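/- Let n ≥ 5. There exists ε₁ > 0 such that for every exponent p on the critical hyperbola with |p − 1| ≤ ε₁ and q = q(p), the ground state (U_p, V_p) is non-degenerate: every pair (φ, ψ) of C² functions on ℝⁿ satisfying −Δφ = p V_p^{p−1} ψ and −Δψ = q U_p^{q−1} φ on ℝⁿ and (φ(x), ψ(x)) → (0,0) as |x| → ∞ is a linear combination of the n+1 pairs (∂U_p/∂x_j, ∂V_p/∂x_j) for j = 1, …, n and (x·∇U_p + (n−2 − n/(p+1)) U_p, x·∇V_p + (n−2 − n/(q+1)) V_p). -/

import Mathlib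

open Filter MeasureTheory Topology

noncomputable def lap {n : ℕ} (f : EuclideanSpace ℝ (Fin n) → ℝ)
    (x : EuclideanSpace ℝ (Fin n)) : ℝ :=
  ∑ i, fderiv ℝ (fderiv ℝ f) x (EuclideanSpace.single i 1) (EuclideanSpace.single i 1)

def IsGroundState (n : ℕ) (p q : ℝ) (U V : EuclideanSpace ℝ (Fin n) → ℝ) : Prop :=
  ContDiff ℝ 2 U ∧ ContDiff ℝ 2 V ∧
  (∀ x, 0 < U x) ∧ (∀ x, 0 < V x) ∧
  (∀ x, -lap U x = V x ^ p) ∧ (∀ x, -lap V x = U x ^ q) ∧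
  (∀ x y, ‖x‖ ≤ ‖y‖ → U y ≤ U x) ∧
  (∀ x y, ‖x‖ ≤ ‖y‖ → V y ≤ V x) ∧
  Tendsto U (cocompact _) (nhds 0) ∧
  Tendsto V (cocompact _) (nhds 0) ∧
  U 0 = 1

namespace LE

abbrev Eu (n : ℕ) := EuclideanSpace ℝ (Fin n)

lemma lap_eq_laplacian {n : ℕ} (f : Eu n → ℝ) (x : Eu n) :
    lap f x = (Laplacian.laplacian f : Eu n → ℝ) x := by
  rw [InnerProductSpace.laplacian_eq_iteratedFDeriv_orthonormalBasis f
    (EuclideanSpace.basisFun (Fin n) ℝ)]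
  simp [lap, iteratedFDeriv_two_apply]

lemma lap_eq_basis {n : ℕ} (f : Eu n → ℝ) (x : Eu n) (b : OrthonormalBasis (Fin n) ℝ (Eu n)) :
    lap f x = ∑ i, fderiv ℝ (fderiv ℝ f) x (b i) (b i) := by
  rw [lap_eq_laplacian, InnerProductSpace.laplacian_eq_iteratedFDeriv_orthonormalBasis f b]
  simp [iteratedFDeriv_two_apply]

lemma lap_congr {n : ℕ} {f g : Eu n → ℝ} {x : Eu n} (h : f =ᶠ[𝓝 x] g) : lap f x = lap g x := by
  unfold lap
  have h1 : fderiv ℝ f =ᶠ[𝓝 x] fderiv ℝ g := h.fderiv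
  rw [h1.fderiv_eq]

lemma lap_add {n : ℕ} {f g : Eu n → ℝ} {x : Eu n} (hf : ContDiffAt ℝ 2 f x)
    (hg : ContDiffAt ℝ 2 g x) : lap (fun y => f y + g y) x = lap f x + lap g x := by
  simp only [lap_eq_laplacian]
  exact hf.laplacian_add hg

lemma lap_sub {n : ℕ} {f g : Eu n → ℝ} {x : Eu n} (hf : ContDiffAt ℝ 2 f x)
    (hg : ContDiffAt ℝ 2 g x) : lap (fun y => f y - g y) x = lap f x - lap g x := by
  simp only [lap_eq_laplacian]
  exact hf.laplacian_sub hg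

lemma lap_cmul {n : ℕ} {f : Eu n → ℝ} {x : Eu n} (c : ℝ) (hf : ContDiffAt ℝ 2 f x) :
    lap (fun y => c * f y) x = c * lap f x := by
  simp only [lap_eq_laplacian]
  exact InnerProductSpace.laplacian_smul c hf

/-- Second derivative along a line. -/
lemma second_line {n : ℕ} {f : Eu n → ℝ} {x v : Eu n} (hf : ContDiffAt ℝ 2 f x)
    {g : ℝ → ℝ} {d : ℝ}
    (h1 : ∀ᶠ t in 𝓝 (0:ℝ), HasDerivAt (fun t => f (x + t • v)) (g t) t)
    (h2 : HasDerivAt g d 0) : fderiv ℝ (fderiv ℝ f) x v v = d := by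
  have hev : ∀ᶠ y in 𝓝 x, DifferentiableAt ℝ f y := by
    have := hf.eventually (by simp)
    filter_upwards [this] with y hy using hy.differentiableAt (by norm_num)
  have hline : ∀ t : ℝ, HasDerivAt (fun t : ℝ => x + t • v) v t := by
    intro t
    simpa using ((hasDerivAt_id t).smul_const v).const_add x
  have hc : Tendsto (fun t : ℝ => x + t • v) (𝓝 0) (𝓝 x) := by
    have := (hline 0).continuousAt.tendsto
    simpa using this
  have hg : g =ᶠ[𝓝 0] fun t => fderiv ℝ f (x + t • v) v := by
    filter_upwards [h1, hc.eventually hev] with t ht hd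
    have := hd.hasFDerivAt.comp_hasDerivAt t (hline t)
    exact ht.unique this
  have hD : DifferentiableAt ℝ (fderiv ℝ f) x :=
    (hf.fderiv_right (m := 1) (by norm_num)).differentiableAt (by norm_num)
  have hD' : HasFDerivAt (fderiv ℝ f) (fderiv ℝ (fderiv ℝ f) x) (x + (0:ℝ) • v) := by
    simpa using hD.hasFDerivAt
  have h3 := hD'.comp_hasDerivAt (0:ℝ) (hline 0)
  have h4 : HasDerivAt (fun t : ℝ => fderiv ℝ f (x + t • v) v)
      (fderiv ℝ (fderiv ℝ f) x v v) 0 := by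
    have := h3.clm_apply (hasDerivAt_const (0:ℝ) v)
    simpa using this
  exact (h4.congr_of_eventuallyEq hg).unique h2

lemma line_deriv {n : ℕ} {f : Eu n → ℝ} {x : Eu n} (hf : ContDiffAt ℝ 2 f x) (v : Eu n) :
    (∀ᶠ t in 𝓝 (0:ℝ), HasDerivAt (fun t : ℝ => f (x + t • v)) (fderiv ℝ f (x + t • v) v) t) ∧
    HasDerivAt (fun t : ℝ => fderiv ℝ f (x + t • v) v) (fderiv ℝ (fderiv ℝ f) x v v) 0 := by
  have hev : ∀ᶠ y in 𝓝 x, DifferentiableAt ℝ f y := by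
    have := hf.eventually (by simp)
    filter_upwards [this] with y hy using hy.differentiableAt (by norm_num)
  have hline : ∀ t : ℝ, HasDerivAt (fun t : ℝ => x + t • v) v t := by
    intro t
    simpa using ((hasDerivAt_id t).smul_const v).const_add x
  have hc : Tendsto (fun t : ℝ => x + t • v) (𝓝 0) (𝓝 x) := by
    have := (hline 0).continuousAt.tendsto
    simpa using this
  have hD : DifferentiableAt ℝ (fderiv ℝ f) x :=
    (hf.fderiv_right (m := 1) (by norm_num)).differentiableAt (by norm_num)
  have hD' : HasFDerivAt (fderiv ℝ f) (fderiv ℝ (fderiv ℝ f) x) (x + (0:ℝ) • v) := by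
    simpa using hD.hasFDerivAt
  have h3 := hD'.comp_hasDerivAt (0:ℝ) (hline 0)
  refine ⟨?_, ?_⟩
  · filter_upwards [hc.eventually hev] with t hd
    exact hd.hasFDerivAt.comp_hasDerivAt t (hline t)
  · have := h3.clm_apply (hasDerivAt_const (0:ℝ) v)
    simpa using this

lemma lap_comp_isometry {n : ℕ} {f : Eu n → ℝ} {x : Eu n} (σ : Eu n ≃ₗᵢ[ℝ] Eu n)
    (hf : ContDiffAt ℝ 2 f (σ x)) : lap (fun y => f (σ y)) x = lap f (σ x) := by
  have hc : ContDiffAt ℝ 2 (fun y => f (σ y)) x :=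
    hf.comp x σ.contDiff.contDiffAt
  rw [lap_eq_basis f (σ x) ((EuclideanSpace.basisFun (Fin n) ℝ).map σ),
    lap_eq_basis _ x (EuclideanSpace.basisFun (Fin n) ℝ)]
  refine Finset.sum_congr rfl fun i _ => ?_
  obtain ⟨h1, h2⟩ := line_deriv hf (σ (EuclideanSpace.basisFun (Fin n) ℝ i))
  refine second_line hc (g := fun t => fderiv ℝ f (σ x + t • σ (EuclideanSpace.basisFun (Fin n) ℝ i)) (σ (EuclideanSpace.basisFun (Fin n) ℝ i))) ?_ ?_
  · simpa [map_add, map_smul] using h1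
  · simpa using h2

lemma lap_linear_mul {n : ℕ} {f : Eu n → ℝ} {x : Eu n} (e : Eu n) (hf : ContDiffAt ℝ 2 f x) :
    lap (fun y => inner ℝ e y * f y) x = inner ℝ e x * lap f x + 2 * fderiv ℝ f x e := by
  have hl : ContDiff ℝ 2 (fun y : Eu n => inner ℝ e y) := contDiff_const.inner ℝ contDiff_id
  have hc : ContDiffAt ℝ 2 (fun y => inner ℝ e y * f y) x := hl.contDiffAt.mul hf
  have key : ∀ i, fderiv ℝ (fderiv ℝ (fun y => inner ℝ e y * f y)) x
      (EuclideanSpace.single i 1) (EuclideanSpace.single i 1)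
      = inner ℝ e x * fderiv ℝ (fderiv ℝ f) x (EuclideanSpace.single i 1) (EuclideanSpace.single i 1)
       + 2 * (e i * fderiv ℝ f x (EuclideanSpace.single i 1)) := by
    intro i
    set v : Eu n := EuclideanSpace.single i 1 with hv
    have hev : inner ℝ e v = e i := by simp [hv, EuclideanSpace.inner_single_right]
    obtain ⟨h1, h2⟩ := line_deriv hf v
    have hlin : ∀ t : ℝ, HasDerivAt (fun t : ℝ => inner ℝ e (x + t • v)) (e i) t := by
      intro t
      have : (fun t : ℝ => inner ℝ e (x + t • v)) = fun t => inner ℝ e x + t * e i := by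
        ext t; rw [inner_add_right, inner_smul_right, hev]
      rw [this]
      simpa using ((hasDerivAt_id t).mul_const (e i)).const_add (inner ℝ e x)
    refine second_line hc (g := fun t => e i * f (x + t • v) +
      inner ℝ e (x + t • v) * fderiv ℝ f (x + t • v) v) ?_ ?_
    · filter_upwards [h1] with t ht
      exact (hlin t).mul ht
    · have h0 := h1.self_of_nhds
      have := (h0.const_mul (e i)).add ((hlin 0).mul h2)
      refine this.congr_deriv ?_
      simp
      ring
  unfold lap
  rw [Finset.sum_congr rfl fun i _ => key i, Finset.sum_add_distrib, ← Finset.mul_sum,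
    ← Finset.mul_sum]
  congr 2
  have : e = ∑ i, e i • (EuclideanSpace.single i (1:ℝ) : Eu n) := by
    have := (EuclideanSpace.basisFun (Fin n) ℝ).sum_repr e
    simpa using this.symm
  conv_rhs => rw [this, map_sum]
  simp

lemma norm_line {n : ℕ} {z v : Eu n} (hz : z ≠ 0) :
    HasDerivAt (fun t : ℝ => ‖z + t • v‖) (inner ℝ z v / ‖z‖) 0 := by
  have h1 : HasDerivAt (fun t : ℝ => ‖z + t • v‖ ^ 2) (2 * inner ℝ (z + (0:ℝ) • v) v) 0 := by
    have hl : HasDerivAt (fun t : ℝ => z + t • v) v 0 := by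
      simpa using ((hasDerivAt_id (0:ℝ)).smul_const v).const_add z
    exact hl.norm_sq
  have h2 : HasDerivAt (fun t : ℝ => √(‖z + t • v‖ ^ 2)) (2 * inner ℝ (z + (0:ℝ) • v) v /
      (2 * √(‖z + (0:ℝ) • v‖ ^ 2))) 0 := by
    apply h1.sqrt
    simp [hz]
  have h3 : (fun t : ℝ => √(‖z + t • v‖ ^ 2)) = fun t : ℝ => ‖z + t • v‖ := by
    ext t; rw [Real.sqrt_sq (norm_nonneg _)]
  rw [h3] at h2
  refine h2.congr_deriv ?_
  simp only [zero_smul, add_zero]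
  rw [Real.sqrt_sq (norm_nonneg _)]
  have : ‖z‖ ≠ 0 := norm_ne_zero_iff.mpr hz
  field_simp

lemma norm_line' {n : ℕ} {z v : Eu n} (t : ℝ) (hz : z + t • v ≠ 0) :
    HasDerivAt (fun t : ℝ => ‖z + t • v‖) (inner ℝ (z + t • v) v / ‖z + t • v‖) t := by
  have h := norm_line (v := v) hz
  have h' : HasDerivAt (fun s : ℝ => ‖z + t • v + s • v‖) (inner ℝ (z + t • v) v / ‖z + t • v‖)
    (t - t) := by simpa using h
  have := h'.comp_sub_const t t
  refine this.congr_of_eventuallyEq (Eventually.of_forall fun s => ?_)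
  simp only
  congr 1
  rw [add_assoc, ← add_smul]; ring_nf

lemma contDiffAt_radial {n : ℕ} {g : ℝ → ℝ} {x y : Eu n} (hxy : x - y ≠ 0)
    (hg : ContDiffAt ℝ 2 g ‖x - y‖) : ContDiffAt ℝ 2 (fun z : Eu n => g ‖z - y‖) x := by
  have h1 : ContDiffAt ℝ 2 (fun z : Eu n => ‖z - y‖) x :=
    (contDiffAt_id.sub contDiffAt_const).norm ℝ hxy
  exact hg.comp x h1

lemma fderiv_radial {n : ℕ} {g : ℝ → ℝ} {g1 : ℝ} {x : Eu n} (v : Eu n) (hx : x ≠ 0)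
    (hg : ContDiffAt ℝ 2 g ‖x‖) (h1 : HasDerivAt g g1 ‖x‖) :
    fderiv ℝ (fun z : Eu n => g ‖z‖) x v = g1 * (inner ℝ x v / ‖x‖) := by
  have hc : ContDiffAt ℝ 2 (fun z : Eu n => g ‖z‖) x := by
    simpa using contDiffAt_radial (y := 0) (x := x) (g := g) (by simpa using hx) (by simpa using hg)
  obtain ⟨h, -⟩ := line_deriv hc v
  have h0 := h.self_of_nhds
  have h2 : HasDerivAt g g1 ‖x + (0:ℝ) • v‖ := by simpa using h1
  have h3 := h2.comp (0:ℝ) (norm_line (v := v) hx)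
  have := h0.unique h3
  simpa using this

lemma lap_radial {n : ℕ} {g g' : ℝ → ℝ} {g2 : ℝ} {x y : Eu n} (hxy : x - y ≠ 0)
    (hg : ContDiffAt ℝ 2 g ‖x - y‖) (h1 : ∀ᶠ r in 𝓝 ‖x - y‖, HasDerivAt g (g' r) r)
    (h2 : HasDerivAt g' g2 ‖x - y‖) :
    lap (fun z : Eu n => g ‖z - y‖) x = g2 + (n - 1) / ‖x - y‖ * g' ‖x - y‖ := by
  set w := x - y with hw
  have hr : ‖w‖ ≠ 0 := norm_ne_zero_iff.mpr hxy
  have key : ∀ i, fderiv ℝ (fderiv ℝ (fun z : Eu n => g ‖z - y‖)) x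
      (EuclideanSpace.single i 1) (EuclideanSpace.single i 1)
      = g2 * (w i ^ 2 / ‖w‖ ^ 2) + g' ‖w‖ * (1 / ‖w‖ - w i ^ 2 / ‖w‖ ^ 3) := by
    intro i
    set v : Eu n := EuclideanSpace.single i 1 with hv
    have hwv : inner ℝ w v = w i := by simp [hv, EuclideanSpace.inner_single_right]
    have hvv : inner ℝ v v = 1 := by simp [hv]
    have heq : ∀ t : ℝ, x + t • v - y = w + t • v := by intro t; rw [hw]; abel
    have hcont : Tendsto (fun t : ℝ => w + t • v) (𝓝 0) (𝓝 w) := by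
      have : Continuous (fun t : ℝ => w + t • v) := by fun_prop
      simpa using this.tendsto 0
    have hne : ∀ᶠ t in 𝓝 (0:ℝ), w + t • v ≠ 0 := hcont.eventually (isOpen_ne.mem_nhds hxy)
    have hnt : Tendsto (fun t : ℝ => ‖w + t • v‖) (𝓝 0) (𝓝 ‖w‖) := hcont.norm
    refine second_line (contDiffAt_radial hxy hg)
      (g := fun t => g' ‖w + t • v‖ * ((w i + t) / ‖w + t • v‖)) ?_ ?_
    · filter_upwards [hne, hnt.eventually h1] with t ht1 ht2
      simp only [heq]
      have := ht2.comp t (norm_line' t ht1)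
      refine this.congr_deriv ?_
      rw [inner_add_left, inner_smul_left, hwv, hvv]
      simp
    · have e1 : HasDerivAt (fun t : ℝ => ‖w + t • v‖) (w i / ‖w‖) 0 := by
        simpa [hwv] using norm_line (v := v) hxy
      have h2' : HasDerivAt g' g2 ‖w + (0:ℝ) • v‖ := by simpa using h2
      have e2 := h2'.comp (0:ℝ) e1
      have e3 : HasDerivAt (fun t : ℝ => w i + t) 1 0 := by
        simpa using (hasDerivAt_id (0:ℝ)).const_add (w i)
      have e4 := e3.div e1 (by simpa using hr)
      have := e2.mul e4
      refine this.congr_deriv ?_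
      simp
      field_simp
  unfold lap
  rw [Finset.sum_congr rfl fun i _ => key i, Finset.sum_add_distrib, ← Finset.mul_sum,
    ← Finset.mul_sum, Finset.sum_sub_distrib]
  have hs : ∑ i, w i ^ 2 = ‖w‖ ^ 2 := by
    rw [EuclideanSpace.norm_sq_eq]; simp
  simp only [← Finset.sum_div, hs]
  simp
  field_simp

end LE

namespace LE

lemma second_nonpos {f g : ℝ → ℝ} {d : ℝ} (hmax : IsLocalMax f 0)
    (h1 : ∀ᶠ t in 𝓝 (0:ℝ), HasDerivAt f (g t) t) (h2 : HasDerivAt g d 0) : d ≤ 0 := by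
  by_contra hd
  push Not at hd
  have hdf : deriv f =ᶠ[𝓝 0] g := by
    filter_upwards [h1] with t ht using ht.deriv
  have h0 : deriv f 0 = 0 := hmax.deriv_eq_zero
  have h2' : deriv (deriv f) 0 = d := by
    rw [hdf.deriv_eq]; exact h2.deriv
  have hmin : IsLocalMin f 0 := by
    apply isLocalMin_of_deriv_deriv_pos (by rw [h2']; exact hd) h0
    exact h1.self_of_nhds.continuousAt
  have hconst : f =ᶠ[𝓝 0] fun _ => f 0 := by
    filter_upwards [hmin, hmax] with t a b using le_antisymm b a
  have : deriv f =ᶠ[𝓝 0] fun _ => 0 := by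
    have := hconst.deriv
    simpa using this
  rw [this.deriv_eq] at h2'
  simp at h2'
  linarith

lemma maxprin {n : ℕ} (hn : 1 ≤ n) {Ω C : Set (Eu n)} (hΩ : IsOpen Ω) (hC : IsClosed C)
    (hsub : Ω ⊆ C) {h : Eu n → ℝ} (hc : ContinuousOn h C) (h2 : ∀ x ∈ Ω, ContDiffAt ℝ 2 h x)
    (hl : ∀ x ∈ Ω, 0 ≤ lap h x) (hb : ∀ x ∈ C, x ∉ Ω → h x ≤ 0)
    (hinf : ∀ ε > 0, ∃ R : ℝ, ∀ x ∈ Ω, R ≤ ‖x‖ → h x ≤ ε) : ∀ x ∈ Ω, h x ≤ 0 := by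
  intro x0 hx0
  by_contra hpos
  push Not at hpos
  set ε := h x0 / 2 with hε
  have hεpos : 0 < ε := by positivity
  obtain ⟨R, hR⟩ := hinf (ε / 2) (by positivity)
  set K : Set (Eu n) := C ∩ h ⁻¹' (Set.Ici ε) with hK
  have hKclosed : IsClosed K := hc.preimage_isClosed_of_isClosed hC isClosed_Ici
  have hKΩ : ∀ x ∈ K, x ∈ Ω := by
    intro x hx
    by_contra hxn
    have := hb x hx.1 hxn
    have h' : ε ≤ h x := hx.2
    linarith
  have hKR : ∀ x ∈ K, ‖x‖ ≤ |R| := by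
    intro x hx
    by_contra hxn
    push Not at hxn
    have := hR x (hKΩ x hx) ((le_abs_self R).trans hxn.le)
    have h' : ε ≤ h x := hx.2
    linarith
  have hKcomp : IsCompact K := by
    apply (isCompact_closedBall (0 : Eu n) |R|).of_isClosed_subset hKclosed
    intro x hx
    simpa using hKR x hx
  set δ := ε / (2 * (R ^ 2 + 1)) with hδ
  have hδpos : 0 < δ := by positivity
  have hδR : δ * R ^ 2 ≤ ε / 2 := by
    rw [hδ, div_mul_eq_mul_div, div_le_div_iff₀ (by positivity) (by norm_num)]
    nlinarith
  have hkc : ContinuousOn (fun x => h x + δ * ‖x‖ ^ 2) K := by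
    apply ContinuousOn.add (hc.mono Set.inter_subset_left)
    fun_prop
  have hx0K : x0 ∈ K := ⟨hsub hx0, by change ε ≤ h x0; linarith⟩
  obtain ⟨y, hyK, hymax⟩ := hKcomp.exists_isMaxOn ⟨x0, hx0K⟩ hkc
  have hyx0 : h x0 + δ * ‖x0‖ ^ 2 ≤ h y + δ * ‖y‖ ^ 2 := hymax hx0K
  have hyR : δ * ‖y‖ ^ 2 ≤ ε / 2 := by
    refine le_trans (mul_le_mul_of_nonneg_left ?_ hδpos.le) hδR
    have := pow_le_pow_left₀ (norm_nonneg y) (hKR y hyK) 2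
    simpa using this
  have hyε : ε < h y := by
    have : 0 ≤ δ * ‖x0‖ ^ 2 := by positivity
    linarith
  have hyΩ := hKΩ y hyK
  have hyC2 := h2 y hyΩ
  have hloc : ∀ᶠ x in 𝓝 y, h x + δ * ‖x‖ ^ 2 ≤ h y + δ * ‖y‖ ^ 2 := by
    filter_upwards [hΩ.mem_nhds hyΩ, hyC2.continuousAt.eventually (lt_mem_nhds hyε)] with x a b
    exact hymax (show x ∈ K from ⟨hsub a, le_of_lt b⟩)
  have key : ∀ i, fderiv ℝ (fderiv ℝ h) y (EuclideanSpace.single i 1) (EuclideanSpace.single i 1)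
      ≤ - (2 * δ) := by
    intro i
    set v : Eu n := EuclideanSpace.single i 1 with hv
    obtain ⟨l1, l2⟩ := line_deriv hyC2 v
    have hvv : inner ℝ v v = (1:ℝ) := by simp [hv]
    have hnorm : ∀ t : ℝ, ‖y + t • v‖ ^ 2 = ‖y‖ ^ 2 + 2 * t * inner ℝ y v + t ^ 2 := by
      intro t
      rw [← real_inner_self_eq_norm_sq, inner_add_left, inner_add_right, inner_add_right,
        inner_smul_left, inner_smul_right, inner_smul_left, inner_smul_right, hvv,
        real_inner_comm y v, real_inner_self_eq_norm_sq]
      simp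
      ring
    have hcont : Tendsto (fun t : ℝ => y + t • v) (𝓝 0) (𝓝 y) := by
      have : Continuous (fun t : ℝ => y + t • v) := by fun_prop
      simpa using this.tendsto 0
    have hm : IsLocalMax (fun t : ℝ => h (y + t • v) + δ * ‖y + t • v‖ ^ 2) 0 := by
      filter_upwards [hcont.eventually hloc] with t ht
      simpa using ht
    have := second_nonpos (g := fun t => fderiv ℝ h (y + t • v) v + δ * (2 * inner ℝ y v + 2 * t))
      (d := fderiv ℝ (fderiv ℝ h) y v v + δ * 2) hm ?_ ?_
    · linarith
    · filter_upwards [l1] with t ht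
      refine ht.add (HasDerivAt.const_mul δ ?_)
      have e : (fun t : ℝ => ‖y + t • v‖ ^ 2) = fun t => ‖y‖ ^ 2 + 2 * t * inner ℝ y v + t ^ 2 := by
        ext t; exact hnorm t
      rw [e]
      have := ((((hasDerivAt_id t).const_mul 2).mul_const (inner ℝ y v)).const_add (‖y‖ ^ 2)).add
        ((hasDerivAt_id t).pow 2)
      refine this.congr_deriv ?_
      simp
    · refine l2.add (HasDerivAt.const_mul δ ?_)
      simpa using ((hasDerivAt_id (0:ℝ)).const_mul 2).const_add (2 * inner ℝ y v)
  have hsum : lap h y ≤ ∑ _i : Fin n, - (2 * δ) := Finset.sum_le_sum fun i _ => key i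
  have h0 := hl y hyΩ
  simp at hsum
  have : (1:ℝ) ≤ n := by exact_mod_cast hn
  nlinarith

end LE

namespace LE

lemma mono_aux {f f' : ℝ → ℝ} {a b : ℝ} (hab : a ≤ b) (hc : ContinuousOn f (Set.Icc a b))
    (hd : ∀ x ∈ Set.Ioo a b, HasDerivAt f (f' x) x) (hnn : ∀ x ∈ Set.Ioo a b, 0 ≤ f' x) :
    f a ≤ f b := by
  have := monotoneOn_of_deriv_nonneg (convex_Icc a b) hc
    (fun x hx => by
      rw [interior_Icc] at hx
      exact (hd x hx).differentiableAt.differentiableWithinAt)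
    (fun x hx => by
      rw [interior_Icc] at hx
      rw [(hd x hx).deriv]; exact hnn x hx)
  exact this (Set.left_mem_Icc.2 hab) (Set.right_mem_Icc.2 hab) hab

/-- comparison of two functions through their derivatives -/
lemma cmp_aux {f g f' g' : ℝ → ℝ} {a b : ℝ} (hab : a ≤ b) (hcf : ContinuousOn f (Set.Icc a b))
    (hcg : ContinuousOn g (Set.Icc a b))
    (hdf : ∀ x ∈ Set.Ioo a b, HasDerivAt f (f' x) x)
    (hdg : ∀ x ∈ Set.Ioo a b, HasDerivAt g (g' x) x)
    (h : ∀ x ∈ Set.Ioo a b, f' x ≤ g' x) : f b - f a ≤ g b - g a := by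
  have := mono_aux (f := fun x => g x - f x) (f' := fun x => g' x - f' x) hab (hcg.sub hcf)
    (fun x hx => (hdg x hx).sub (hdf x hx)) (fun x hx => by linarith [h x hx])
  linarith

structure Flux (n : ℕ) (f a g : ℝ → ℝ) : Prop where
  df : ∀ r, 0 < r → HasDerivAt f (-(a r / r ^ (n - 1))) r
  da : ∀ r, 0 < r → HasDerivAt a (r ^ (n - 1) * g r) r
  cf : ContinuousOn f (Set.Ici 0)
  ca : ContinuousOn a (Set.Ici 0)
  a0 : a 0 = 0

lemma Flux.congr {n : ℕ} {f a g g' : ℝ → ℝ} (h : Flux n f a g) (hg : ∀ r, 0 < r → g r = g' r) :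
    Flux n f a g' :=
  ⟨h.df, fun r hr => by rw [← hg r hr]; exact h.da r hr, h.cf, h.ca, h.a0⟩

lemma Flux.sub {n : ℕ} {f a g f' a' g' : ℝ → ℝ} (h : Flux n f a g) (h' : Flux n f' a' g') :
    Flux n (fun r => f r - f' r) (fun r => a r - a' r) (fun r => g r - g' r) := by
  refine ⟨fun r hr => ?_, fun r hr => ?_, h.cf.sub h'.cf, h.ca.sub h'.ca, by simp [h.a0, h'.a0]⟩
  · exact ((h.df r hr).sub (h'.df r hr)).congr_deriv (by ring)
  · exact ((h.da r hr).sub (h'.da r hr)).congr_deriv (by ring)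

lemma Flux.cmul {n : ℕ} {f a g : ℝ → ℝ} (c : ℝ) (h : Flux n f a g) :
    Flux n (fun r => c * f r) (fun r => c * a r) (fun r => c * g r) := by
  refine ⟨fun r hr => ?_, fun r hr => ?_, continuousOn_const.mul h.cf, continuousOn_const.mul h.ca,
    by simp [h.a0]⟩
  · exact ((h.df r hr).const_mul c).congr_deriv (by ring)
  · exact ((h.da r hr).const_mul c).congr_deriv (by ring)

lemma Flux.a_le {n : ℕ} (hn : 1 ≤ n) {f a g : ℝ → ℝ} (h : Flux n f a g) {T M : ℝ}
    (hg : ∀ s, 0 < s → s < T → g s ≤ M) {r : ℝ} (h0 : 0 ≤ r) (hr : r ≤ T) :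
    a r ≤ M * r ^ n / n := by
  have hn' : (n : ℝ) ≠ 0 := by positivity
  have := cmp_aux (f := a) (g := fun s => M * s ^ n / n) (f' := fun s => s ^ (n - 1) * g s)
    (g' := fun s => s ^ (n - 1) * M) h0 (h.ca.mono Set.Icc_subset_Ici_self) (by fun_prop)
    (fun x hx => h.da x hx.1) (fun x hx => by
      refine (((hasDerivAt_pow n x).const_mul M).div_const (n : ℝ)).congr_deriv ?_
      field_simp) (fun x hx => by
      have := hg x hx.1 (hx.2.trans_le hr)
      have := hx.1.le
      gcongr)
  simp only [h.a0] at this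
  rw [zero_pow (by omega)] at this
  simpa using this

lemma Flux.f_ge {n : ℕ} (hn : 1 ≤ n) {f a g : ℝ → ℝ} (h : Flux n f a g) {T M : ℝ}
    (hg : ∀ s, 0 < s → s < T → g s ≤ M) {r : ℝ} (h0 : 0 ≤ r) (hr : r ≤ T) :
    f 0 - M * r ^ 2 / (2 * n) ≤ f r := by
  have hn' : (n : ℝ) ≠ 0 := by positivity
  have := cmp_aux (f := fun s => - (M * s ^ 2 / (2 * n))) (g := f) (f' := fun s => - (M * s / n))
    (g' := fun s => -(a s / s ^ (n - 1))) h0 (by fun_prop) (h.cf.mono Set.Icc_subset_Ici_self)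
    (fun x hx => by
      refine (((hasDerivAt_pow 2 x).const_mul M).div_const (2 * n : ℝ)).neg.congr_deriv ?_
      field_simp; norm_num) (fun x hx => h.df x hx.1) (fun x hx => by
      have h1 := h.a_le hn hg hx.1.le (hx.2.le.trans hr)
      have h2 := hx.1
      apply neg_le_neg
      rw [div_le_iff₀ (by positivity)]
      calc a x ≤ M * x ^ n / n := h1
        _ = M * x / n * x ^ (n - 1) := by
          obtain ⟨m, rfl⟩ := Nat.exists_eq_add_of_le' hn
          simp only [Nat.add_sub_cancel, pow_succ]; ring)
  simp at this
  linarith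

lemma Flux.neg {n : ℕ} {f a g : ℝ → ℝ} (h : Flux n f a g) :
    Flux n (fun r => - f r) (fun r => - a r) (fun r => - g r) := by
  simpa using h.cmul (-1)

lemma Flux.a_ge {n : ℕ} (hn : 1 ≤ n) {f a g : ℝ → ℝ} (h : Flux n f a g) {T M : ℝ}
    (hg : ∀ s, 0 < s → s < T → M ≤ g s) {r : ℝ} (h0 : 0 ≤ r) (hr : r ≤ T) :
    M * r ^ n / n ≤ a r := by
  have := h.neg.a_le hn (T := T) (M := -M) (fun s h1 h2 => by linarith [hg s h1 h2]) h0 hr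
  have h3 : -M * r ^ n / n = - (M * r ^ n / n) := by ring
  linarith

lemma Flux.f_le {n : ℕ} (hn : 1 ≤ n) {f a g : ℝ → ℝ} (h : Flux n f a g) {T M : ℝ}
    (hg : ∀ s, 0 < s → s < T → M ≤ g s) {r : ℝ} (h0 : 0 ≤ r) (hr : r ≤ T) :
    f r ≤ f 0 - M * r ^ 2 / (2 * n) := by
  have := h.neg.f_ge hn (T := T) (M := -M) (fun s h1 h2 => by linarith [hg s h1 h2]) h0 hr
  have h3 : -M * r ^ 2 / (2 * n) = - (M * r ^ 2 / (2 * n)) := by ring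
  linarith

lemma Flux.exp_bd {n : ℕ} {f a g : ℝ → ℝ} (h : Flux n f a g) {T A K e : ℝ}
    (hA : 0 ≤ A) (he : 0 ≤ e) (hK : 0 < K)
    (hg : ∀ s, 0 < s → s ≤ T → g s ≤ A * Real.exp (K * s) + e) {r : ℝ} (h0 : 0 ≤ r) (hr : r ≤ T) :
    f 0 - f r ≤ A * Real.exp (K * r) / K ^ 2 + e * r ^ 2 / 2 := by
  have hE : ∀ x : ℝ, HasDerivAt (fun s => Real.exp (K * s)) (K * Real.exp (K * x)) x := by
    intro x
    have := ((hasDerivAt_id x).const_mul K).exp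
    simpa [mul_comm] using this
  have ha : ∀ x, 0 ≤ x → x ≤ T → a x ≤ x ^ (n - 1) * (A * Real.exp (K * x) / K + e * x) := by
    intro x hx0 hxT
    have := cmp_aux (f := a) (g := fun s => s ^ (n - 1) * (A * Real.exp (K * s) / K + e * s))
      (f' := fun s => s ^ (n - 1) * g s)
      (g' := fun s => ((n - 1 : ℕ) : ℝ) * s ^ (n - 1 - 1) * (A * Real.exp (K * s) / K + e * s) +
        s ^ (n - 1) * (A * (K * Real.exp (K * s)) / K + e * 1))
      hx0 (h.ca.mono Set.Icc_subset_Ici_self) (by fun_prop)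
      (fun x hx => h.da x hx.1) (fun x hx =>
        (hasDerivAt_pow (n - 1) x).mul ((((hE x).const_mul A).div_const K).add
          ((hasDerivAt_id x).const_mul e))) (fun s hs => by
        have h1 := hg s hs.1 (hs.2.le.trans hxT)
        have h2 := hs.1
        have h3 : A * (K * Real.exp (K * s)) / K + e * 1 = A * Real.exp (K * s) + e := by
          field_simp
        rw [h3]
        have h4 : s ^ (n - 1) * g s ≤ s ^ (n - 1) * (A * Real.exp (K * s) + e) := by gcongr
        have h5 : 0 ≤ ((n - 1 : ℕ) : ℝ) * s ^ (n - 1 - 1) * (A * Real.exp (K * s) / K + e * s) := by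
          positivity
        linarith)
    rw [h.a0] at this
    have h6 : 0 ≤ (0:ℝ) ^ (n - 1) * (A * Real.exp (K * 0) / K + e * 0) := by positivity
    linarith
  have := cmp_aux (f := fun s => - f s)
    (g := fun s => A * Real.exp (K * s) / K ^ 2 + e * s ^ 2 / 2)
    (f' := fun s => a s / s ^ (n - 1)) (g' := fun s => A * Real.exp (K * s) / K + e * s)
    h0 ((h.cf.mono Set.Icc_subset_Ici_self).neg) (by fun_prop)
    (fun x hx => ((h.df x hx.1).neg).congr_deriv (by ring)) (fun x hx => by
      refine ((((hE x).const_mul A).div_const (K ^ 2)).add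
        (((hasDerivAt_pow 2 x).const_mul e).div_const 2)).congr_deriv ?_
      field_simp
      norm_num
      ring) (fun x hx => by
        have h2 := hx.1
        have := ha x h2.le (hx.2.le.trans hr)
        rw [div_le_iff₀ (by positivity)]
        linarith)
  have h6 : 0 ≤ A * Real.exp (K * 0) / K ^ 2 + e * 0 ^ 2 / 2 := by positivity
  linarith

/-- Volterra estimate -/
lemma volterra {n : ℕ} (hn : 1 ≤ n) {R C : ℝ} (hR : 0 ≤ R) (hC : 0 ≤ C) :
    ∃ L : ℝ, 0 < L ∧ ∀ (D a f G b g : ℝ → ℝ) (e : ℝ), 0 ≤ e → Flux n D a f → Flux n G b g →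
      |D 0| ≤ e → |G 0| ≤ e →
      (∀ r, 0 < r → r ≤ R → |f r| ≤ C * (|D r| + |G r|) + e) →
      (∀ r, 0 < r → r ≤ R → |g r| ≤ C * (|D r| + |G r|) + e) →
      ∀ r, 0 ≤ r → r ≤ R → |D r| ≤ L * e ∧ |G r| ≤ L * e ∧ |a r| ≤ L * e ∧ |b r| ≤ L * e := by
  set K := 2 * (C + 1) with hKdef
  have hK : 0 < K := by positivity
  have hK2 : 4 * C ≤ K ^ 2 := by rw [hKdef]; nlinarith
  set L0 := Real.exp (K * R) * (4 * (1 + R ^ 2)) with hL0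
  have hL0p : 0 < L0 := by positivity
  set L1 := (C * (2 * L0) + 1) * R ^ n / n with hL1
  have hL1p : 0 ≤ L1 := by positivity
  refine ⟨L0 + L1, by positivity, ?_⟩
  intro D a f G b g e he hD hG hD0 hG0 hf hg
  have hcont : ContinuousOn (fun r => Real.exp (-(K * r)) * (|D r| + |G r|)) (Set.Icc 0 R) := by
    apply ContinuousOn.mul (by fun_prop)
    exact ((hD.cf.mono Set.Icc_subset_Ici_self).abs).add ((hG.cf.mono Set.Icc_subset_Ici_self).abs)
  obtain ⟨r0, hr0, hmax⟩ := isCompact_Icc.exists_isMaxOn ⟨0, Set.left_mem_Icc.2 hR⟩ hcont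
  set M := Real.exp (-(K * r0)) * (|D r0| + |G r0|) with hM
  have hMnn : 0 ≤ M := by positivity
  have hb : ∀ r, 0 ≤ r → r ≤ R → |D r| + |G r| ≤ M * Real.exp (K * r) := by
    intro r h0 h1
    have h2 : Real.exp (-(K * r)) * (|D r| + |G r|) ≤ M := hmax ⟨h0, h1⟩
    rw [Real.exp_neg] at h2
    have h3 : 0 < Real.exp (K * r) := Real.exp_pos _
    field_simp at h2
    linarith
  have hf' : ∀ r, 0 < r → r ≤ R → |f r| ≤ C * M * Real.exp (K * r) + e := by
    intro r h0 h1
    have h2 := hf r h0 h1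
    have h3 := mul_le_mul_of_nonneg_left (hb r h0.le h1) hC
    linarith
  have hg' : ∀ r, 0 < r → r ≤ R → |g r| ≤ C * M * Real.exp (K * r) + e := by
    intro r h0 h1
    have h2 := hg r h0 h1
    have h3 := mul_le_mul_of_nonneg_left (hb r h0.le h1) hC
    linarith
  have hCM : 0 ≤ C * M := by positivity
  have e1 := hD.exp_bd hCM he hK (fun s h0 h1 => (le_abs_self _).trans (hf' s h0 h1)) hr0.1 hr0.2
  have e2 := hD.neg.exp_bd hCM he hK (fun s h0 h1 => (neg_le_abs _).trans (hf' s h0 h1)) hr0.1 hr0.2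
  have e3 := hG.exp_bd hCM he hK (fun s h0 h1 => (le_abs_self _).trans (hg' s h0 h1)) hr0.1 hr0.2
  have e4 := hG.neg.exp_bd hCM he hK (fun s h0 h1 => (neg_le_abs _).trans (hg' s h0 h1)) hr0.1 hr0.2
  have hE : 1 ≤ Real.exp (K * r0) := Real.one_le_exp (mul_nonneg hK.le hr0.1)
  set E := Real.exp (K * r0) with hEdef
  have hq : C * M * E / K ^ 2 ≤ M * E / 4 := by
    rw [div_le_div_iff₀ (by positivity) (by norm_num)]
    have : 0 ≤ M * E := by positivity
    nlinarith
  have hr2 : e * r0 ^ 2 / 2 ≤ e * R ^ 2 / 2 := by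
    have h1 := hr0.1
    have h2 := hr0.2
    gcongr
  have hDa : |D r0| ≤ M * E / 4 + e * R ^ 2 / 2 + e := by
    rw [abs_le] at hD0 ⊢
    constructor <;> linarith [hD0.1, hD0.2]
  have hGa : |G r0| ≤ M * E / 4 + e * R ^ 2 / 2 + e := by
    rw [abs_le] at hG0 ⊢
    constructor <;> linarith [hG0.1, hG0.2]
  have hME : M * E = |D r0| + |G r0| := by
    rw [hM, hEdef, Real.exp_neg]
    field_simp
  have hMle : M ≤ e * (4 * (1 + R ^ 2)) := by
    have h1 : M * E ≤ e * (4 * (1 + R ^ 2)) := by nlinarith [mul_nonneg he (sq_nonneg R)]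
    have h2 : M ≤ M * E := le_mul_of_one_le_right hMnn hE
    linarith
  have hfin : ∀ r, 0 ≤ r → r ≤ R → |D r| + |G r| ≤ L0 * e := by
    intro r h0 h1
    calc |D r| + |G r| ≤ M * Real.exp (K * r) := hb r h0 h1
      _ ≤ (e * (4 * (1 + R ^ 2))) * Real.exp (K * R) := by gcongr
      _ = L0 * e := by rw [hL0]; ring
  have habs : ∀ (D a f : ℝ → ℝ), Flux n D a f →
      (∀ r, 0 < r → r ≤ R → |f r| ≤ C * (2 * L0) * e + e) → ∀ r, 0 ≤ r → r ≤ R → |a r| ≤ L1 * e := by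
    intro D a f hD hf r h0 h1
    have e1 := hD.a_le hn (fun s h0 h1 => (le_abs_self _).trans (hf s h0 h1.le)) h0 h1
    have e2 := hD.neg.a_le hn (fun s h0 h1 => (neg_le_abs _).trans (hf s h0 h1.le)) h0 h1
    have e3 : (C * (2 * L0) * e + e) * r ^ n / n ≤ L1 * e := by
      calc (C * (2 * L0) * e + e) * r ^ n / n ≤ (C * (2 * L0) * e + e) * R ^ n / n := by gcongr
        _ = L1 * e := by rw [hL1]; ring
    rw [abs_le]; constructor <;> linarith
  have hbd : ∀ r, 0 < r → r ≤ R → C * (|D r| + |G r|) + e ≤ C * (2 * L0) * e + e := by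
    intro r h0 h1
    have := mul_le_mul_of_nonneg_left (hfin r h0.le h1) hC
    nlinarith [mul_nonneg (mul_nonneg hC hL0p.le) he]
  intro r h0 h1
  have h2 := hfin r h0 h1
  have h3 := habs D a f hD (fun r h0 h1 => (hf r h0 h1).trans (hbd r h0 h1)) r h0 h1
  have h4 := habs G b g hG (fun r h0 h1 => (hg r h0 h1).trans (hbd r h0 h1)) r h0 h1
  have h5 := abs_nonneg (D r)
  have h6 := abs_nonneg (G r)
  have h7 := mul_nonneg hL1p he
  have h8 := mul_nonneg hL0p.le he
  refine ⟨?_, ?_, ?_, ?_⟩ <;> linarith [add_mul L0 L1 e]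

/-- radial profile of a C2 radial function -/
lemma flux_of_radial {n : ℕ} (hn : 2 ≤ n) {F : Eu n → ℝ} (hF : ContDiff ℝ 2 F)
    (hrad : ∀ x y, ‖x‖ = ‖y‖ → F x = F y) {e : Eu n} (he : ‖e‖ = 1) :
    Flux n (fun r => F (r • e)) (fun r => -(r ^ (n - 1) * fderiv ℝ F (r • e) e))
      (fun r => - lap F (r • e)) := by
  have hf : ContDiff ℝ 2 (fun r : ℝ => F (r • e)) := hF.comp (contDiff_id.smul contDiff_const)
  have hd : ∀ r : ℝ, HasDerivAt (fun r : ℝ => F (r • e)) (fderiv ℝ F (r • e) e) r := by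
    intro r
    have h1 : HasFDerivAt F (fderiv ℝ F (r • e)) (r • e) :=
      (hF.differentiable (by norm_num) _).hasFDerivAt
    have h2 : HasDerivAt (fun r : ℝ => r • e) e r := by
      simpa using (hasDerivAt_id r).smul_const e
    exact h1.comp_hasDerivAt r h2
  have hfd : ContDiff ℝ 1 (fun r : ℝ => fderiv ℝ F (r • e) e) := by
    have h1 : ContDiff ℝ 1 (fderiv ℝ F) := hF.fderiv_right (by norm_num)
    exact (h1.comp (contDiff_id.smul contDiff_const)).clm_apply contDiff_const
  have hFr : F = fun z => (fun r : ℝ => F (r • e)) ‖z - 0‖ := by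
    ext z
    apply hrad
    simp [norm_smul, he]
  refine ⟨fun r hr => ?_, fun r hr => ?_, hf.continuous.continuousOn, ?_, ?_⟩
  · refine (hd r).congr_deriv ?_
    have : r ^ (n - 1) ≠ 0 := by positivity
    field_simp
  · have h2 : HasDerivAt (fun r : ℝ => fderiv ℝ F (r • e) e)
        (deriv (fun r : ℝ => fderiv ℝ F (r • e) e) r) r :=
      (hfd.differentiable (by norm_num) r).hasDerivAt
    set d := deriv (fun r : ℝ => fderiv ℝ F (r • e) e) r
    have hnorm : ‖r • e - 0‖ = r := by simp [norm_smul, he, abs_of_pos hr]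
    have hl : lap F (r • e) = d + (n - 1) / r * fderiv ℝ F (r • e) e := by
      have := lap_radial (n := n) (g := fun r : ℝ => F (r • e)) (x := r • e) (y := 0)
        (g' := fun r : ℝ => fderiv ℝ F (r • e) e) (g2 := d)
        (by rw [← norm_ne_zero_iff, hnorm]; exact hr.ne') hf.contDiffAt (Eventually.of_forall hd)
        (by rw [hnorm]; exact h2)
      rw [← hFr, hnorm] at this
      exact this
    refine ((hasDerivAt_pow (n - 1) r).mul h2).neg.congr_deriv ?_
    rw [hl]
    obtain ⟨m, rfl⟩ := Nat.exists_eq_add_of_le' hn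
    have e1 : m + 2 - 1 - 1 = m := by omega
    have e2 : m + 2 - 1 = m + 1 := by omega
    rw [e1, e2]
    push_cast
    field_simp
    ring
  · have := hfd.continuous
    fun_prop
  · rw [zero_pow (by omega)]; simp

end LE

namespace LE

structure RadSol (n : ℕ) (p q : ℝ) (u v a b : ℝ → ℝ) : Prop where
  hp : 0 < p
  hq : 0 < q
  hyp : 1 / (p + 1) + 1 / (q + 1) = ((n : ℝ) - 2) / n
  fu : Flux n u a (fun r => v r ^ p)
  fv : Flux n v b (fun r => u r ^ q)
  upos : ∀ r, 0 ≤ r → 0 < u r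
  vpos : ∀ r, 0 ≤ r → 0 < v r
  tu : Tendsto u atTop (𝓝 0)
  tv : Tendsto v atTop (𝓝 0)
  u0 : u 0 = 1

/-- `x - a r^{2-n}/(n-2)` for a flux pair -/
noncomputable def red (n : ℕ) (f a : ℝ → ℝ) (r : ℝ) : ℝ := f r - a r / ((n - 2) * r ^ (n - 2))

lemma Flux.dred {n : ℕ} (hn : 3 ≤ n) {f a g : ℝ → ℝ} (h : Flux n f a g) {r : ℝ} (hr : 0 < r) :
    HasDerivAt (red n f a) (-(r * g r / (n - 2))) r := by
  have hN : (n : ℝ) - 2 ≠ 0 := by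
    have : (3:ℝ) ≤ n := by exact_mod_cast hn
    linarith
  have h1 := ((hasDerivAt_pow (n - 2) r).const_mul ((n:ℝ) - 2))
  have h2 : ((n:ℝ) - 2) * r ^ (n - 2) ≠ 0 := by positivity
  refine ((h.df r hr).sub ((h.da r hr).div h1 h2)).congr_deriv ?_
  obtain ⟨m, rfl⟩ := Nat.exists_eq_add_of_le' hn
  have e1 : m + 3 - 2 = m + 1 := by omega
  have e2 : m + 3 - 1 = m + 2 := by omega
  simp only [e1, e2, Nat.add_sub_cancel] at *
  push_cast at *
  field_simp
  ring

lemma Flux.a_nonneg {n : ℕ} (hn : 1 ≤ n) {f a g : ℝ → ℝ} (h : Flux n f a g)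
    (hg : ∀ r, 0 < r → 0 ≤ g r) {r : ℝ} (hr : 0 ≤ r) : 0 ≤ a r := by
  have := h.a_ge hn (T := r) (M := 0) (fun s h0 _ => hg s h0) hr le_rfl
  simpa using this

lemma Flux.a_mono {n : ℕ} {f a g : ℝ → ℝ} (h : Flux n f a g)
    (hg : ∀ r, 0 < r → 0 ≤ g r) {r s : ℝ} (hr : 0 ≤ r) (hs : r ≤ s) : a r ≤ a s := by
  refine mono_aux hs (h.ca.mono fun x hx => ?_) (fun x hx => h.da x (hr.trans_lt hx.1))
    (fun x hx => ?_)
  · exact hr.trans hx.1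
  · have h1 := hr.trans_lt hx.1
    have := hg x h1
    positivity

lemma Flux.f_anti {n : ℕ} (hn : 1 ≤ n) {f a g : ℝ → ℝ} (h : Flux n f a g)
    (hg : ∀ r, 0 < r → 0 ≤ g r) {r s : ℝ} (hr : 0 ≤ r) (hs : r ≤ s) : f s ≤ f r := by
  have := mono_aux (f := fun x => - f x) (f' := fun x => a x / x ^ (n - 1)) hs
    (h.cf.neg.mono fun x hx => hr.trans hx.1)
    (fun x hx => ((h.df x (hr.trans_lt hx.1)).neg).congr_deriv (by ring))
    (fun x hx => by
      have h1 := hr.trans_lt hx.1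
      have := h.a_nonneg hn hg h1.le
      positivity)
  linarith

/-- the reduced quantity is nonnegative when `f` tends to `0` and `g ≥ 0` -/
lemma Flux.red_nonneg {n : ℕ} (hn : 3 ≤ n) {f a g : ℝ → ℝ} (h : Flux n f a g)
    (hg : ∀ r, 0 < r → 0 ≤ g r) (hf : Tendsto f atTop (𝓝 0)) {r : ℝ} (hr : 0 < r) :
    0 ≤ red n f a r := by
  have hN : 0 < (n : ℝ) - 2 := by
    have : (3:ℝ) ≤ n := by exact_mod_cast hn
    linarith
  by_contra hneg
  push Not at hneg
  set c := - red n f a r with hc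
  have hcpos : 0 < c := by linarith
  have hfnn : ∀ s, 0 ≤ s → 0 ≤ f s := by
    intro s hs
    apply le_of_tendsto hf
    filter_upwards [eventually_ge_atTop s] with t ht
    exact h.f_anti (by omega) hg hs ht
  have hred : ∀ s, r ≤ s → red n f a s ≤ - c := by
    intro s hs
    have := mono_aux (f := fun x => - red n f a x) (f' := fun x => x * g x / (n - 2)) hs
      (fun x hx => ((h.dred hn (hr.trans_le hx.1)).neg).continuousAt.continuousWithinAt)
      (fun x hx => ((h.dred hn (hr.trans hx.1)).neg).congr_deriv (by ring))
      (fun x hx => by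
        have h1 := hr.trans hx.1
        have := hg x h1
        positivity)
    linarith
  -- then f' ≤ -(c N)/r
  have hlog : ∀ s, r ≤ s → f s ≤ f r - c * (n - 2) * (Real.log s - Real.log r) := by
    intro s hs
    have := cmp_aux (f := f) (g := fun x => - (c * (n - 2) * Real.log x))
      (f' := fun x => -(a x / x ^ (n - 1))) (g' := fun x => - (c * (n - 2) * x⁻¹)) hs
      (h.cf.mono fun x hx => hr.le.trans hx.1)
      (fun x hx => (((Real.hasDerivAt_log (hr.trans_le hx.1).ne').const_mul (c * ((n:ℝ) - 2))).neg).continuousAt.continuousWithinAt)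
      (fun x hx => h.df x (hr.trans hx.1))
      (fun x hx => ((Real.hasDerivAt_log (hr.trans hx.1).ne').const_mul (c * ((n:ℝ) - 2))).neg)
      (fun x hx => by
        have h1 := hr.trans hx.1
        have h2 := hred x hx.1.le
        have h3 := hfnn x h1.le
        unfold red at h2
        have h4 : c ≤ a x / ((n - 2) * x ^ (n - 2)) := by linarith
        rw [le_div_iff₀ (by positivity)] at h4
        apply neg_le_neg
        rw [le_div_iff₀ (by positivity)]
        have : x ^ (n - 1) = x ^ (n - 2) * x := by
          rw [← pow_succ]; congr 1; omega
        rw [this]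
        calc c * (n - 2) * x⁻¹ * (x ^ (n - 2) * x) = c * ((n - 2) * x ^ (n - 2)) := by field_simp
          _ ≤ a x := h4)
    linarith
  have hlim : Tendsto (fun s => f r - c * (n - 2) * (Real.log s - Real.log r)) atTop atBot := by
    apply tendsto_atBot_add_const_left
    apply tendsto_neg_atTop_atBot.comp
    apply Tendsto.const_mul_atTop (by positivity)
    exact tendsto_atTop_add_const_right _ _ Real.tendsto_log_atTop
  obtain ⟨s, hs1, hs2⟩ := ((hlim.eventually (eventually_lt_atBot 0)).and
    (eventually_ge_atTop r)).exists
  linarith [hlog s hs2, hfnn s (hr.le.trans hs2)]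

namespace RadSol
variable {n : ℕ} {p q : ℝ} {u v a b : ℝ → ℝ}

lemma gv (h : RadSol n p q u v a b) : ∀ r, 0 < r → 0 ≤ v r ^ p := fun r hr =>
  (Real.rpow_pos_of_pos (h.vpos r hr.le) p).le
lemma gu (h : RadSol n p q u v a b) : ∀ r, 0 < r → 0 ≤ u r ^ q := fun r hr =>
  (Real.rpow_pos_of_pos (h.upos r hr.le) q).le

lemma swap' (h : RadSol n p q u v a b) (hn : 3 ≤ n) :
    ((n:ℝ) / (p + 1) + n / (q + 1) = n - 2) ∧ 2 + n / (q + 1) = p * (n / (p + 1)) ∧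
      2 + n / (p + 1) = q * (n / (q + 1)) := by
  have hp := h.hp
  have hq := h.hq
  have hh := h.hyp
  have hn0 : (0:ℝ) < n := by positivity
  have h1 : (n:ℝ) / (p + 1) + n / (q + 1) = n - 2 := by
    have : (n:ℝ) / (p + 1) + n / (q + 1) = n * (1 / (p + 1) + 1 / (q + 1)) := by ring
    rw [this, hh]; field_simp
  have h2 : (n:ℝ) / (p + 1) * (p + 1) = n := by field_simp
  have h3 : (n:ℝ) / (q + 1) * (q + 1) = n := by field_simp
  refine ⟨h1, by nlinarith, by nlinarith⟩

lemma pohozaev (h : RadSol n p q u v a b) (hn : 3 ≤ n) {r : ℝ} (hr : 0 < r) :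
    r ^ n * (v r ^ (p + 1) / (p + 1) + u r ^ (q + 1) / (q + 1)) =
      n / (q + 1) * red n u a r * b r + n / (p + 1) * a r * red n v b r := by
  have hN : 0 < (n : ℝ) - 2 := by
    have : (3:ℝ) ≤ n := by exact_mod_cast hn
    linarith
  have hp := h.hp
  have hq := h.hq
  obtain ⟨s1, s2, s3⟩ := h.swap' hn
  set α := (n:ℝ) / (q + 1) with hα
  set β := (n:ℝ) / (p + 1) with hβ
  set H : ℝ → ℝ := fun r => r ^ n * (v r ^ (p + 1) / (p + 1) + u r ^ (q + 1) / (q + 1)) -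
    (α * red n u a r * b r + β * a r * red n v b r) with hH
  have hd : ∀ r, 0 < r → HasDerivAt H 0 r := by
    intro r hr
    have hv := h.vpos r hr.le
    have hu := h.upos r hr.le
    have e1 := ((h.fv.df r hr).rpow_const (p := p + 1) (Or.inl hv.ne')).div_const (p + 1)
    have e2 := ((h.fu.df r hr).rpow_const (p := q + 1) (Or.inl hu.ne')).div_const (q + 1)
    have e3 := (hasDerivAt_pow n r).mul (e1.add e2)
    have e4 := ((h.fu.dred hn hr).const_mul α).mul (h.fv.da r hr)
    have e5 := ((h.fu.da r hr).const_mul β).mul (h.fv.dred hn hr)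
    refine (e3.sub (e4.add e5)).congr_deriv ?_
    simp only [Pi.add_apply]
    have a1 : p + 1 - 1 = p := by ring
    have a2 : q + 1 - 1 = q := by ring
    rw [a1, a2, Real.rpow_add_one hv.ne', Real.rpow_add_one hu.ne']
    set vp := v r ^ p
    set uq := u r ^ q
    have b1 : (n:ℝ) * (vp * v r / (p + 1)) = β * vp * v r := by rw [hβ]; ring
    have b2 : (n:ℝ) * (uq * u r / (q + 1)) = α * uq * u r := by rw [hα]; ring
    have c1 : r ^ n = r ^ (n - 2) * r * r := by rw [← pow_succ, ← pow_succ]; congr 1; omega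
    have c2 : r ^ (n - 1) = r ^ (n - 2) * r := by rw [← pow_succ]; congr 1; omega
    have hm : 0 < r ^ (n - 2) := by positivity
    have b3 : (n:ℝ) * r ^ (n - 1) * (vp * v r / (p + 1) + uq * u r / (q + 1)) =
      r ^ (n - 1) * (β * vp * v r + α * uq * u r) := by
      rw [← b1, ← b2]; ring
    rw [b3]
    unfold red
    rw [c2, c1]
    set m := r ^ (n - 2)
    have hp1 : p + 1 ≠ 0 := by positivity
    have hq1 : q + 1 ≠ 0 := by positivity
    have hs : α = (n:ℝ) - 2 - β := by linarith
    rw [hs]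
    field_simp
    ring
  have hconst : ∀ s, 0 < s → H s = H r := by
    intro s hs
    have := (convex_Ioi (0:ℝ)).is_const_of_fderivWithin_eq_zero (𝕜 := ℝ) (f := H)
      (fun x hx => (hd x hx).differentiableAt.differentiableWithinAt)
      (fun x hx => by
        have hx' : UniqueDiffWithinAt ℝ (Set.Ioi (0:ℝ)) x := isOpen_Ioi.uniqueDiffWithinAt hx
        rw [(hd x hx).differentiableAt.fderivWithin hx']
        ext
        simp [(hd x hx).deriv]) hs hr
    exact this
  -- limit at zero
  have hlim : Tendsto H (𝓝[>] 0) (𝓝 0) := by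
    have t0 : ∀ {f : ℝ → ℝ}, ContinuousOn f (Set.Ici 0) → Tendsto f (𝓝[>] 0) (𝓝 (f 0)) := by
      intro f hf
      exact (hf 0 Set.self_mem_Ici).mono_left (nhdsWithin_mono _ Set.Ioi_subset_Ici_self)
    have tu := t0 h.fu.cf
    have tv := t0 h.fv.cf
    have ta : Tendsto a (𝓝[>] 0) (𝓝 0) := by have := t0 h.fu.ca; rwa [h.fu.a0] at this
    have tb : Tendsto b (𝓝[>] 0) (𝓝 0) := by have := t0 h.fv.ca; rwa [h.fv.a0] at this
    have tn : Tendsto (fun r : ℝ => r ^ n) (𝓝[>] 0) (𝓝 0) := by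
      have := t0 (f := fun r : ℝ => r ^ n) (by fun_prop)
      simpa [zero_pow (show n ≠ 0 by omega)] using this
    have tq : ∀ {f a g : ℝ → ℝ} {M : ℝ}, Flux n f a g → (∀ r, 0 < r → 0 ≤ g r) →
        (∀ r, 0 < r → g r ≤ M) → Tendsto (red n f a) (𝓝[>] 0) (𝓝 (f 0)) := by
      intro f a g M hf hg hM
      have : Tendsto (fun r => a r / ((n - 2) * r ^ (n - 2))) (𝓝[>] 0) (𝓝 0) := by
        have hz : Tendsto (fun r : ℝ => M * r ^ 2 / (n * (n - 2))) (𝓝[>] 0) (𝓝 0) := by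
          have := t0 (f := fun r : ℝ => M * r ^ 2 / (n * (n - 2))) (by fun_prop)
          simpa using this
        refine tendsto_of_tendsto_of_tendsto_of_le_of_le' tendsto_const_nhds hz ?_ ?_
        · filter_upwards [self_mem_nhdsWithin] with r hr
          have hr : 0 < r := hr
          have := hf.a_nonneg (by omega) hg hr.le
          positivity
        · filter_upwards [self_mem_nhdsWithin] with r hr
          have hr : 0 < r := hr
          have h1 := hf.a_le (by omega) (T := r) (fun s h _ => hM s h) hr.le le_rfl
          rw [div_le_iff₀ (by positivity)]
          refine h1.trans (le_of_eq ?_)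
          have c1 : r ^ n = r ^ (n - 2) * r ^ 2 := by rw [← pow_add]; congr 1; omega
          rw [c1]; field_simp
      have h2 := (t0 hf.cf).sub this
      rw [sub_zero] at h2
      exact h2
    have hux : Tendsto (red n u a) (𝓝[>] 0) (𝓝 (u 0)) := tq h.fu h.gv (M := v 0 ^ p)
      (fun r hr => Real.rpow_le_rpow (h.vpos r hr.le).le
        (h.fv.f_anti (by omega) h.gu le_rfl hr.le) hp.le)
    have hvx : Tendsto (red n v b) (𝓝[>] 0) (𝓝 (v 0)) := tq h.fv h.gu (M := u 0 ^ q)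
      (fun r hr => Real.rpow_le_rpow (h.upos r hr.le).le
        (h.fu.f_anti (by omega) h.gv le_rfl hr.le) hq.le)
    have hv1 := (tv.rpow_const (p := p + 1) (Or.inr (by positivity))).div_const (p + 1)
    have hu1 := (tu.rpow_const (p := q + 1) (Or.inr (by positivity))).div_const (q + 1)
    have := (tn.mul (hv1.add hu1)).sub (((hux.const_mul α).mul tb).add ((ta.const_mul β).mul hvx))
    simpa [hH] using this
  have hlim2 : Tendsto H (𝓝[>] 0) (𝓝 (H r)) := by
    refine tendsto_const_nhds.congr' ?_
    filter_upwards [self_mem_nhdsWithin] with s hs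
    exact (hconst s hs).symm
  have := tendsto_nhds_unique hlim2 hlim
  simp only [hH] at this
  linarith

end RadSol
end LE

namespace LE

lemma explicit_solution {n : ℕ} (hn : 5 ≤ n) :
    ∃ (us vs as bs : ℝ → ℝ) (B A : ℝ), 0 < B ∧ 0 < A ∧ Flux n us as vs ∧
      Flux n vs bs (fun r => us r ^ (((n:ℝ) + 4) / (n - 4))) ∧ us 0 = 1 ∧
      (∀ r, 0 ≤ r → 0 < us r) ∧ (∀ r, 0 ≤ r → 0 < vs r) ∧ Tendsto vs atTop (𝓝 0) ∧
      Tendsto (fun r => as r / r ^ 2) atTop (𝓝 (B / (2 * (n - 2)))) ∧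
      Tendsto bs atTop (𝓝 B) ∧
      Tendsto (fun r => vs r * r ^ (n - 2)) atTop (𝓝 (B / (n - 2))) ∧
      Tendsto (fun r => us r * r ^ (n - 4)) atTop (𝓝 A) := by
  have hn5 : (5:ℝ) ≤ n := by exact_mod_cast hn
  have hn4 : 0 < (n:ℝ) - 4 := by linarith
  have hn2 : 0 < (n:ℝ) - 2 := by linarith
  have hD : 0 < ((n:ℝ) - 4) * n * (n ^ 2 - 4) := by
    have : 0 < (n:ℝ) ^ 2 - 4 := by nlinarith
    positivity
  set c : ℝ := 1 / √(((n:ℝ) - 4) * n * (n ^ 2 - 4)) with hc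
  have hcpos : 0 < c := by positivity
  have hc2 : c ^ 2 * (((n:ℝ) - 4) * n * (n ^ 2 - 4)) = 1 := by
    rw [hc, div_pow, Real.sq_sqrt hD.le, one_pow, one_div, inv_mul_cancel₀ hD.ne']
  clear_value c
  set w : ℝ → ℝ := fun r => 1 + c * r ^ 2 with hw
  have hwpos : ∀ r, 0 < w r := fun r => by simp only [hw]; positivity
  have hdw : ∀ s r : ℝ, HasDerivAt (fun r => w r ^ s) (2 * c * r * s * w r ^ (s - 1)) r := by
    intro s r
    have h1 : HasDerivAt w (2 * c * r) r := by
      refine (((hasDerivAt_pow 2 r).const_mul c).const_add 1).congr_deriv ?_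
      norm_num; ring
    refine (h1.rpow_const (p := s) (Or.inl (hwpos r).ne')).congr_deriv ?_
    ring
  have hcw : ∀ s : ℝ, Continuous (fun r => w r ^ s) := fun s =>
    continuous_iff_continuousAt.2 fun r => (hdw s r).continuousAt
  -- exponents
  set k : ℝ := (n:ℝ) / 2 with hk
  have hsplit : ∀ (r s : ℝ) (j : ℕ), s = -k - 2 + j → w r ^ s = w r ^ (-k - 2) * w r ^ j := by
    intro r s j hs
    rw [hs, Real.rpow_add (hwpos r), Real.rpow_natCast]
  set us : ℝ → ℝ := fun r => w r ^ (-k + 2) with hus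
  set vs : ℝ → ℝ := fun r => c * (n - 4) * (2 * w r ^ (-k + 1) + (n - 2) * w r ^ (-k)) with hvs
  set as : ℝ → ℝ := fun r => c * (n - 4) * (r ^ n * w r ^ (-k + 1)) with has
  set bs : ℝ → ℝ := fun r => 2 * c ^ 2 * (n - 4) * (n - 2) *
    (r ^ n * (w r ^ (-k) + k * w r ^ (-k - 1))) with hbs
  have hrn : ∀ r : ℝ, r ^ n = r ^ (n - 1) * r := fun r => by
    rw [← pow_succ]; congr 1; omega
  -- limits
  have hw2 : Tendsto (fun r => w r / r ^ 2) atTop (𝓝 c) := by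
    have h1 : Tendsto (fun r : ℝ => (r ^ 2)⁻¹ + c) atTop (𝓝 (0 + c)) :=
      (tendsto_inv_atTop_zero.comp (tendsto_pow_atTop (by norm_num))).add_const c
    rw [zero_add] at h1
    refine h1.congr' ?_
    filter_upwards [eventually_gt_atTop 0] with r hr
    simp only [hw]; field_simp
  have hws : ∀ s : ℝ, Tendsto (fun r => w r ^ s / r ^ (2 * s)) atTop (𝓝 (c ^ s)) := by
    intro s
    refine (hw2.rpow_const (p := s) (Or.inl hcpos.ne')).congr' ?_
    filter_upwards [eventually_gt_atTop 0] with r hr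
    rw [Real.div_rpow (hwpos r).le (by positivity), ← Real.rpow_natCast, ← Real.rpow_mul hr.le]
    norm_num
  have hinvp : ∀ j : ℕ, j ≠ 0 → Tendsto (fun r : ℝ => (r ^ j)⁻¹) atTop (𝓝 0) := fun j hj =>
    tendsto_inv_atTop_zero.comp (tendsto_pow_atTop hj)
  have L : ∀ (s : ℝ) (j : ℕ), (j : ℝ) = -(2 * s) →
      Tendsto (fun r => r ^ j * w r ^ s) atTop (𝓝 (c ^ s)) := by
    intro s j hj
    refine (hws s).congr' ?_
    filter_upwards [eventually_gt_atTop 0] with r hr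
    have : r ^ (2 * s) = (r ^ j)⁻¹ := by
      rw [← Real.rpow_natCast, ← Real.rpow_neg hr.le, hj, neg_neg]
    rw [this]; field_simp
  have L0 := L (-k) n (by rw [hk]; ring)
  have L1 := L (-k + 1) (n - 2) (by rw [Nat.cast_sub (by omega), hk]; push_cast; ring)
  have L2 := L (-k + 2) (n - 4) (by rw [Nat.cast_sub (by omega), hk]; push_cast; ring)
  have Lm := L (-k - 1) (n + 2) (by rw [hk]; push_cast; ring)
  have Lm' : Tendsto (fun r => r ^ n * w r ^ (-k - 1)) atTop (𝓝 0) := by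
    have := (Lm.mul (hinvp 2 (by norm_num)))
    rw [mul_zero] at this
    refine this.congr' ?_
    filter_upwards [eventually_gt_atTop 0] with r hr
    rw [pow_add]; field_simp
  have L0' : Tendsto (fun r => r ^ (n - 2) * w r ^ (-k)) atTop (𝓝 0) := by
    have := (L0.mul (hinvp 2 (by norm_num)))
    rw [mul_zero] at this
    refine this.congr' ?_
    filter_upwards [eventually_gt_atTop 0] with r hr
    have : r ^ n = r ^ (n - 2) * r ^ 2 := by rw [← pow_add]; congr 1; omega
    rw [this]; field_simp
  have hc1 : c ^ (-k + 1) = c ^ (-k) * c := by rw [Real.rpow_add hcpos, Real.rpow_one]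
  have tV : Tendsto (fun r => vs r * r ^ (n - 2)) atTop
      (𝓝 (2 * c ^ 2 * (n - 4) * (n - 2) * c ^ (-k) / (n - 2))) := by
    have := ((L1.const_mul 2).add (L0'.const_mul ((n:ℝ) - 2))).const_mul (c * ((n:ℝ) - 4))
    rw [hc1] at this
    refine (this.congr fun r => ?_).trans (le_of_eq ?_)
    · simp only [hvs]; ring
    · congr 1; field_simp; ring
  refine ⟨us, vs, as, bs, 2 * c ^ 2 * (n - 4) * (n - 2) * c ^ (-k), c ^ (-k + 2), by positivity,
    by positivity, ?_, ?_, ?_, ?_, ?_, ?_, ?_, ?_, tV, ?_⟩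
  · refine ⟨fun r hr => ?_, fun r hr => ?_, (hcw _).continuousOn, ?_, ?_⟩
    · refine (hdw _ r).congr_deriv ?_
      simp only [has]
      rw [hrn, hsplit r (-k + 2 - 1) 3 (by push_cast; ring), hsplit r (-k + 1) 3 (by push_cast; ring)]
      have : k = n / 2 := hk
      field_simp
      rw [this]; ring
    · refine (((hasDerivAt_pow n r).mul (hdw (-k + 1) r)).const_mul (c * ((n:ℝ) - 4))).congr_deriv ?_
      simp only [hvs]
      rw [hrn, hsplit r (-k + 1 - 1) 2 (by push_cast; ring), hsplit r (-k + 1) 3 (by push_cast; ring),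
        hsplit r (-k) 2 (by push_cast; ring)]
      have h1 : c * r ^ 2 = w r - 1 := by simp only [hw]; ring
      have h2 : (n:ℝ) = 2 * k := by rw [hk]; ring
      rw [h2]
      generalize w r = W at *
      generalize W ^ (-k - 2) = E
      linear_combination (c * (2 * k - 4) * r ^ (n - 1) * E * W ^ 2 * 2 * (-k + 1)) * h1
    · exact ((continuous_const.mul ((continuous_pow n).mul (hcw _)))).continuousOn
    · simp only [has]; rw [zero_pow (by omega)]; ring
  · refine ⟨fun r hr => ?_, fun r hr => ?_, ?_, ?_, ?_⟩
    · refine ((((hdw (-k + 1) r).const_mul 2).add ((hdw (-k) r).const_mul ((n:ℝ) - 2))).const_mul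
        (c * ((n:ℝ) - 4))).congr_deriv ?_
      simp only [hbs]
      rw [hrn, hsplit r (-k + 1 - 1) 2 (by push_cast; ring), hsplit r (-k) 2 (by push_cast; ring),
        hsplit r (-k - 1) 1 (by push_cast; ring)]
      have h2 : (n:ℝ) = 2 * k := by rw [hk]; ring
      rw [h2]
      field_simp
      ring
    · refine (((hasDerivAt_pow n r).mul ((hdw (-k) r).add ((hdw (-k - 1) r).const_mul k))).const_mul
        (2 * c ^ 2 * ((n:ℝ) - 4) * (n - 2))).congr_deriv ?_
      simp only [hus, Pi.add_apply]
      have hpow : (w r ^ (-k + 2)) ^ (((n:ℝ) + 4) / (n - 4)) = w r ^ (-k - 2) := by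
        rw [← Real.rpow_mul (hwpos r).le]
        congr 1
        rw [hk]; field_simp; ring
      rw [hpow]
      have e2 : w r ^ (-k - 1 - 1) = w r ^ (-k - 2) := by congr 1; ring
      rw [hrn, e2, hsplit r (-k) 2 (by push_cast; ring), hsplit r (-k - 1) 1 (by push_cast; ring)]
      have h1 : c * r ^ 2 = w r - 1 := by simp only [hw]; ring
      have h2 : (n:ℝ) = 2 * k := by rw [hk]; ring
      rw [h2] at hc2 ⊢
      generalize w r = W at *
      generalize W ^ (-k - 2) = E
      linear_combination (2 * c ^ 2 * (2 * k - 4) * (2 * k - 2) * r ^ (n - 1) * E * (-2 * k * W + 2 * k * (-k - 1))) * h1 + r ^ (n - 1) * E * hc2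
    · exact (continuous_const.mul ((continuous_const.mul (hcw _)).add
        (continuous_const.mul (hcw _)))).continuousOn
    · exact (continuous_const.mul ((continuous_pow n).mul ((hcw _).add
        (continuous_const.mul (hcw _))))).continuousOn
    · simp only [hbs]; rw [zero_pow (by omega)]; ring
  · simp [hus, hw]
  · intro r _; exact Real.rpow_pos_of_pos (hwpos r) _
  · intro r _
    have h1 := Real.rpow_pos_of_pos (hwpos r) (-k + 1)
    have h2 := Real.rpow_pos_of_pos (hwpos r) (-k)
    simp only [hvs]
    positivity
  · have := tV.mul (hinvp (n - 2) (by omega))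
    rw [mul_zero] at this
    refine this.congr' ?_
    filter_upwards [eventually_gt_atTop 0] with r hr
    field_simp
  · have := L1.const_mul (c * ((n:ℝ) - 4))
    rw [hc1] at this
    refine (this.congr' ?_).trans (le_of_eq ?_)
    · filter_upwards [eventually_gt_atTop 0] with r hr
      have e : r ^ n = r ^ (n - 2) * r ^ 2 := by rw [← pow_add]; congr 1; omega
      simp only [has]; rw [e]; field_simp
    · congr 1; field_simp
  · have := (L0.add (Lm'.const_mul k)).const_mul (2 * c ^ 2 * ((n:ℝ) - 4) * (n - 2))
    refine (this.congr fun r => ?_).trans (le_of_eq ?_)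
    · simp only [hbs]; ring
    · congr 1; ring
  · exact L2.congr fun r => by simp only [hus]; ring

end LE

namespace LE

lemma first_exit {h : ℝ → ℝ} {a b c : ℝ} (hc : ContinuousOn h (Set.Icc a b))
    (H : ∀ t ∈ Set.Icc a b, (∀ s, a ≤ s → s < t → c < h s) → c < h t) :
    ∀ t ∈ Set.Icc a b, c < h t := by
  by_contra hcon
  push Not at hcon
  obtain ⟨t1, ht1, hle⟩ := hcon
  set S : Set ℝ := Set.Icc a b ∩ h ⁻¹' Set.Iic c with hS
  have hScl : IsClosed S := hc.preimage_isClosed_of_isClosed isClosed_Icc isClosed_Iic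
  have hSc : IsCompact S := isCompact_Icc.of_isClosed_subset hScl Set.inter_subset_left
  obtain ⟨t0, ht0⟩ := hSc.exists_isLeast ⟨t1, ht1, hle⟩
  have h1 := H t0 ht0.1.1 (fun s hs hst => by
    by_contra hn
    push Not at hn
    have : s ∈ S := ⟨⟨hs, hst.le.trans ht0.1.1.2⟩, hn⟩
    exact absurd (ht0.2 this) (by linarith))
  have h2 : h t0 ≤ c := ht0.1.2
  linarith

lemma rpow_close {s0 : ℝ} (hs : 0 < s0) (M : ℝ) {ε : ℝ} (hε : 0 < ε) :
    ∀ᶠ s in 𝓝 s0, ∀ x ∈ Set.Icc 0 M, |x ^ s - x ^ s0| ≤ ε := by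
  apply isCompact_Icc.eventually_forall_of_forall_eventually
  intro x hx
  have h1 : ContinuousAt (fun z : ℝ × ℝ => z.2 ^ z.1 - z.2 ^ s0) (s0, x) := by
    apply ContinuousAt.sub
    · have h2 := Real.continuousAt_rpow_of_pos (x, s0) hs
      exact ContinuousAt.comp (x := (s0, x)) (f := fun z : ℝ × ℝ => (z.2, z.1)) h2 (by fun_prop)
    · exact continuousAt_snd.rpow_const (Or.inr hs.le)
  have h3 : Tendsto (fun z : ℝ × ℝ => |z.2 ^ z.1 - z.2 ^ s0|) (𝓝 (s0, x)) (𝓝 0) := by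
    have := h1.abs.tendsto
    simpa using this
  filter_upwards [h3.eventually (gt_mem_nhds hε)] with z hz using hz.le

lemma rpow_lip {q : ℝ} (hq : 1 ≤ q) {x y : ℝ} (hx : x ∈ Set.Icc (0:ℝ) 1)
    (hy : y ∈ Set.Icc (0:ℝ) 1) : |x ^ q - y ^ q| ≤ q * |x - y| := by
  have := Convex.norm_image_sub_le_of_norm_hasDerivWithin_le (f := fun x : ℝ => x ^ q)
    (f' := fun x => q * x ^ (q - 1)) (s := Set.Icc (0:ℝ) 1) (C := q)
    (fun z hz => (Real.hasDerivAt_rpow_const (Or.inr hq)).hasDerivWithinAt)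
    (fun z hz => by
      have h1 : 0 ≤ z ^ (q - 1) := Real.rpow_nonneg hz.1 _
      have h2 : z ^ (q - 1) ≤ 1 := Real.rpow_le_one hz.1 hz.2 (by linarith)
      rw [Real.norm_eq_abs, abs_of_nonneg (by positivity)]
      nlinarith) (convex_Icc 0 1) hy hx
  simpa [Real.norm_eq_abs] using this

section
variable {ι : Type*} {l : Filter ι} {n : ℕ} {p q : ι → ℝ} {u v a b : ι → ℝ → ℝ}

lemma tendsto_q (hn : 5 ≤ n) (hs : ∀ i, RadSol n (p i) (q i) (u i) (v i) (a i) (b i))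
    (hp : Tendsto p l (𝓝 1)) : Tendsto q l (𝓝 (((n:ℝ) + 4) / (n - 4))) := by
  have hn5 : (5:ℝ) ≤ n := by exact_mod_cast hn
  have hn4 : 0 < (n:ℝ) - 4 := by linarith
  have h1 : Tendsto (fun i => (((n:ℝ) - 2) / n - 1 / (p i + 1))⁻¹ - 1) l
      (𝓝 ((((n:ℝ) - 2) / n - 1 / (1 + 1))⁻¹ - 1)) := by
    apply Tendsto.sub_const
    apply Tendsto.inv₀
    · exact tendsto_const_nhds.sub (tendsto_const_nhds.div (hp.add_const 1) (by norm_num))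
    · have : ((n:ℝ) - 2) / n - 1 / (1 + 1) = (n - 4) / (2 * n) := by field_simp; ring
      rw [this]; positivity
  have e : (((n:ℝ) - 2) / n - 1 / (1 + 1))⁻¹ - 1 = ((n:ℝ) + 4) / (n - 4) := by
    have : ((n:ℝ) - 2) / n - 1 / (1 + 1) = (n - 4) / (2 * n) := by field_simp; ring
    rw [this]; field_simp; ring
  rw [e] at h1
  refine h1.congr fun i => ?_
  have h2 := (hs i).hyp
  have h3 : ((n:ℝ) - 2) / n - 1 / (p i + 1) = 1 / (q i + 1) := by linarith
  have := (hs i).hq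
  rw [h3]; field_simp; ring

lemma RadSol.u_le_one {n : ℕ} (hn : 5 ≤ n) {p q : ℝ} {u v a b : ℝ → ℝ}
    (h : RadSol n p q u v a b) {r : ℝ} (hr : 0 ≤ r) : u r ≤ 1 := by
  rw [← h.u0]; exact h.fu.f_anti (by omega) h.gv le_rfl hr

lemma v0_close (hn : 5 ≤ n) (hs : ∀ i, RadSol n (p i) (q i) (u i) (v i) (a i) (b i))
    (hp : Tendsto p l (𝓝 1)) {us vs as bs : ℝ → ℝ} (fu : Flux n us as vs)
    (fv : Flux n vs bs (fun r => us r ^ (((n:ℝ) + 4) / (n - 4)))) (u0 : us 0 = 1)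
    (upos : ∀ r, 0 ≤ r → 0 < us r) (vpos : ∀ r, 0 ≤ r → 0 < vs r) (tv : Tendsto vs atTop (𝓝 0)) :
    Tendsto (fun i => v i 0) l (𝓝 (vs 0)) := by
  have hn5 : (5:ℝ) ≤ n := by exact_mod_cast hn
  have hn4 : 0 < (n:ℝ) - 4 := by linarith
  have hq := tendsto_q hn hs hp
  set qs := ((n:ℝ) + 4) / (n - 4) with hqs
  have hqpos : 0 < qs := by positivity
  have usle : ∀ r, 0 ≤ r → us r ≤ 1 := fun r hr => by
    rw [← u0]; exact fu.f_anti (by omega) (fun s h => (vpos s h.le).le) le_rfl hr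
  have vsle : ∀ r, 0 ≤ r → vs r ≤ vs 0 := fun r hr =>
    fv.f_anti (by omega) (fun s h => Real.rpow_nonneg (upos s h.le).le _) le_rfl hr
  rw [Metric.tendsto_nhds]
  intro g hg
  -- times
  obtain ⟨T2, hT2v, hT2⟩ := ((tv.eventually (gt_mem_nhds (half_pos hg))).and
    (eventually_ge_atTop 0)).exists
  obtain ⟨T1, hT1v, hT1⟩ : ∃ T1 : ℝ, 1 ≤ (g / 4) * T1 ^ 2 / (2 * n) ∧ 0 ≤ T1 := by
    have : Tendsto (fun T : ℝ => (g / 4) * T ^ 2 / (2 * n)) atTop atTop := by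
      apply Tendsto.atTop_div_const (by positivity)
      exact (tendsto_pow_atTop (by norm_num)).const_mul_atTop (by positivity)
    exact ((this.eventually (eventually_ge_atTop 1)).and (eventually_ge_atTop 0)).exists
  set T := max T1 T2 with hT
  set ε' := (g / 4) * (2 * n) / (T ^ 2 + 1) with hε'
  have hε'pos : 0 < ε' := by positivity
  have hε'T : ∀ t, 0 ≤ t → t ≤ T → ε' * t ^ 2 / (2 * n) ≤ g / 4 := by
    intro t h0 h1
    have h2 : t ^ 2 ≤ T ^ 2 + 1 := by nlinarith
    calc ε' * t ^ 2 / (2 * n) ≤ ε' * (T ^ 2 + 1) / (2 * n) := by gcongr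
      _ = g / 4 := by rw [hε']; field_simp
  have ev1 := hp.eventually (rpow_close one_pos (vs 0 + g / 2) (show 0 < g / 4 by positivity))
  have ev2 := hq.eventually (rpow_close hqpos 1 hε'pos)
  filter_upwards [ev1, ev2] with i h1 h2
  have hi := hs i
  have fD := hi.fu.sub fu
  have fG := hi.fv.sub fv
  have hcG : ∀ S, ContinuousOn (fun r => v i r - vs r) (Set.Icc 0 S) := fun S =>
    fG.cf.mono Set.Icc_subset_Ici_self
  rw [Real.dist_eq]
  by_contra hcon
  push Not at hcon
  have hpi := hi.hp
  have hqi := hi.hq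
  rcases le_abs'.1 hcon with hneg | hpos
  · -- v starts below
    have key : ∀ t ∈ Set.Icc 0 T2, g / 2 < -(v i t - vs t) ∧
        g / 2 < -(v i t - vs t) := by
      have := first_exit (h := fun t => -(v i t - vs t)) (c := g / 2) (hcG T2).neg (by
        intro t ht hlt
        have hf : ∀ s, 0 < s → s < t → v i s ^ p i - vs s ≤ -(g / 4) := by
          intro s h0 hst
          have h3 := hlt s h0.le hst
          have h4 := hi.vpos s h0.le
          have h5 := h1 (vs s - g / 2) ⟨by linarith, by linarith [vsle s h0.le]⟩
          rw [Real.rpow_one, abs_le] at h5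
          have h6 : v i s ^ p i ≤ (vs s - g / 2) ^ p i :=
            Real.rpow_le_rpow h4.le (by linarith) hpi.le
          linarith [h5.2]
        have hDnn : ∀ s, 0 ≤ s → s ≤ t → us s ≤ u i s := by
          intro s h0 hst
          have h3 := fD.f_ge (by omega) (T := t) (M := 0) (fun s h0 h => by
            linarith [hf s h0 h]) h0 hst
          rw [hi.u0, u0, zero_mul, zero_div] at h3
          linarith
        have h3 := fG.f_le (by omega) (T := t) (M := -ε') (fun s h0 hst => by
          have h4 := hDnn s h0.le hst.le
          have h5 := h2 (us s) ⟨(upos s h0.le).le, usle s h0.le⟩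
          rw [abs_le] at h5
          have h6 : us s ^ q i ≤ u i s ^ q i := Real.rpow_le_rpow (upos s h0.le).le h4 hqi.le
          linarith [h5.1]) ht.1 le_rfl
        have h4 := hε'T t ht.1 (ht.2.trans (le_max_right _ _))
        have h5 : -ε' * t ^ 2 / (2 * n) = - (ε' * t ^ 2 / (2 * n)) := by ring
        linarith)
      exact fun t ht => ⟨this t ht, this t ht⟩
    have h3 := (key T2 ⟨hT2, le_rfl⟩).1
    linarith [hi.vpos T2 hT2]
  · have hall : ∀ t ∈ Set.Icc 0 T1, (∀ s, 0 ≤ s → s < t → g / 2 < v i s - vs s) →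
        (∀ s, 0 < s → s < t → g / 4 ≤ v i s ^ p i - vs s) := by
      intro t ht hlt s h0 hst
      have h3 := hlt s h0.le hst
      have h4 := vpos s h0.le
      have h5 := h1 (vs s + g / 2) ⟨by linarith, by linarith [vsle s h0.le]⟩
      rw [Real.rpow_one, abs_le] at h5
      have h6 : (vs s + g / 2) ^ p i ≤ v i s ^ p i :=
        Real.rpow_le_rpow (by linarith) (by linarith) hpi.le
      linarith [h5.1]
    have key := first_exit (h := fun t => v i t - vs t) (c := g / 2) (hcG T1) (by
        intro t ht hlt
        have hf := hall t ht hlt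
        have hDnn : ∀ s, 0 ≤ s → s ≤ t → u i s ≤ us s := by
          intro s h0 hst
          have h3 := fD.f_le (by omega) (T := t) (M := 0) (fun s h0 h => by
            linarith [hf s h0 h]) h0 hst
          rw [hi.u0, u0, zero_mul, zero_div] at h3
          linarith
        have h3 := fG.f_ge (by omega) (T := t) (M := ε') (fun s h0 hst => by
          have h4 := hDnn s h0.le hst.le
          have h5 := h2 (us s) ⟨(upos s h0.le).le, usle s h0.le⟩
          rw [abs_le] at h5
          have h6 : u i s ^ q i ≤ us s ^ q i := Real.rpow_le_rpow (hi.upos s h0.le).le h4 hqi.le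
          linarith [h5.2]) ht.1 le_rfl
        have h4 := hε'T t ht.1 (ht.2.trans (le_max_left _ _))
        linarith)
    have hf := hall T1 ⟨hT1, le_rfl⟩ (fun s h0 h => key s ⟨h0, h.le⟩)
    have h3 := fD.f_le (by omega) (T := T1) hf hT1 le_rfl
    rw [hi.u0, u0] at h3
    linarith [hi.upos T1 hT1, usle T1 hT1]

lemma all_close (hn : 5 ≤ n) (hs : ∀ i, RadSol n (p i) (q i) (u i) (v i) (a i) (b i))
    (hp : Tendsto p l (𝓝 1)) {us vs as bs : ℝ → ℝ} (fu : Flux n us as vs)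
    (fv : Flux n vs bs (fun r => us r ^ (((n:ℝ) + 4) / (n - 4)))) (u0 : us 0 = 1)
    (upos : ∀ r, 0 ≤ r → 0 < us r) (vpos : ∀ r, 0 ≤ r → 0 < vs r) (tv : Tendsto vs atTop (𝓝 0))
    {R : ℝ} (hR : 0 ≤ R) :
    Tendsto (fun i => u i R) l (𝓝 (us R)) ∧ Tendsto (fun i => v i R) l (𝓝 (vs R)) ∧
    Tendsto (fun i => a i R) l (𝓝 (as R)) ∧ Tendsto (fun i => b i R) l (𝓝 (bs R)) := by
  have hv0 := v0_close hn hs hp fu fv u0 upos vpos tv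
  have hn5 : (5:ℝ) ≤ n := by exact_mod_cast hn
  have hn4 : 0 < (n:ℝ) - 4 := by linarith
  have hq := tendsto_q hn hs hp
  set qs := ((n:ℝ) + 4) / (n - 4) with hqs
  have hqpos : 0 < qs := by positivity
  have hq1 : 1 ≤ qs := by rw [hqs, le_div_iff₀ hn4]; linarith
  have usle : ∀ r, 0 ≤ r → us r ≤ 1 := fun r hr => by
    rw [← u0]; exact fu.f_anti (by omega) (fun s h => (vpos s h.le).le) le_rfl hr
  obtain ⟨L, hL, hvol⟩ := volterra (n := n) (by omega) hR hqpos.le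
  have key : ∀ e > 0, ∀ᶠ i in l, |u i R - us R| ≤ L * e ∧ |v i R - vs R| ≤ L * e ∧
      |a i R - as R| ≤ L * e ∧ |b i R - bs R| ≤ L * e := by
    intro e he
    have ev1 := hp.eventually (rpow_close one_pos (vs 0 + e) he)
    have ev2 := hq.eventually (rpow_close hqpos 1 he)
    have ev3 := (Metric.tendsto_nhds.1 hv0) e he
    filter_upwards [ev1, ev2, ev3] with i h1 h2 h3
    have hi := hs i
    rw [Real.dist_eq] at h3
    refine hvol _ _ _ _ _ _ e he.le (hi.fu.sub fu) (hi.fv.sub fv) (by simp [hi.u0, u0, he.le])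
      h3.le ?_ ?_ R hR le_rfl
    · intro r h0 hr
      have h4 := hi.fv.f_anti (by omega) hi.gu le_rfl h0.le
      have h5 := h1 (v i r) ⟨(hi.vpos r h0.le).le, by linarith [(abs_lt.1 h3).2]⟩
      rw [Real.rpow_one] at h5
      have h6 : |v i r ^ p i - vs r| ≤ |v i r ^ p i - v i r| + |v i r - vs r| := abs_sub_le _ _ _
      have h7 := abs_nonneg (u i r - us r)
      have h8 := abs_nonneg (v i r - vs r)
      nlinarith
    · intro r h0 hr
      have hu1 : u i r ∈ Set.Icc (0:ℝ) 1 := ⟨(hi.upos r h0.le).le, hi.u_le_one hn h0.le⟩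
      have h5 := h2 (u i r) hu1
      have h4 := rpow_lip hq1 hu1 (y := us r) ⟨(upos r h0.le).le, usle r h0.le⟩
      have h6 : |u i r ^ q i - us r ^ qs| ≤ |u i r ^ q i - u i r ^ qs| + |u i r ^ qs - us r ^ qs| :=
        abs_sub_le _ _ _
      have h8 := abs_nonneg (v i r - vs r)
      nlinarith
  have conv : ∀ {f : ι → ℝ} {c : ℝ}, (∀ e > 0, ∀ᶠ i in l, |f i - c| ≤ L * e) →
      Tendsto f l (𝓝 c) := by
    intro f c h
    rw [Metric.tendsto_nhds]
    intro e he
    filter_upwards [h (e / (2 * L)) (by positivity)] with i hi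
    rw [Real.dist_eq]
    refine hi.trans_lt ?_
    have : L * (e / (2 * L)) = e / 2 := by field_simp
    rw [this]; linarith
  exact ⟨conv fun e he => (key e he).mono fun i h => h.1,
    conv fun e he => (key e he).mono fun i h => h.2.1,
    conv fun e he => (key e he).mono fun i h => h.2.2.1,
    conv fun e he => (key e he).mono fun i h => h.2.2.2⟩

end
end LE

namespace LE

lemma first_exit' {h : ℝ → ℝ} {a b c : ℝ} (hc : ContinuousOn h (Set.Icc a b)) (ha : c < h a)
    (H : ∀ t, a < t → t ≤ b → (∀ s, a ≤ s → s ≤ t → c ≤ h s) → c < h t) :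
    ∀ t ∈ Set.Icc a b, c < h t := by
  apply first_exit hc
  intro t ht hlt
  rcases eq_or_lt_of_le ht.1 with rfl | hat
  · exact ha
  · refine H t hat ht.2 fun s hs hst => ?_
    rcases eq_or_lt_of_le hst with rfl | hlt'
    · have h1 : Tendsto h (𝓝[Set.Ico a s] s) (𝓝 (h s)) :=
        (hc s ht).mono_left (nhdsWithin_mono _ fun x hx => ⟨hx.1, hx.2.le.trans ht.2⟩)
      haveI : (𝓝[Set.Ico a s] s).NeBot := by
        rw [← mem_closure_iff_nhdsWithin_neBot, closure_Ico hat.ne]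
        exact ⟨hs, le_rfl⟩
      refine ge_of_tendsto h1 ?_
      filter_upwards [self_mem_nhdsWithin] with x hx
      exact (hlt x hx.1 hx.2).le
    · exact (hlt s hs hlt').le

lemma div_pow_rpow {n : ℕ} (hn : 2 ≤ n) {c s : ℝ} (hc : 0 ≤ c) (hs : 0 < s) (p : ℝ) :
    (c / s ^ (n - 2)) ^ p = c ^ p * s ^ (-(((n:ℝ) - 2) * p)) := by
  rw [Real.div_rpow hc (by positivity), ← Real.rpow_natCast, ← Real.rpow_mul hs.le,
    Real.rpow_neg hs.le, Nat.cast_sub hn]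
  push_cast
  rfl

lemma hasDerivAt_rpow' {s : ℝ} (hs : 0 < s) (k : ℝ) :
    HasDerivAt (fun x : ℝ => x ^ k) (k * s ^ (k - 1)) s :=
  Real.hasDerivAt_rpow_const (Or.inl hs.ne')

namespace RadSol
variable {n : ℕ} {p q : ℝ} {u v a b : ℝ → ℝ}

lemma v_lower (h : RadSol n p q u v a b) (hn : 5 ≤ n) {r s : ℝ} (hr : 0 < r) (hrs : r ≤ s) :
    b r / (n - 2) / s ^ (n - 2) ≤ v s := by
  have hs := hr.trans_le hrs
  have hn5 : (5:ℝ) ≤ n := by exact_mod_cast hn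
  have h1 := h.fv.red_nonneg (by omega) h.gu h.tv hs
  have h2 := h.fv.a_mono h.gu hr.le hrs
  unfold red at h1
  have hN : 0 < (n:ℝ) - 2 := by linarith
  rw [div_div]
  have : b r / ((n - 2) * s ^ (n - 2)) ≤ b s / ((n - 2) * s ^ (n - 2)) := by gcongr
  linarith

lemma b_nonneg (h : RadSol n p q u v a b) (hn : 5 ≤ n) {r : ℝ} (hr : 0 ≤ r) : 0 ≤ b r :=
  h.fv.a_nonneg (by omega) h.gu hr

lemma a_nonneg (h : RadSol n p q u v a b) (hn : 5 ≤ n) {r : ℝ} (hr : 0 ≤ r) : 0 ≤ a r :=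
  h.fu.a_nonneg (by omega) h.gv hr

lemma x1_lower (h : RadSol n p q u v a b) (hn : 5 ≤ n) {γ : ℝ} (hγ : γ = ((n:ℝ) - 2) * p - 2)
    (hγ0 : 0 < γ) {r : ℝ} (hr : 0 < r) :
    (b r / (n - 2)) ^ p * r ^ (-γ) / ((n - 2) * γ) ≤ red n u a r := by
  have hn5 : (5:ℝ) ≤ n := by exact_mod_cast hn
  have hN : 0 < (n:ℝ) - 2 := by linarith
  have hb := h.b_nonneg hn hr.le
  set B := (b r / (n - 2)) ^ p with hB
  have key : ∀ T, r ≤ T → B * r ^ (-γ) / ((n - 2) * γ) - B * T ^ (-γ) / ((n - 2) * γ) ≤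
      red n u a r := by
    intro T hT
    have := cmp_aux (f := red n u a) (g := fun s => B * s ^ (-γ) / ((n - 2) * γ))
      (f' := fun s => -(s * v s ^ p / (n - 2)))
      (g' := fun s => B * (-γ * s ^ (-γ - 1)) / ((n - 2) * γ)) hT
      (fun x hx => (h.fu.dred (by omega) (hr.trans_le hx.1)).continuousAt.continuousWithinAt)
      (fun x hx => (((hasDerivAt_rpow' (hr.trans_le hx.1) (-γ)).const_mul B).div_const
        (((n:ℝ) - 2) * γ)).continuousAt.continuousWithinAt)
      (fun x hx => h.fu.dred (by omega) (hr.trans hx.1))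
      (fun x hx => ((hasDerivAt_rpow' (hr.trans hx.1) (-γ)).const_mul B).div_const
        (((n:ℝ) - 2) * γ))
      (fun s hs => by
        have hs0 := hr.trans hs.1
        have h1 := h.v_lower hn hr hs.1.le
        have h2 : (b r / (n - 2) / s ^ (n - 2)) ^ p ≤ v s ^ p :=
          Real.rpow_le_rpow (by positivity) h1 h.hp.le
        rw [div_pow_rpow (by omega) (by positivity) hs0] at h2
        have h3 : s ^ (-γ - 1) = s * s ^ (-(((n:ℝ) - 2) * p)) := by
          rw [← Real.rpow_one_add' hs0.le]
          · congr 1; rw [hγ]; ring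
          · intro h0
            have : ((n:ℝ) - 2) * p = 1 := by linarith
            linarith
        rw [h3]
        have h4 : B * (-γ * (s * s ^ (-(((n:ℝ) - 2) * p)))) / ((n - 2) * γ) =
          -(s * (B * s ^ (-(((n:ℝ) - 2) * p))) / (n - 2)) := by field_simp
        rw [h4]
        apply neg_le_neg
        gcongr)
    have h5 := h.fu.red_nonneg (by omega) h.gv h.tu (hr.trans_le hT)
    linarith
  have hlim : Tendsto (fun T => B * r ^ (-γ) / ((n - 2) * γ) - B * T ^ (-γ) / ((n - 2) * γ)) atTop
      (𝓝 (B * r ^ (-γ) / ((n - 2) * γ) - B * 0 / ((n - 2) * γ))) :=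
    tendsto_const_nhds.sub (((tendsto_rpow_neg_atTop hγ0).const_mul B).div_const _)
  have := le_of_tendsto hlim (by filter_upwards [eventually_ge_atTop r] with T hT using key T hT)
  simpa using this

lemma a_upper (h : RadSol n p q u v a b) (hn : 5 ≤ n) {μ : ℝ} (hμ : μ = n - ((n:ℝ) - 2) * p)
    (hμ0 : 0 < μ) {R r c : ℝ} (hR : 0 < R) (hr : R ≤ r) (hc : 0 ≤ c)
    (hv : ∀ s, R < s → s < r → v s ≤ c / s ^ (n - 2)) :
    a r - a R ≤ c ^ p * (r ^ μ - R ^ μ) / μ := by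
  have := cmp_aux (f := a) (g := fun s => c ^ p * s ^ μ / μ)
      (f' := fun s => s ^ (n - 1) * v s ^ p)
      (g' := fun s => c ^ p * (μ * s ^ (μ - 1)) / μ) hr
      (h.fu.ca.mono fun x hx => hR.le.trans hx.1)
      (fun x hx => (((hasDerivAt_rpow' (hR.trans_le hx.1) μ).const_mul (c ^ p)).div_const
        μ).continuousAt.continuousWithinAt)
      (fun x hx => h.fu.da x (hR.trans hx.1))
      (fun x hx => ((hasDerivAt_rpow' (hR.trans hx.1) μ).const_mul (c ^ p)).div_const μ)
      (fun s hs => by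
        have hs0 := hR.trans hs.1
        have h2 : v s ^ p ≤ (c / s ^ (n - 2)) ^ p :=
          Real.rpow_le_rpow (h.vpos s hs0.le).le (hv s hs.1 hs.2) h.hp.le
        rw [div_pow_rpow (by omega) hc hs0] at h2
        have h3 : s ^ (μ - 1) = s ^ (n - 1) * s ^ (-(((n:ℝ) - 2) * p)) := by
          rw [← Real.rpow_natCast, ← Real.rpow_add hs0]
          congr 1; rw [hμ, Nat.cast_sub (by omega)]; push_cast; ring
        rw [h3]
        have h4 : c ^ p * (μ * (s ^ (n - 1) * s ^ (-(((n:ℝ) - 2) * p)))) / μ =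
          s ^ (n - 1) * (c ^ p * s ^ (-(((n:ℝ) - 2) * p))) := by field_simp
        rw [h4]
        gcongr)
  have e : c ^ p * (r ^ μ - R ^ μ) / μ = c ^ p * r ^ μ / μ - c ^ p * R ^ μ / μ := by ring
  rw [e]; exact this

lemma a_lower (h : RadSol n p q u v a b) (hn : 5 ≤ n) {μ : ℝ} (hμ : μ = n - ((n:ℝ) - 2) * p)
    (hμ0 : 0 < μ) {R r : ℝ} (hR : 0 < R) (hr : R ≤ r) :
    (b R / (n - 2)) ^ p * (r ^ μ - R ^ μ) / μ ≤ a r - a R := by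
  have hn5 : (5:ℝ) ≤ n := by exact_mod_cast hn
  have hN : 0 < (n:ℝ) - 2 := by linarith
  have hb := h.b_nonneg hn hR.le
  set c := b R / (n - 2) with hc
  have hc0 : 0 ≤ c := by positivity
  have := cmp_aux (g := a) (f := fun s => c ^ p * s ^ μ / μ)
      (g' := fun s => s ^ (n - 1) * v s ^ p)
      (f' := fun s => c ^ p * (μ * s ^ (μ - 1)) / μ) hr
      (fun x hx => (((hasDerivAt_rpow' (hR.trans_le hx.1) μ).const_mul (c ^ p)).div_const
        μ).continuousAt.continuousWithinAt)
      (h.fu.ca.mono fun x hx => hR.le.trans hx.1)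
      (fun x hx => ((hasDerivAt_rpow' (hR.trans hx.1) μ).const_mul (c ^ p)).div_const μ)
      (fun x hx => h.fu.da x (hR.trans hx.1))
      (fun s hs => by
        have hs0 := hR.trans hs.1
        have h2 : (c / s ^ (n - 2)) ^ p ≤ v s ^ p :=
          Real.rpow_le_rpow (by positivity) (h.v_lower hn hR hs.1.le) h.hp.le
        rw [div_pow_rpow (by omega) hc0 hs0] at h2
        have h3 : s ^ (μ - 1) = s ^ (n - 1) * s ^ (-(((n:ℝ) - 2) * p)) := by
          rw [← Real.rpow_natCast, ← Real.rpow_add hs0]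
          congr 1; rw [hμ, Nat.cast_sub (by omega)]; push_cast; ring
        rw [h3]
        have h4 : c ^ p * (μ * (s ^ (n - 1) * s ^ (-(((n:ℝ) - 2) * p)))) / μ =
          s ^ (n - 1) * (c ^ p * s ^ (-(((n:ℝ) - 2) * p))) := by field_simp
        rw [h4]
        gcongr)
  have e : c ^ p * (r ^ μ - R ^ μ) / μ = c ^ p * r ^ μ / μ - c ^ p * R ^ μ / μ := by ring
  rw [e]; exact this

lemma b_upper (h : RadSol n p q u v a b) (hn : 5 ≤ n) {γ R r K : ℝ} (hγ : 3 ≤ γ * q - n)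
    (hR : 1 ≤ R) (hr : R ≤ r) (hK : 0 ≤ K)
    (hu : ∀ s, R < s → s < r → u s ≤ K * s ^ (-γ)) :
    b r - b R ≤ K ^ q * (R ^ (-3:ℝ)) / 3 := by
  have hR0 : 0 < R := by linarith
  have := cmp_aux (f := b) (g := fun s => -(K ^ q * s ^ (-3:ℝ) / 3))
      (f' := fun s => s ^ (n - 1) * u s ^ q)
      (g' := fun s => -(K ^ q * ((-3:ℝ) * s ^ ((-3:ℝ) - 1)) / 3)) hr
      (h.fv.ca.mono fun x hx => hR0.le.trans hx.1)
      (fun x hx => (((hasDerivAt_rpow' (hR0.trans_le hx.1) (-3)).const_mul (K ^ q)).div_const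
        3).neg.continuousAt.continuousWithinAt)
      (fun x hx => h.fv.da x (hR0.trans hx.1))
      (fun x hx => (((hasDerivAt_rpow' (hR0.trans hx.1) (-3)).const_mul (K ^ q)).div_const 3).neg)
      (fun s hs => by
        have hs0 := hR0.trans hs.1
        have h2 : u s ^ q ≤ (K * s ^ (-γ)) ^ q :=
          Real.rpow_le_rpow (h.upos s hs0.le).le (hu s hs.1 hs.2) h.hq.le
        rw [Real.mul_rpow hK (by positivity), ← Real.rpow_mul hs0.le] at h2
        have h3 : s ^ (n - 1) * s ^ (-γ * q) ≤ s ^ ((-3:ℝ) - 1) := by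
          rw [← Real.rpow_natCast, ← Real.rpow_add hs0]
          apply Real.rpow_le_rpow_of_exponent_le (by linarith [hs.1])
          rw [Nat.cast_sub (by omega)]; push_cast; linarith
        have h4 : -(K ^ q * ((-3:ℝ) * s ^ ((-3:ℝ) - 1)) / 3) = K ^ q * s ^ ((-3:ℝ) - 1) := by ring
        rw [h4]
        calc s ^ (n - 1) * u s ^ q ≤ s ^ (n - 1) * (K ^ q * s ^ (-γ * q)) := by gcongr
          _ = K ^ q * (s ^ (n - 1) * s ^ (-γ * q)) := by ring
          _ ≤ _ := by gcongr)
  have h5 : 0 ≤ K ^ q * r ^ (-3:ℝ) / 3 := by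
    have := hR0.trans_le hr
    positivity
  linarith

end RadSol
end LE

namespace LE

lemma bern_up {k s : ℝ} (hk : 0 ≤ k) (hk1 : k ≤ 1 / 50) (hs : 0 ≤ s) (hs1 : s ≤ 5 / 2) :
    (1 + k) ^ s ≤ 1 + s * k * (21 / 20) := by
  have h1 : (1 + k) ^ s ≤ Real.exp (k * s) := by
    rw [Real.exp_mul]
    exact Real.rpow_le_rpow (by linarith) (by linarith [Real.add_one_le_exp k]) hs
  have hks : 0 ≤ k * s := by positivity
  have hks1 : k * s ≤ 1 / 20 := by nlinarith
  have h2 := (abs_le.1 (Real.abs_exp_sub_one_sub_id_le (x := k * s)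
    (by rw [abs_of_nonneg hks]; linarith))).2
  nlinarith

namespace RadSol
variable {n : ℕ} {p q : ℝ} {u v a b : ℝ → ℝ}

set_option maxHeartbeats 2000000 in
/-- one step of the continuity argument -/
lemma boot_step (h : RadSol n p q u v a b) (hn : 5 ≤ n) {γ μ R b0 b1 C0 K : ℝ}
    (hγ : γ = ((n:ℝ) - 2) * p - 2) (hγ0 : 0 < γ)
    (hμ : μ = n - ((n:ℝ) - 2) * p) (hμ0 : 1 ≤ μ) (hp1 : p ≤ 3 / 2)
    (hγq : 3 ≤ γ * q - n) (hR : 1 ≤ R) (hK : 0 < K) (hb0 : 0 < b0)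
    (hβ : 6 / 5 * μ ≤ n / (p + 1))
    (hbR0 : b0 ≤ b R) (hbR1 : b R ≤ b1)
    (h1 : 6 / 5 * (b R / (n - 2)) ^ p * R ^ μ ≤ n / (p + 1) * a R)
    (h2 : a R ≤ C0 * R ^ μ)
    (h5 : K ^ q * R ^ (-3:ℝ) / 3 ≤ b0 / 20)
    (h7 : 20 * (K ^ (q + 1) * R ^ (-3:ℝ)) < 1 / 50 * (b0 / (n - 2)) ^ (p + 1))
    (h6 : ((51 / 50 * (21 / 20) * b1 / (n - 2)) ^ (p + 1) + K ^ (q + 1) * R ^ (-3:ℝ)) /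
        (n / (q + 1) * b0) + (C0 + (51 / 50 * (21 / 20) * b1 / (n - 2)) ^ p) / (n - 2) < K)
    {r : ℝ} (hRr : R < r)
    (hu : ∀ s, R ≤ s → s ≤ r → u s ≤ K * s ^ (-γ))
    (hv : ∀ s, R ≤ s → s ≤ r → v s ≤ 51 / 50 * b s / (n - 2) / s ^ (n - 2)) :
    u r < K * r ^ (-γ) ∧ v r < 51 / 50 * b r / (n - 2) / r ^ (n - 2) ∧ b r ≤ 21 / 20 * b R := by
  have hn5 : (5:ℝ) ≤ n := by exact_mod_cast hn
  have hN : 0 < (n:ℝ) - 2 := by linarith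
  have hR0 : 0 < R := by linarith
  have hr0 : 0 < r := by linarith
  have hp := h.hp
  have hq := h.hq
  obtain ⟨s1, s2, s3⟩ := h.swap' (by omega)
  have hP := h.pohozaev (by omega) hr0
  have hα0 : 0 < (n:ℝ) / (q + 1) := by positivity
  have hβ0 : 0 < (n:ℝ) / (p + 1) := by positivity
  have hαγ : γ = (p + 1) * (n / (q + 1)) := by rw [hγ]; linarith [mul_comm p ((n:ℝ) / (q + 1)), congrArg (· * p) s1]
  set α := (n:ℝ) / (q + 1) with hα
  set β := (n:ℝ) / (p + 1) with hβd
  -- bound on b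
  have hbu : b r ≤ 21 / 20 * b R := by
    have := h.b_upper hn hγq hR hRr.le hK.le (fun s hs hs' => hu s hs.le hs'.le)
    linarith
  have hbmono : ∀ s, R ≤ s → s ≤ r → b s ≤ b r := fun s hs hs' =>
    h.fv.a_mono h.gu (hR0.le.trans hs) hs'
  have hbR : b R ≤ b r := hbmono R le_rfl hRr.le
  have hbr0 : 0 < b r := by linarith
  -- E
  set x := b r / (n - 2) with hx
  have hx0 : 0 < x := by positivity
  set g := r ^ (-γ) with hg
  have hg0 : 0 < g := Real.rpow_pos_of_pos hr0 _
  set X1 := red n u a r with hX1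
  set Y1 := red n v b r with hY1
  have hX1nn : 0 ≤ X1 := h.fu.red_nonneg (by omega) h.gv h.tu hr0
  have hY1nn : 0 ≤ Y1 := h.fv.red_nonneg (by omega) h.gu h.tv hr0
  -- lower bound x1
  have hx1 : x ^ p * g / ((n - 2) * γ) ≤ X1 := h.x1_lower hn hγ hγ0 hr0
  -- lower bound a
  have hrμ : R ^ μ ≤ r ^ μ := Real.rpow_le_rpow hR0.le hRr.le (by linarith)
  have hRμ0 : 0 < R ^ μ := Real.rpow_pos_of_pos hR0 _
  have hrμ0 : 0 < r ^ μ := Real.rpow_pos_of_pos hr0 _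
  have hxp0 : 0 < x ^ p := Real.rpow_pos_of_pos hx0 _
  have ha1 : 11 / 10 * x ^ p * r ^ μ ≤ β * a r := by
    have e1 := h.a_lower hn hμ (by linarith) hR0 hRr.le
    set y := (b R / (n - 2)) ^ p with hy
    have hy0 : 0 ≤ y := Real.rpow_nonneg (by have := hb0.trans_le hbR0; positivity) _
    have e2 : 6 / 5 * y * (r ^ μ - R ^ μ) ≤ β * (y * (r ^ μ - R ^ μ) / μ) := by
      have : β * (y * (r ^ μ - R ^ μ) / μ) = β / μ * (y * (r ^ μ - R ^ μ)) := by ring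
      rw [this, mul_assoc]
      apply mul_le_mul_of_nonneg_right
      · rw [le_div_iff₀ (by linarith)]; exact hβ
      · exact mul_nonneg hy0 (by linarith)
    have e3 : 6 / 5 * y * r ^ μ ≤ β * a r := by
      have := mul_le_mul_of_nonneg_left e1 hβ0.le
      linarith
    have e4 : x ^ p ≤ (21 / 20) ^ p * y := by
      rw [hy, ← Real.mul_rpow (by norm_num) (by have := hb0.trans_le hbR0; positivity)]
      apply Real.rpow_le_rpow hx0.le _ hp.le
      rw [hx, ← mul_div_assoc]
      gcongr
    have e5 : ((21:ℝ) / 20) ^ p ≤ 12 / 11 := by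
      calc ((21:ℝ) / 20) ^ p ≤ (21 / 20) ^ (3 / 2 : ℝ) :=
            Real.rpow_le_rpow_of_exponent_le (by norm_num) hp1
        _ ≤ 12 / 11 := by
          have := Real.rpow_le_rpow (z := (1:ℝ) / 2) (x := ((21:ℝ) / 20) ^ (3:ℝ)) (y := (12 / 11) ^ (2:ℝ))
            (by positivity) (by norm_num) (by norm_num)
          rw [← Real.rpow_mul (by norm_num), ← Real.rpow_mul (by norm_num)] at this
          norm_num at this
          exact this
    have e6 : 11 / 10 * x ^ p ≤ 6 / 5 * y := by
      have := mul_le_mul_of_nonneg_right e5 hy0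
      linarith
    calc 11 / 10 * x ^ p * r ^ μ ≤ 6 / 5 * y * r ^ μ := by gcongr
      _ ≤ β * a r := e3
  -- kappa
  set ν := r ^ (n - 2) with hν
  have hν0 : 0 < ν := by positivity
  set k := Y1 * ν / x with hk
  have hk0 : 0 ≤ k := by positivity
  have hY1k : Y1 = k * x / ν := by rw [hk]; field_simp
  have hvk : v r = (1 + k) * x / ν := by
    have : v r = Y1 + x / ν := by
      rw [hY1, hx, hν]; unfold red; field_simp; ring
    rw [this, hY1k]; ring
  have hk1 : k ≤ 1 / 50 := by
    have := hv r hRr.le le_rfl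
    rw [hvk] at this
    have e : 51 / 50 * b r / (n - 2) / ν = 51 / 50 * x / ν := by rw [hx]; ring
    rw [e, div_le_div_iff_of_pos_right hν0] at this
    have := le_of_mul_le_mul_right this hx0
    linarith
  set E := x ^ (p + 1) * g with hE
  have hE0 : 0 < E := by positivity
  have hrn : (r:ℝ) ^ n * r ^ (-(((n:ℝ) - 2) * (p + 1))) = g := by
    rw [hg, ← Real.rpow_natCast, ← Real.rpow_add hr0]; congr 1; rw [hγ]; ring
  have hvE : r ^ n * v r ^ (p + 1) = (1 + k) ^ (p + 1) * E := by
    rw [hvk, div_pow_rpow (by omega) (by positivity) hr0, Real.mul_rpow (by linarith) hx0.le, hE,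
      ← hrn]
    ring
  have hxx : x ^ (p + 1) = x ^ p * x := Real.rpow_add_one hx0.ne' p
  have t1 : E / (p + 1) ≤ α * X1 * b r := by
    have e1 : E / (p + 1) = α * (x ^ p * g / ((n - 2) * γ)) * b r := by
      have : b r = x * (n - 2) := by rw [hx]; field_simp
      rw [this, hE, hxx, hαγ]
      field_simp
    rw [e1]
    gcongr
  have hμg : r ^ μ / ν = g := by
    rw [div_eq_iff hν0.ne', hν, hg, ← Real.rpow_natCast, ← Real.rpow_add hr0]
    congr 1; rw [hμ, hγ, Nat.cast_sub (by omega)]; push_cast; ring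
  have t2 : 11 / 10 * k * E ≤ β * a r * Y1 := by
    calc 11 / 10 * k * E = (11 / 10 * x ^ p * r ^ μ) * Y1 := by
          rw [hE, hxx, ← hμg, hY1k]; ring
      _ ≤ β * a r * Y1 := by gcongr
  -- u term
  set Z := K ^ (q + 1) * R ^ (-3:ℝ) with hZ
  have hZ0 : 0 < Z := by positivity
  have hur : u r ≤ K * g := hu r hRr.le le_rfl
  have t3 : r ^ n * u r ^ (q + 1) ≤ Z * g := by
    have e1 : u r ^ (q + 1) ≤ (K * g) ^ (q + 1) :=
      Real.rpow_le_rpow (h.upos r hr0.le).le hur (by linarith)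
    rw [Real.mul_rpow hK.le hg0.le, hg, ← Real.rpow_mul hr0.le] at e1
    have e2 : r ^ n * r ^ (-γ * (q + 1)) ≤ R ^ (-3:ℝ) * g := by
      have : r ^ n * r ^ (-γ * (q + 1)) = r ^ ((n:ℝ) - γ * q) * g := by
        rw [hg, ← Real.rpow_natCast, ← Real.rpow_add hr0, ← Real.rpow_add hr0]; congr 1; ring
      rw [this]
      gcongr
      calc r ^ ((n:ℝ) - γ * q) ≤ r ^ (-3:ℝ) :=
            Real.rpow_le_rpow_of_exponent_le (by linarith) (by linarith)
        _ ≤ R ^ (-3:ℝ) := Real.rpow_le_rpow_of_nonpos hR0 hRr.le (by norm_num)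
    calc r ^ n * u r ^ (q + 1) ≤ r ^ n * (K ^ (q + 1) * r ^ (-γ * (q + 1))) := by gcongr
      _ = K ^ (q + 1) * (r ^ n * r ^ (-γ * (q + 1))) := by ring
      _ ≤ K ^ (q + 1) * (R ^ (-3:ℝ) * g) := by gcongr
      _ = Z * g := by rw [hZ]; ring
  have t3' : r ^ n * (u r ^ (q + 1) / (q + 1)) ≤ Z * g := by
    rw [← mul_div_assoc, div_le_iff₀ (by positivity)]
    have : Z * g ≤ Z * g * (q + 1) := le_mul_of_one_le_right (by positivity) (by linarith)
    linarith
  rw [mul_add, ← mul_div_assoc, hvE] at hP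
  have hbern := bern_up hk0 hk1 (by linarith : (0:ℝ) ≤ p + 1) (by linarith)
  have t4 : (1 + k) ^ (p + 1) * E / (p + 1) ≤ E / (p + 1) + k * (21 / 20) * E := by
    rw [div_le_iff₀ (by positivity)]
    have : (E / (p + 1) + k * (21 / 20) * E) * (p + 1) = (1 + (p + 1) * k * (21 / 20)) * E := by
      field_simp
    rw [this]
    gcongr
  have hkE : 1 / 20 * (k * E) ≤ Z * g := by linarith
  have hkx : k * x ^ (p + 1) ≤ 20 * Z := by
    have : (k * x ^ (p + 1)) * g ≤ (20 * Z) * g := by rw [hE] at hkE; linarith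
    exact le_of_mul_le_mul_right this hg0
  have hb0x : (b0 / (n - 2)) ^ (p + 1) ≤ x ^ (p + 1) := by
    apply Real.rpow_le_rpow (by positivity) _ (by linarith)
    rw [hx]; gcongr; linarith
  have hklt : k < 1 / 50 := by
    by_contra hcon
    push Not at hcon
    have : 1 / 50 * (b0 / (n - 2)) ^ (p + 1) ≤ k * x ^ (p + 1) := by gcongr
    linarith
  -- upper bound for u
  set B1 := 51 / 50 * (21 / 20) * b1 / ((n:ℝ) - 2) with hB1
  have hb1 : 0 < b1 := by linarith
  have hB10 : 0 < B1 := by positivity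
  have hkB1 : (1 + k) * x ≤ B1 := by
    have e1 : x ≤ 21 / 20 * b1 / ((n:ℝ) - 2) := by
      rw [hx]; gcongr; linarith
    calc (1 + k) * x ≤ 51 / 50 * (21 / 20 * b1 / ((n:ℝ) - 2)) := by
          gcongr; linarith
      _ = B1 := by rw [hB1]; ring
  have haup : a r ≤ (C0 + B1 ^ p) * r ^ μ := by
    have e1 := h.a_upper hn hμ (by linarith) hR0 hRr.le hB10.le (fun s hs hs' => by
      have hs0 : 0 < s := hR0.trans hs
      refine (hv s hs.le hs'.le).trans ?_
      have : 51 / 50 * b s / (n - 2) ≤ B1 := by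
        rw [hB1]; gcongr ?_ / _
        have := hbmono s hs.le hs'.le
        linarith
      gcongr)
    have hB1p : 0 < B1 ^ p := Real.rpow_pos_of_pos hB10 _
    have e2 : B1 ^ p * (r ^ μ - R ^ μ) / μ ≤ B1 ^ p * (r ^ μ - R ^ μ) :=
      div_le_self (mul_nonneg hB1p.le (by linarith)) hμ0
    have hC0 : 0 ≤ C0 := by
      by_contra hneg
      push Not at hneg
      have := h.a_nonneg hn hR0.le
      have := mul_neg_of_neg_of_pos hneg hRμ0
      linarith
    linarith [mul_le_mul_of_nonneg_left hrμ hC0, mul_pos hB1p hRμ0]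
  have hxup : X1 ≤ (B1 ^ (p + 1) + Z) / (α * b0) * g := by
    have e1 : (1 + k) ^ (p + 1) * E / (p + 1) ≤ B1 ^ (p + 1) * g := by
      have e2 : (1 + k) ^ (p + 1) * E = ((1 + k) * x) ^ (p + 1) * g := by
        rw [Real.mul_rpow (by linarith) hx0.le, hE]; ring
      rw [e2]
      have e3 : ((1 + k) * x) ^ (p + 1) ≤ B1 ^ (p + 1) :=
        Real.rpow_le_rpow (by positivity) hkB1 (by linarith)
      calc ((1 + k) * x) ^ (p + 1) * g / (p + 1) ≤ ((1 + k) * x) ^ (p + 1) * g :=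
            div_le_self (by positivity) (by linarith)
        _ ≤ _ := by gcongr
    have e4 : 0 ≤ β * a r * Y1 := mul_nonneg (mul_nonneg hβ0.le (h.a_nonneg hn hr0.le)) hY1nn
    have e5 : α * X1 * b0 ≤ α * X1 * b r := by
      apply mul_le_mul_of_nonneg_left (by linarith) (by positivity)
    rw [div_mul_eq_mul_div, le_div_iff₀ (by positivity)]
    linarith
  have huf : u r = X1 + a r / ((n - 2) * ν) := by
    rw [hX1, hν]; unfold red; ring
  refine ⟨?_, ?_, hbu⟩
  · have e1 : a r / ((n - 2) * ν) ≤ (C0 + B1 ^ p) / (n - 2) * g := by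
      rw [← hμg]
      calc a r / ((n - 2) * ν) ≤ (C0 + B1 ^ p) * r ^ μ / ((n - 2) * ν) := by gcongr
        _ = _ := by field_simp
    rw [huf]
    calc X1 + a r / ((n - 2) * ν) ≤ ((B1 ^ (p + 1) + Z) / (α * b0) + (C0 + B1 ^ p) / (n - 2)) * g := by
          rw [add_mul]; linarith
      _ < K * g := by gcongr
  · rw [hvk]
    have e : 51 / 50 * b r / (n - 2) / ν = 51 / 50 * x / ν := by rw [hx]; ring
    rw [e]
    gcongr
    linarith

lemma boot (h : RadSol n p q u v a b) (hn : 5 ≤ n) {γ μ R b0 b1 C0 K : ℝ}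
    (hγ : γ = ((n:ℝ) - 2) * p - 2) (hγ0 : 0 < γ)
    (hμ : μ = n - ((n:ℝ) - 2) * p) (hμ0 : 1 ≤ μ) (hp1 : p ≤ 3 / 2)
    (hγq : 3 ≤ γ * q - n) (hR : 1 ≤ R) (hK : 0 < K) (hb0 : 0 < b0)
    (hβ : 6 / 5 * μ ≤ n / (p + 1))
    (hbR0 : b0 ≤ b R) (hbR1 : b R ≤ b1)
    (h1 : 6 / 5 * (b R / (n - 2)) ^ p * R ^ μ ≤ n / (p + 1) * a R)
    (h2 : a R ≤ C0 * R ^ μ)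
    (h3 : v R < 51 / 50 * b R / (n - 2) / R ^ (n - 2))
    (h4 : u R < K * R ^ (-γ))
    (h5 : K ^ q * R ^ (-3:ℝ) / 3 ≤ b0 / 20)
    (h7 : 20 * (K ^ (q + 1) * R ^ (-3:ℝ)) < 1 / 50 * (b0 / (n - 2)) ^ (p + 1))
    (h6 : ((51 / 50 * (21 / 20) * b1 / (n - 2)) ^ (p + 1) + K ^ (q + 1) * R ^ (-3:ℝ)) /
        (n / (q + 1) * b0) + (C0 + (51 / 50 * (21 / 20) * b1 / (n - 2)) ^ p) / (n - 2) < K)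
    {r : ℝ} (hRr : R ≤ r) : u r ≤ K * r ^ (-γ) ∧ b r ≤ 21 / 20 * b R := by
  have hR0 : 0 < R := by linarith
  have hcont : ContinuousOn (fun t => min (K * t ^ (-γ) - u t)
      (51 / 50 * b t / (n - 2) / t ^ (n - 2) - v t)) (Set.Icc R r) := by
    intro t ht
    have ht0 : 0 < t := hR0.trans_le ht.1
    have e1 := (h.fu.df t ht0).continuousAt
    have e2 := (h.fv.df t ht0).continuousAt
    have e3 := (h.fv.da t ht0).continuousAt
    have e4 := (hasDerivAt_rpow' ht0 (-γ)).continuousAt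
    have e5 : t ^ (n - 2) ≠ 0 := by positivity
    have e6 : ContinuousAt (fun x : ℝ => x ^ (n - 2)) t := (continuous_pow _).continuousAt
    have e7 : ContinuousAt (fun t => K * t ^ (-γ) - u t) t := (e4.const_mul K).sub e1
    have e8 : ContinuousAt (fun t => 51 / 50 * b t / (n - 2) / t ^ (n - 2) - v t) t :=
      (((e3.const_mul (51 / 50)).div_const ((n:ℝ) - 2)).div e6 e5).sub e2
    have e9 : ContinuousAt (fun t => min (K * t ^ (-γ) - u t)
      (51 / 50 * b t / (n - 2) / t ^ (n - 2) - v t)) t := e7.min e8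
    exact e9.continuousWithinAt
  have key := first_exit' (c := 0) hcont (by
      rw [lt_min_iff]; constructor <;> linarith) (by
      intro t hRt htr hall
      have hu : ∀ s, R ≤ s → s ≤ t → u s ≤ K * s ^ (-γ) := fun s hs hs' => by
        have := (le_min_iff.1 (hall s hs hs')).1
        linarith
      have hv : ∀ s, R ≤ s → s ≤ t → v s ≤ 51 / 50 * b s / (n - 2) / s ^ (n - 2) := fun s hs hs' => by
        have := (le_min_iff.1 (hall s hs hs')).2
        linarith
      have := h.boot_step hn hγ hγ0 hμ hμ0 hp1 hγq hR hK hb0 hβ hbR0 hbR1 h1 h2 h5 h7 h6 hRt hu hv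
      rw [lt_min_iff]; constructor <;> linarith [this.1, this.2.1])
  have hall : ∀ s, R ≤ s → s ≤ r → u s ≤ K * s ^ (-γ) := fun s hs hs' => by
    have := (lt_min_iff.1 (key s ⟨hs, hs'⟩)).1
    linarith
  refine ⟨hall r hRr le_rfl, ?_⟩
  have := h.b_upper hn hγq hR hRr hK.le (fun s hs hs' => hall s hs.le hs'.le)
  linarith

end RadSol
end LE

namespace LE

section
variable {ι : Type*} {l : Filter ι} {n : ℕ} {p q : ι → ℝ} {u v a b : ι → ℝ → ℝ}

set_option maxHeartbeats 1000000 in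
lemma ev_decay (hn : 5 ≤ n) (hs : ∀ i, RadSol n (p i) (q i) (u i) (v i) (a i) (b i))
    (hp : Tendsto p l (𝓝 1)) :
    ∃ R K b1 : ℝ, 1 ≤ R ∧ 0 < K ∧ 0 < b1 ∧ ∀ᶠ i in l,
      7 ≤ (((n:ℝ) - 2) * p i - 2) * (q i - 1) ∧ ((n:ℝ) - 2) * |p i - 1| ≤ 1 ∧ 1 < q i ∧
      ∀ r, R ≤ r → u i r ≤ K * r ^ (-(((n:ℝ) - 2) * p i - 2)) ∧ b i r ≤ b1 := by
  obtain ⟨us, vs, as, bs, B, A, hB, hA, fu, fv, u0, upos, vpos, tv, la, lb, lv, lu⟩ :=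
    explicit_solution hn
  have hn5 : (5:ℝ) ≤ n := by exact_mod_cast hn
  have hn4 : 0 < (n:ℝ) - 4 := by linarith
  have hN : 0 < (n:ℝ) - 2 := by linarith
  have hq := tendsto_q hn hs hp
  set qs := ((n:ℝ) + 4) / (n - 4) with hqs
  have hqpos : 0 < qs := by positivity
  set C0 : ℝ := B / (2 * (n - 2)) + 1 with hC0
  set B1 : ℝ := 51 / 50 * (21 / 20) * (2 * B) / ((n:ℝ) - 2) with hB1
  have hB10 : 0 < B1 := by positivity
  have hC00 : 0 < C0 := by positivity
  set K : ℝ := B1 ^ ((1:ℝ) + 1) / (n / (qs + 1) * (B / 2)) + (C0 + B1 ^ (1:ℝ)) / (n - 2) + 1 + A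
    with hK
  have hK0 : 0 < K := by
    have : 0 < B1 ^ ((1:ℝ) + 1) := Real.rpow_pos_of_pos hB10 _
    have : 0 < B1 ^ (1:ℝ) := Real.rpow_pos_of_pos hB10 _
    positivity
  have hAK : A < K := by
    have : 0 < B1 ^ ((1:ℝ) + 1) := Real.rpow_pos_of_pos hB10 _
    have : 0 < B1 ^ (1:ℝ) := Real.rpow_pos_of_pos hB10 _
    have : 0 < B1 ^ ((1:ℝ) + 1) / (n / (qs + 1) * (B / 2)) + (C0 + B1 ^ (1:ℝ)) / (n - 2) := by
      positivity
    linarith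
  have l3 : Tendsto (fun R : ℝ => R ^ (-3:ℝ)) atTop (𝓝 0) := tendsto_rpow_neg_atTop (by norm_num)
  have hev : ∀ᶠ R : ℝ in atTop, 1 ≤ R ∧ B / 2 < bs R ∧ bs R < 2 * B ∧
      6 / 5 * (bs R / (n - 2)) ^ (1:ℝ) * R ^ (2:ℝ) < n / (1 + 1) * as R ∧
      as R < C0 * R ^ (2:ℝ) ∧
      vs R < 51 / 50 * bs R / (n - 2) / R ^ (n - 2) ∧
      us R < K * R ^ (-((n:ℝ) - 4)) ∧
      K ^ qs * R ^ (-3:ℝ) / 3 < B / 2 / 20 ∧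
      20 * (K ^ (qs + 1) * R ^ (-3:ℝ)) < 1 / 50 * (B / 2 / (n - 2)) ^ ((1:ℝ) + 1) ∧
      (B1 ^ ((1:ℝ) + 1) + K ^ (qs + 1) * R ^ (-3:ℝ)) / (n / (qs + 1) * (B / 2)) +
        (C0 + B1 ^ (1:ℝ)) / (n - 2) < K := by
    have e1 : ∀ᶠ R in atTop, B / 2 < bs R := lb.eventually_const_lt (by linarith)
    have e2 : ∀ᶠ R in atTop, bs R < 2 * B := lb.eventually_lt_const (by linarith)
    have e3 : ∀ᶠ R in atTop, 6 / 5 * (bs R / (n - 2)) < n / (1 + 1) * (as R / R ^ 2) := by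
      have t1 := (lb.div_const ((n:ℝ) - 2)).const_mul (6 / 5)
      have t2 := la.const_mul ((n:ℝ) / (1 + 1))
      refine t1.eventually_lt t2 ?_
      have : (n:ℝ) / (1 + 1) * (B / (2 * (n - 2))) = n / 4 * (B / (n - 2)) := by field_simp; norm_num
      rw [this]
      have : 0 < B / ((n:ℝ) - 2) := by positivity
      nlinarith
    have e4 : ∀ᶠ R in atTop, as R / R ^ 2 < C0 := la.eventually_lt_const (by linarith)
    have e5 : ∀ᶠ R in atTop, vs R * R ^ (n - 2) < 51 / 50 * bs R / (n - 2) := by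
      have t1 := (lb.const_mul (51 / 50)).div_const ((n:ℝ) - 2)
      refine lv.eventually_lt t1 ?_
      gcongr; linarith
    have e6 : ∀ᶠ R in atTop, us R * R ^ (n - 4) < K := lu.eventually_lt_const hAK
    have e7 : ∀ᶠ R : ℝ in atTop, K ^ qs * R ^ (-3:ℝ) / 3 < B / 2 / 20 := by
      have := (l3.const_mul (K ^ qs)).div_const 3
      exact this.eventually_lt_const (by rw [mul_zero, zero_div]; positivity)
    have e8 : ∀ᶠ R : ℝ in atTop, 20 * (K ^ (qs + 1) * R ^ (-3:ℝ)) <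
        1 / 50 * (B / 2 / (n - 2)) ^ ((1:ℝ) + 1) := by
      have := (l3.const_mul (K ^ (qs + 1))).const_mul 20
      exact this.eventually_lt_const (by rw [mul_zero, mul_zero]; positivity)
    have e9 : ∀ᶠ R : ℝ in atTop,
        (B1 ^ ((1:ℝ) + 1) + K ^ (qs + 1) * R ^ (-3:ℝ)) / (n / (qs + 1) * (B / 2)) +
        (C0 + B1 ^ (1:ℝ)) / (n - 2) < K := by
      have := (((l3.const_mul (K ^ (qs + 1))).const_add (B1 ^ ((1:ℝ) + 1))).div_const
        (n / (qs + 1) * (B / 2))).add_const ((C0 + B1 ^ (1:ℝ)) / (n - 2))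
      refine this.eventually_lt_const ?_
      rw [mul_zero, add_zero]; linarith
    filter_upwards [e1, e2, e3, e4, e5, e6, e7, e8, e9, eventually_ge_atTop 1] with
      R e1 e2 e3 e4 e5 e6 e7 e8 e9 e10
    have hR0 : 0 < R := by linarith
    refine ⟨e10, e1, e2, ?_, ?_, ?_, ?_, e7, e8, e9⟩
    · rw [Real.rpow_one, Real.rpow_two, ← lt_div_iff₀ (by positivity), mul_div_assoc]; exact e3
    · rw [Real.rpow_two, ← div_lt_iff₀ (by positivity)]; exact e4
    · rw [lt_div_iff₀ (by positivity)]; exact e5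
    · rw [Real.rpow_neg hR0.le, ← div_eq_mul_inv, lt_div_iff₀ (Real.rpow_pos_of_pos hR0 _)]
      have : R ^ ((n:ℝ) - 4) = R ^ (n - 4) := by
        rw [← Real.rpow_natCast, Nat.cast_sub (by omega)]; norm_num
      rw [this]; exact e6
  obtain ⟨R, hR, c1, c2, c3, c4, c5, c6, c7, c8, c9⟩ := hev.exists
  have hR0 : 0 < R := by linarith
  obtain ⟨tu, tv', ta, tb⟩ := all_close hn hs hp fu fv u0 upos vpos tv hR0.le
  refine ⟨R, K, 21 / 20 * (2 * B), hR, hK0, by positivity, ?_⟩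
  have tγ : Tendsto (fun i => ((n:ℝ) - 2) * p i - 2) l (𝓝 ((n:ℝ) - 4)) := by
    have := (hp.const_mul ((n:ℝ) - 2)).sub_const 2
    convert this using 2; ring
  have tμ : Tendsto (fun i => (n:ℝ) - ((n:ℝ) - 2) * p i) l (𝓝 2) := by
    have := (hp.const_mul ((n:ℝ) - 2)).const_sub (n:ℝ)
    convert this using 2; ring
  have tβ : Tendsto (fun i => (n:ℝ) / (p i + 1)) l (𝓝 ((n:ℝ) / (1 + 1))) :=
    tendsto_const_nhds.div (hp.add_const 1) (by norm_num)
  have tα : Tendsto (fun i => (n:ℝ) / (q i + 1)) l (𝓝 ((n:ℝ) / (qs + 1))) :=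
    tendsto_const_nhds.div (hq.add_const 1) (by positivity)
  have tp1 := hp.add_const 1
  have tq1 := hq.add_const 1
  have tRμ : Tendsto (fun i => R ^ ((n:ℝ) - ((n:ℝ) - 2) * p i)) l (𝓝 (R ^ (2:ℝ))) :=
    tendsto_const_nhds.rpow tμ (Or.inl hR0.ne')
  have tRγ : Tendsto (fun i => R ^ (-(((n:ℝ) - 2) * p i - 2))) l (𝓝 (R ^ (-((n:ℝ) - 4)))) :=
    tendsto_const_nhds.rpow tγ.neg (Or.inl hR0.ne')
  have tKq : Tendsto (fun i => K ^ q i) l (𝓝 (K ^ qs)) :=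
    tendsto_const_nhds.rpow hq (Or.inl hK0.ne')
  have tKq1 : Tendsto (fun i => K ^ (q i + 1)) l (𝓝 (K ^ (qs + 1))) :=
    tendsto_const_nhds.rpow tq1 (Or.inl hK0.ne')
  have tB1 : Tendsto (fun i => B1 ^ (p i)) l (𝓝 (B1 ^ (1:ℝ))) :=
    tendsto_const_nhds.rpow hp (Or.inl hB10.ne')
  have tB2 : Tendsto (fun i => B1 ^ (p i + 1)) l (𝓝 (B1 ^ ((1:ℝ) + 1))) :=
    tendsto_const_nhds.rpow tp1 (Or.inl hB10.ne')
  have d1 := tγ.eventually_const_lt hn4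
  have d2 := tμ.eventually_const_lt (show (1:ℝ) < 2 by norm_num)
  have d3 := hp.eventually_lt_const (show (1:ℝ) < 3 / 2 by norm_num)
  have hγqs : ((n:ℝ) - 4) * qs = n + 4 := by rw [hqs]; field_simp
  have d4 := ((tγ.mul hq).sub_const (n:ℝ)).eventually_const_lt (show (3:ℝ) < _ by rw [hγqs]; linarith)
  have d5 := (tμ.const_mul (6 / 5)).eventually_lt tβ (by linarith)
  have d6 := tb.eventually_const_lt c1
  have d7 := tb.eventually_lt_const c2
  have hbx : bs R / ((n:ℝ) - 2) ≠ 0 := by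
    have : 0 < bs R := by linarith
    positivity
  have d8 := ((((tb.div_const ((n:ℝ) - 2)).rpow hp (Or.inl hbx)).const_mul (6 / 5)).mul
    tRμ).eventually_lt (tβ.mul ta) c3
  have d9 := ta.eventually_lt (tRμ.const_mul C0) c4
  have d10 := tv'.eventually_lt (((tb.const_mul (51 / 50)).div_const ((n:ℝ) - 2)).div_const
    (R ^ (n - 2))) c5
  have d11 := tu.eventually_lt (tRγ.const_mul K) c6
  have d12 := ((tKq.mul_const (R ^ (-3:ℝ))).div_const 3).eventually_lt_const c7
  have hBN : B / 2 / ((n:ℝ) - 2) ≠ 0 := by positivity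
  have d13 := ((tKq1.mul_const (R ^ (-3:ℝ))).const_mul 20).eventually_lt
    ((Tendsto.rpow (tendsto_const_nhds (x := B / 2 / ((n:ℝ) - 2))) tp1 (Or.inl hBN)).const_mul (1 / 50)) c8
  have d14 := (((tB2.add (tKq1.mul_const (R ^ (-3:ℝ)))).div (tα.mul_const (B / 2))
    (by positivity)).add ((tB1.const_add C0).div_const ((n:ℝ) - 2))).eventually_lt_const c9
  have d15 := (tγ.mul (hq.sub_const 1)).eventually_const_lt
    (show (7:ℝ) < _ by rw [mul_sub, hγqs]; linarith)
  have d16 : ∀ᶠ i in l, ((n:ℝ) - 2) * |p i - 1| < 1 := by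
    have := ((hp.sub_const 1).abs).const_mul ((n:ℝ) - 2)
    exact this.eventually_lt_const (by norm_num)
  have d17 := hq.eventually_const_lt (show (1:ℝ) < qs by rw [hqs, lt_div_iff₀ hn4]; linarith)
  filter_upwards [d1, d2, d3, d4, d5, d6, d7, d8, d9, d10, d11, d12, d13, d14, d15, d16, d17] with
    i d1 d2 d3 d4 d5 d6 d7 d8 d9 d10 d11 d12 d13 d14 d15 d16 d17
  refine ⟨d15.le, d16.le, d17, fun r hr => ?_⟩
  have := (hs i).boot hn rfl d1 rfl d2.le d3.le d4.le hR hK0 (by positivity : 0 < B / 2) d5.le d6.le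
    d7.le d8.le d9.le d10 d11 d12.le d13 d14 hr
  exact ⟨this.1, this.2.trans (by linarith)⟩

end

/-- decay of ground states for `p` close to `1` -/
theorem decay {n : ℕ} (hn : 5 ≤ n) : ∃ ε : ℝ, 0 < ε ∧ ∀ (p q : ℝ) (u v a b : ℝ → ℝ),
    RadSol n p q u v a b → |p - 1| ≤ ε → ∃ C : ℝ, 0 < C ∧ (∀ r, 0 ≤ r → b r ≤ C) ∧
      (∀ r, 1 ≤ r → p * v r ^ (p - 1) ≤ C * r) ∧
      (∀ r, 1 ≤ r → q * u r ^ (q - 1) ≤ C * (r ^ 7)⁻¹) := by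
  have hn5 : (5:ℝ) ≤ n := by exact_mod_cast hn
  have hN : 0 < (n:ℝ) - 2 := by linarith
  let ι := {d : (ℝ × ℝ) × ((ℝ → ℝ) × (ℝ → ℝ)) × ((ℝ → ℝ) × (ℝ → ℝ)) //
    RadSol n d.1.1 d.1.2 d.2.1.1 d.2.1.2 d.2.2.1 d.2.2.2}
  let pp : ι → ℝ := fun d => d.1.1.1
  obtain ⟨R, K, b1, hR, hK, hb1, hev⟩ := ev_decay (ι := ι) (l := comap pp (𝓝 1)) (n := n) (p := pp)
    (q := fun d => d.1.1.2) (u := fun d => d.1.2.1.1) (v := fun d => d.1.2.1.2)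
    (a := fun d => d.1.2.2.1) (b := fun d => d.1.2.2.2) hn (fun d => d.2) tendsto_comap
  rw [eventually_comap] at hev
  obtain ⟨δ, hδ, hball⟩ := Metric.eventually_nhds_iff.1 hev
  refine ⟨δ / 2, by linarith, ?_⟩
  intro p q u v a b h hpe
  have hR0 : 0 < R := by linarith
  have hp := h.hp
  have hq := h.hq
  obtain ⟨g1, g2, hq1, g3⟩ := hball (y := p) (by rw [Real.dist_eq]; linarith)
    (⟨((p, q), (u, v), (a, b)), h⟩ : ι) rfl
  simp only [pp] at g1 g2 g3 hq1
  have hv0 := h.vpos 0 le_rfl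
  have hvle : ∀ r, 0 ≤ r → v r ≤ v 0 := fun r hr => h.fv.f_anti (by omega) h.gu le_rfl hr
  -- lower bound for v
  have hb1pos : 0 < b 1 := by
    have := h.fv.a_ge (M := u 1 ^ q) (by omega) (T := 1) (fun s hs hs1 => by
      apply Real.rpow_le_rpow (h.upos 1 (by norm_num)).le _ hq.le
      exact h.fu.f_anti (by omega) h.gv hs.le hs1.le) (zero_le_one) le_rfl
    have h2 : 0 < u 1 ^ q := Real.rpow_pos_of_pos (h.upos 1 (by norm_num)) _
    have : 0 < u 1 ^ q * 1 ^ n / (n:ℝ) := by positivity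
    linarith
  set c := b 1 / ((n:ℝ) - 2) with hc
  have hc0 : 0 < c := by positivity
  have habs := abs_le.1 (le_of_eq (rfl : |p - 1| = |p - 1|))
  set C1 := p * (v 0 ^ (p - 1) + c ^ (p - 1)) with hC1
  have hv0p : 0 < v 0 ^ (p - 1) := Real.rpow_pos_of_pos hv0 _
  have hcp : 0 < c ^ (p - 1) := Real.rpow_pos_of_pos hc0 _
  have hC10 : 0 < C1 := by positivity
  set C2 := q * (R ^ 7 + K ^ (q - 1)) with hC2
  have hKq : 0 < K ^ (q - 1) := Real.rpow_pos_of_pos hK _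
  have hC20 : 0 < C2 := by positivity
  refine ⟨b1 + C1 + C2, by positivity, ?_, ?_, ?_⟩
  · intro r hr
    have h1 := (g3 (max r R) (le_max_right _ _)).2
    have h2 := h.fv.a_mono h.gu hr (le_max_left r R)
    linarith
  · intro r hr
    have hr0 : 0 < r := by linarith
    have hvr := h.vpos r hr0.le
    have key : v r ^ (p - 1) ≤ (v 0 ^ (p - 1) + c ^ (p - 1)) * r := by
      rcases le_total 1 p with hp1 | hp1
      · have : v r ^ (p - 1) ≤ v 0 ^ (p - 1) := Real.rpow_le_rpow hvr.le (hvle r hr0.le) (by linarith)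
        nlinarith
      · have h1 := h.v_lower hn one_pos hr
        have h2 : v r ^ (p - 1) ≤ (c / r ^ (n - 2)) ^ (p - 1) :=
          Real.rpow_le_rpow_of_nonpos (by positivity) h1 (by linarith)
        rw [div_pow_rpow (by omega) hc0.le hr0] at h2
        have h3 : r ^ (-(((n:ℝ) - 2) * (p - 1))) ≤ r ^ (1:ℝ) := by
          apply Real.rpow_le_rpow_of_exponent_le hr
          rw [abs_of_nonpos (by linarith)] at g2
          linarith
        rw [Real.rpow_one] at h3
        have h4 : c ^ (p - 1) * r ^ (-(((n:ℝ) - 2) * (p - 1))) ≤ c ^ (p - 1) * r := by gcongr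
        nlinarith
    calc p * v r ^ (p - 1) ≤ p * ((v 0 ^ (p - 1) + c ^ (p - 1)) * r) := by gcongr
      _ = C1 * r := by rw [hC1]; ring
      _ ≤ _ := by gcongr; linarith
  · intro r hr
    have hr0 : 0 < r := by linarith
    have hur := h.upos r hr0.le
    have key : u r ^ (q - 1) ≤ (R ^ 7 + K ^ (q - 1)) * (r ^ 7)⁻¹ := by
      rw [← div_eq_mul_inv, le_div_iff₀ (by positivity)]
      rcases le_total r R with hrR | hrR
      · have h1 : u r ^ (q - 1) ≤ 1 := Real.rpow_le_one hur.le (h.u_le_one hn hr0.le) (by linarith)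
        have h2 : r ^ 7 ≤ R ^ 7 := by gcongr
        have h3 : 0 < r ^ 7 := by positivity
        nlinarith
      · have h1 := (g3 r hrR).1
        have h2 : u r ^ (q - 1) ≤ (K * r ^ (-(((n:ℝ) - 2) * p - 2))) ^ (q - 1) :=
          Real.rpow_le_rpow hur.le h1 (by linarith)
        rw [Real.mul_rpow hK.le (by positivity), ← Real.rpow_mul hr0.le] at h2
        have h3 : r ^ (-(((n:ℝ) - 2) * p - 2) * (q - 1)) ≤ r ^ (-7:ℝ) :=
          Real.rpow_le_rpow_of_exponent_le hr (by linarith)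
        have h4 : r ^ (-7:ℝ) * r ^ 7 = 1 := by
          rw [← Real.rpow_natCast, ← Real.rpow_add hr0]; norm_num
        have hR7 : 0 < R ^ 7 := by positivity
        calc u r ^ (q - 1) * r ^ 7 ≤ K ^ (q - 1) * r ^ (-7:ℝ) * r ^ 7 := by
              gcongr
              exact h2.trans (by gcongr)
          _ = K ^ (q - 1) := by rw [mul_assoc, h4, mul_one]
          _ ≤ _ := by linarith
    calc q * u r ^ (q - 1) ≤ q * ((R ^ 7 + K ^ (q - 1)) * (r ^ 7)⁻¹) := by gcongr
      _ = C2 * (r ^ 7)⁻¹ := by rw [hC2]; ring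
      _ ≤ _ := by gcongr; linarith

end LE

namespace LE

lemma hasDerivAt_ipow (k : ℕ) {r : ℝ} (hr : r ≠ 0) :
    HasDerivAt (fun s : ℝ => (s ^ k)⁻¹) (-(k * (r ^ (k + 1))⁻¹)) r := by
  have h := (hasDerivAt_pow k r).inv (pow_ne_zero k hr)
  refine h.congr_deriv ?_
  rcases k with _ | k
  · simp
  · simp only [Nat.add_sub_cancel]
    field_simp
    ring

lemma contDiffAt_ipow (k : ℕ) {r : ℝ} (hr : r ≠ 0) :
    ContDiffAt ℝ 2 (fun s : ℝ => (s ^ k)⁻¹) r :=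
  (contDiffAt_id.pow k).inv (pow_ne_zero k hr)

section
variable {n : ℕ}

lemma cd_ipow (k : ℕ) {x y : Eu n} (hxy : x - y ≠ 0) :
    ContDiffAt ℝ 2 (fun z : Eu n => (‖z - y‖ ^ k)⁻¹) x :=
  contDiffAt_radial (g := fun s : ℝ => (s ^ k)⁻¹) hxy
    (contDiffAt_ipow k (norm_ne_zero_iff.2 hxy))

lemma cd_ipow0 (k : ℕ) {x : Eu n} (hx : x ≠ 0) :
    ContDiffAt ℝ 2 (fun z : Eu n => (‖z‖ ^ k)⁻¹) x := by
  simpa using cd_ipow (y := 0) k (x := x) (by simpa using hx)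

lemma lap_ipow (k : ℕ) {x y : Eu n} (hxy : x - y ≠ 0) :
    lap (fun z : Eu n => (‖z - y‖ ^ k)⁻¹) x = k * (k + 2 - n) * (‖x - y‖ ^ (k + 2))⁻¹ := by
  have hr : ‖x - y‖ ≠ 0 := norm_ne_zero_iff.2 hxy
  have h2 : HasDerivAt (fun r : ℝ => -(k * (r ^ (k + 1))⁻¹))
      (k * ((k + 1) * (‖x - y‖ ^ (k + 2))⁻¹)) ‖x - y‖ := by
    refine (((hasDerivAt_ipow (k + 1) hr).const_mul (k:ℝ)).neg).congr_deriv ?_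
    push_cast; ring
  rw [lap_radial (g := fun s : ℝ => (s ^ k)⁻¹) hxy (contDiffAt_ipow k hr)
    ((isOpen_ne.eventually_mem hr).mono fun r (hr : r ≠ 0) => hasDerivAt_ipow k hr) h2]
  field_simp
  ring

lemma fderiv_ipow (k : ℕ) {x : Eu n} (hx : x ≠ 0) (e : Eu n) :
    fderiv ℝ (fun z : Eu n => (‖z‖ ^ k)⁻¹) x e = -(k * inner ℝ e x * (‖x‖ ^ (k + 2))⁻¹) := by
  have hr : ‖x‖ ≠ 0 := norm_ne_zero_iff.2 hx
  rw [fderiv_radial (g := fun s : ℝ => (s ^ k)⁻¹) e hx (contDiffAt_ipow k hr) (hasDerivAt_ipow k hr),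
    real_inner_comm]
  field_simp
  ring

lemma cd_lin (e x : Eu n) : ContDiffAt ℝ 2 (fun y : Eu n => inner ℝ e y) x :=
  (contDiff_const.inner ℝ contDiff_id).contDiffAt

lemma cd_xipow (k : ℕ) (e : Eu n) {x : Eu n} (hx : x ≠ 0) :
    ContDiffAt ℝ 2 (fun z : Eu n => inner ℝ e z * (‖z‖ ^ k)⁻¹) x := (cd_lin e x).mul (cd_ipow0 k hx)

lemma lap_xipow (k : ℕ) (e : Eu n) {x : Eu n} (hx : x ≠ 0) :
    lap (fun z : Eu n => inner ℝ e z * (‖z‖ ^ k)⁻¹) x =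
      -(k * (n - k) * (inner ℝ e x * (‖x‖ ^ (k + 2))⁻¹)) := by
  rw [lap_linear_mul e (cd_ipow0 k hx), fderiv_ipow k hx]
  have := lap_ipow k (x := x) (y := 0) (by simpa using hx)
  simp only [sub_zero] at this
  rw [this]; ring

lemma lap_xxipow (k : ℕ) {e : Eu n} (he : ‖e‖ = 1) {x : Eu n} (hx : x ≠ 0) :
    lap (fun z : Eu n => inner ℝ e z * (inner ℝ e z * (‖z‖ ^ k)⁻¹)) x =
      2 * (‖x‖ ^ k)⁻¹ - k * (n - k + 2) * (inner ℝ e x ^ 2 * (‖x‖ ^ (k + 2))⁻¹) := by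
  rw [lap_linear_mul e (cd_xipow k e hx), lap_xipow k e hx]
  have h1 : HasFDerivAt (fun z : Eu n => inner ℝ e z) (innerSL ℝ e) x := (innerSL ℝ e).hasFDerivAt
  have h2 := ((cd_ipow0 k hx).differentiableAt (by norm_num)).hasFDerivAt
  have h3 := (h1.mul h2).fderiv
  have h4 : fderiv ℝ (fun z : Eu n => inner ℝ e z * (‖z‖ ^ k)⁻¹) x e =
      inner ℝ e x * fderiv ℝ (fun z : Eu n => (‖z‖ ^ k)⁻¹) x e + (‖x‖ ^ k)⁻¹ * inner ℝ e e := by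
    have := congrArg (fun L => L e) h3
    simpa [Pi.mul_def] using this
  rw [h4, fderiv_ipow k hx, real_inner_self_eq_norm_sq, he]
  ring

lemma xe_le {e : Eu n} (he : ‖e‖ = 1) (x : Eu n) : inner ℝ e x ≤ ‖x‖ := by
  have := real_inner_le_norm e x
  rwa [he, one_mul] at this

/-- comparison with a barrier outside the unit ball in a half space -/
lemma barrier (hn : 5 ≤ n) {e : Eu n} {h Z f : Eu n → ℝ} {L D c : ℝ}
    (hh : ContDiff ℝ 2 h) (h0 : ∀ x, inner ℝ e x = 0 → h x = 0)
    (hL : ∀ x, 0 ≤ inner ℝ e x → ‖x‖ ≤ 1 → |h x| ≤ L * inner ℝ e x) (hL0 : 0 ≤ L)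
    (ht : Tendsto h (cocompact _) (𝓝 0))
    (hZ : ∀ x : Eu n, x ≠ 0 → ContDiffAt ℝ 2 Z x) (hZ0 : ∀ x, 0 ≤ inner ℝ e x → 1 ≤ ‖x‖ → 0 ≤ Z x)
    (hc : 0 < c) (hZ1 : ∀ x, 0 ≤ inner ℝ e x → ‖x‖ = 1 → c * inner ℝ e x ≤ Z x)
    (hD : 0 ≤ D) (hlZ : ∀ x, 0 < inner ℝ e x → 1 < ‖x‖ → f x ≤ -lap Z x)
    (hf : ∀ x, 0 < inner ℝ e x → 1 < ‖x‖ → 0 ≤ f x)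
    (hlh : ∀ x, 0 < inner ℝ e x → 1 < ‖x‖ → |lap h x| ≤ D * f x) :
    ∃ D' : ℝ, 0 ≤ D' ∧ ∀ x, 0 ≤ inner ℝ e x → 1 ≤ ‖x‖ → |h x| ≤ D' * Z x := by
  have hci : Continuous (fun x : Eu n => inner ℝ e x) := by fun_prop
  have main : ∀ k : Eu n → ℝ, ContDiff ℝ 2 k → (∀ x, inner ℝ e x = 0 → k x = 0) →
      (∀ x, 0 ≤ inner ℝ e x → ‖x‖ ≤ 1 → |k x| ≤ L * inner ℝ e x) → Tendsto k (cocompact _) (𝓝 0) →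
      (∀ x, 0 < inner ℝ e x → 1 < ‖x‖ → |lap k x| ≤ D * f x) →
      ∀ x, 0 ≤ inner ℝ e x → 1 ≤ ‖x‖ → k x ≤ (D + L / c) * Z x := by
    intro k hk hk0 hkL hkt hlk
    have hbd : ∀ x, 0 ≤ inner ℝ e x → 1 ≤ ‖x‖ → ¬ (0 < inner ℝ e x ∧ 1 < ‖x‖) →
        k x ≤ (D + L / c) * Z x := by
      intro x hx hx1 hnot
      rcases hx.eq_or_lt with hx0 | hx0
      · rw [hk0 x hx0.symm]
        have := hZ0 x hx hx1
        positivity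
      · have hx1' : ‖x‖ = 1 := by
          by_contra hne
          exact hnot ⟨hx0, lt_of_le_of_ne hx1 (Ne.symm hne)⟩
        have e1 := (le_abs_self _).trans (hkL x hx hx1'.le)
        have e2 := hZ1 x hx hx1'
        have e3 : L * inner ℝ e x ≤ L / c * Z x := by
          calc L * inner ℝ e x = L / c * (c * inner ℝ e x) := by field_simp
            _ ≤ _ := by gcongr
        have e4 := mul_nonneg hD (hZ0 x hx hx1)
        linarith
    have hx0 : ∀ x : Eu n, 1 ≤ ‖x‖ → x ≠ 0 := fun x hx h => by simp [h] at hx; linarith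
    intro x hx hx1
    by_cases hxΩ : 0 < inner ℝ e x ∧ 1 < ‖x‖
    swap
    · exact hbd x hx hx1 hxΩ
    have := maxprin (n := n) (by omega) (Ω := {x | 0 < inner ℝ e x ∧ 1 < ‖x‖})
      (C := {x | 0 ≤ inner ℝ e x ∧ 1 ≤ ‖x‖}) (h := fun x => k x - (D + L / c) * Z x)
      ((isOpen_lt continuous_const hci).inter (isOpen_lt continuous_const continuous_norm))
      ((isClosed_le continuous_const hci).inter (isClosed_le continuous_const continuous_norm))
      (fun x hx => ⟨hx.1.le, hx.2.le⟩)
      (fun x hx => ((hk.contDiffAt.continuousAt).sub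
        ((hZ x (hx0 x hx.2)).continuousAt.const_mul _)).continuousWithinAt)
      (fun x hx => hk.contDiffAt.sub (contDiffAt_const.mul (hZ x (hx0 x hx.2.le))))
      (fun x hx => by
        have cz := hZ x (hx0 x hx.2.le)
        rw [lap_sub hk.contDiffAt (contDiffAt_const.mul cz), lap_cmul _ cz]
        have e1 := hlk x hx.1 hx.2
        have e2 := hlZ x hx.1 hx.2
        have e3 := neg_abs_le (lap k x)
        have e4 := hf x hx.1 hx.2
        have e5 : D * f x ≤ D * (-lap Z x) := by gcongr
        have e6 : 0 ≤ L / c * (-lap Z x) := mul_nonneg (by positivity) (by linarith)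
        linarith)
      (fun x hx hnot => by
        have := hbd x hx.1 hx.2 hnot
        linarith)
      (fun ε hε => by
        have h1 := hkt.eventually_lt_const hε
        rw [← Metric.cobounded_eq_cocompact, ← comap_norm_atTop, eventually_comap] at h1
        obtain ⟨R, hR⟩ := eventually_atTop.1 h1
        refine ⟨R, fun x hx hxR => ?_⟩
        have e1 := hR ‖x‖ hxR x rfl
        have e2 : 0 ≤ (D + L / c) * Z x := mul_nonneg (by positivity) (hZ0 x hx.1.le hx.2.le)
        linarith) x hxΩ
    linarith
  refine ⟨D + L / c, by positivity, fun x hx hx1 => ?_⟩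
  rw [abs_le]
  have m1 := main h hh h0 hL ht hlh x hx hx1
  have m2 := main (fun x => -1 * h x) (contDiff_const.mul hh) (fun x hx => by rw [h0 x hx]; ring)
    (fun x hx hx1 => by
      rw [abs_mul]; simpa using hL x hx hx1) (by simpa using ht.const_mul (-1))
    (fun x hx hx1 => by
      rw [lap_cmul _ hh.contDiffAt, abs_mul]; simpa using hlh x hx hx1) x hx hx1
  constructor <;> linarith

/-- Lipschitz estimate near the boundary of the half space -/
lemma lip_half {e : Eu n} (he : ‖e‖ = 1) {h : Eu n → ℝ} (hh : ContDiff ℝ 2 h)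
    (h0 : ∀ x, inner ℝ e x = 0 → h x = 0) :
    ∃ L : ℝ, 0 ≤ L ∧ ∀ x, 0 ≤ inner ℝ e x → ‖x‖ ≤ 1 → |h x| ≤ L * inner ℝ e x := by
  obtain ⟨L, hL⟩ := (isCompact_closedBall (0:Eu n) 1).exists_bound_of_continuousOn
    (hh.continuous_fderiv (by norm_num)).continuousOn
  have hL0 : 0 ≤ L := (norm_nonneg _).trans (hL 0 (by simp))
  refine ⟨L, hL0, fun x hx hx1 => ?_⟩
  set y := x - (inner ℝ e x) • e with hy
  have hey : inner ℝ e y = 0 := by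
    rw [hy, inner_sub_right, inner_smul_right, real_inner_self_eq_norm_sq, he]; ring
  have hy1 : ‖y‖ ≤ 1 := by
    have : ‖y‖ ^ 2 = ‖x‖ ^ 2 - inner ℝ e x ^ 2 := by
      rw [hy, norm_sub_sq_real, inner_smul_right, norm_smul, he, real_inner_comm e x, mul_one,
        Real.norm_eq_abs, sq_abs]
      ring
    have h2 : ‖x‖ ^ 2 ≤ 1 := by nlinarith [norm_nonneg x]
    nlinarith [norm_nonneg y, sq_nonneg (inner ℝ e x)]
  have := (convex_closedBall (0:Eu n) 1).norm_image_sub_le_of_norm_fderiv_le (f := h) (𝕜 := ℝ)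
    (fun z _ => hh.contDiffAt.differentiableAt (by norm_num)) hL (x := y) (y := x)
    (by simpa using hy1) (by simpa using hx1)
  rw [h0 y hey, sub_zero] at this
  have e1 : ‖x - y‖ = inner ℝ e x := by
    rw [hy, sub_sub_cancel, norm_smul, he, mul_one, Real.norm_eq_abs, abs_of_nonneg hx]
  rwa [e1] at this

end
end LE

namespace LE

/-- A positive pair of solutions in the half space `⟨e, x⟩ > 0` vanishing on its boundary. -/
structure HS (n : ℕ) (e : Eu n) (P Q A B : Eu n → ℝ) (C : ℝ) : Prop where
  he : ‖e‖ = 1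
  hC : 0 < C
  Ppos : ∀ x, 0 < P x
  Qpos : ∀ x, 0 < Q x
  Pb : ∀ x, 1 ≤ ‖x‖ → P x ≤ C * ‖x‖
  Qb : ∀ x, 1 ≤ ‖x‖ → Q x ≤ C * (‖x‖ ^ 7)⁻¹
  cA : Continuous A
  cB : Continuous B
  dA : ∀ x, x ≠ 0 → ContDiffAt ℝ 2 A x
  dB : ∀ x, x ≠ 0 → ContDiffAt ℝ 2 B x
  lA : ∀ x, x ≠ 0 → -lap A x = P x * B x
  lB : ∀ x, x ≠ 0 → -lap B x = Q x * A x
  A0 : ∀ x, inner ℝ e x = 0 → A x = 0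
  B0 : ∀ x, inner ℝ e x = 0 → B x = 0
  tA : Tendsto A (cocompact _) (𝓝 0)
  tB : Tendsto B (cocompact _) (𝓝 0)
  Bl : ∀ x, 0 < inner ℝ e x → inner ℝ e x ≤ C * (B x * (1 + ‖x‖) ^ n)
  Bu : ∀ x, 0 < inner ℝ e x → B x * (1 + ‖x‖) ^ n ≤ C * inner ℝ e x

/-- solutions of the linearised system, vanishing on the hyperplane and at infinity -/
structure LS (n : ℕ) (e : Eu n) (P Q w z : Eu n → ℝ) : Prop where
  dw : ContDiff ℝ 2 w
  dz : ContDiff ℝ 2 z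
  lw : ∀ x, -lap w x = P x * z x
  lz : ∀ x, -lap z x = Q x * w x
  w0 : ∀ x, inner ℝ e x = 0 → w x = 0
  z0 : ∀ x, inner ℝ e x = 0 → z x = 0
  tw : Tendsto w (cocompact _) (𝓝 0)
  tz : Tendsto z (cocompact _) (𝓝 0)

section
variable {n : ℕ} {e : Eu n} {P Q A B w z : Eu n → ℝ} {C : ℝ}

lemma LS.neg (h : LS n e P Q w z) : LS n e P Q (fun x => -1 * w x) (fun x => -1 * z x) where
  dw := contDiff_const.mul h.dw
  dz := contDiff_const.mul h.dz
  lw := fun x => by rw [lap_cmul _ h.dw.contDiffAt]; linarith [h.lw x]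
  lz := fun x => by rw [lap_cmul _ h.dz.contDiffAt]; linarith [h.lz x]
  w0 := fun x hx => by rw [h.w0 x hx]; ring
  z0 := fun x hx => by rw [h.z0 x hx]; ring
  tw := by simpa using h.tw.const_mul (-1)
  tz := by simpa using h.tz.const_mul (-1)

lemma bounded_of_tendsto {f : Eu n → ℝ} (hf : Continuous f) (ht : Tendsto f (cocompact _) (𝓝 0)) :
    ∃ W : ℝ, 0 < W ∧ ∀ x, |f x| ≤ W := by
  have h1 := ht.abs.eventually_lt_const (show |(0:ℝ)| < 1 by norm_num)
  rw [← Metric.cobounded_eq_cocompact, ← comap_norm_atTop, eventually_comap] at h1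
  obtain ⟨R, hR⟩ := eventually_atTop.1 h1
  obtain ⟨L, hL⟩ := (isCompact_closedBall (0:Eu n) R).exists_bound_of_continuousOn hf.continuousOn
  refine ⟨max L 1, by positivity, fun x => ?_⟩
  rcases le_total R ‖x‖ with h | h
  · exact (hR ‖x‖ h x rfl).le.trans (le_max_right _ _)
  · exact (hL x (by simpa using h)).trans (le_max_left _ _)

lemma ne_zero_of_xe {x : Eu n} (h : 0 < inner ℝ e x) : x ≠ 0 := fun h0 => by
  rw [h0, inner_zero_right] at h; exact lt_irrefl _ h

lemma HS.step (hn : 5 ≤ n) {C : ℝ} (hC : 0 ≤ C) {w : Eu n → ℝ} {k : ℕ} (hk : 1 ≤ k) (hkn : k + 1 ≤ n)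
    {e : Eu n}
    (hw : ContDiff ℝ 2 w) (w0 : ∀ x, inner ℝ e x = 0 → w x = 0) (he : ‖e‖ = 1)
    (tw : Tendsto w (cocompact _) (𝓝 0))
    (hS : ∀ x, 0 < inner ℝ e x → 1 < ‖x‖ → |lap w x| ≤ C * (inner ℝ e x * (‖x‖ ^ (k + 2))⁻¹)) :
    ∃ D : ℝ, 0 ≤ D ∧ ∀ x, 0 ≤ inner ℝ e x → 1 ≤ ‖x‖ → |w x| ≤ D * (inner ℝ e x * (‖x‖ ^ k)⁻¹) := by
  obtain ⟨L, hL0, hL⟩ := lip_half he hw w0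
  have hk1 : (1:ℝ) ≤ k := by exact_mod_cast hk
  have hk2 : (k:ℝ) + 1 ≤ n := by exact_mod_cast hkn
  refine barrier hn (f := fun x => inner ℝ e x * (‖x‖ ^ (k + 2))⁻¹) (c := 1) hw w0 hL hL0 tw
    (fun x hx => cd_xipow k e hx) (fun x hx hx1 => by positivity) one_pos
    (fun x hx hx1 => by simp [hx1]) hC ?_ (fun x hx hx1 => by positivity) hS
  intro x hx hx1
  rw [lap_xipow k e (ne_zero_of_xe hx), neg_neg]
  apply le_mul_of_one_le_left (by positivity)
  nlinarith

lemma HS.decay_w (h : HS n e P Q A B C) (hn : 5 ≤ n) (hl : LS n e P Q w z) :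
    ∃ D : ℝ, 0 ≤ D ∧ ∀ x, 0 ≤ inner ℝ e x → 1 ≤ ‖x‖ → |z x| ≤ D * (inner ℝ e x * (‖x‖ ^ n)⁻¹) := by
  have hn5 : (5:ℝ) ≤ n := by exact_mod_cast hn
  have hC := h.hC
  obtain ⟨W, hW0, hW⟩ := bounded_of_tendsto hl.dw.continuous hl.tw
  obtain ⟨L, hL0, hL⟩ := lip_half h.he hl.dz hl.z0
  have hlz : ∀ x, |lap z x| = Q x * |w x| := fun x => by
    rw [← abs_neg, hl.lz x, abs_mul, abs_of_pos (h.Qpos x)]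
  have hlw : ∀ x, |lap w x| = P x * |z x| := fun x => by
    rw [← abs_neg, hl.lw x, abs_mul, abs_of_pos (h.Ppos x)]
  -- step 0
  obtain ⟨D0, hD0, hz0⟩ : ∃ D : ℝ, 0 ≤ D ∧ ∀ x, 0 ≤ inner ℝ e x → 1 ≤ ‖x‖ →
      |z x| ≤ D * (inner ℝ e x * (‖x‖ ^ 4)⁻¹) := by
    set k : ℝ := 10 + 3 * n with hk
    have hk1 : 1 ≤ k := by linarith
    have hxx : ∀ x : Eu n, 0 ≤ inner ℝ e x → 1 ≤ ‖x‖ →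
        inner ℝ e x * (inner ℝ e x * (‖x‖ ^ 5)⁻¹) ≤ inner ℝ e x * (‖x‖ ^ 4)⁻¹ := by
      intro x hx hx1
      have h1 := xe_le h.he x
      have : (‖x‖ ^ 4)⁻¹ = ‖x‖ * (‖x‖ ^ 5)⁻¹ := by
        have : ‖x‖ ≠ 0 := by linarith
        field_simp
      rw [this]
      gcongr
    have hb : ∀ x : Eu n, 0 ≤ inner ℝ e x → 1 ≤ ‖x‖ → 1 / 2 * (inner ℝ e x * (‖x‖ ^ 4)⁻¹) ≤
        k * (inner ℝ e x * (‖x‖ ^ 4)⁻¹) - 1 / 2 * (inner ℝ e x * (inner ℝ e x * (‖x‖ ^ 5)⁻¹)) := by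
      intro x hx hx1
      have h1 := hxx x hx hx1
      have h2 : 1 * (inner ℝ e x * (‖x‖ ^ 4)⁻¹) ≤ k * (inner ℝ e x * (‖x‖ ^ 4)⁻¹) := by gcongr
      linarith
    have hcz : ∀ x : Eu n, x ≠ 0 → ContDiffAt ℝ 2
        (fun x : Eu n => inner ℝ e x * (inner ℝ e x * (‖x‖ ^ 5)⁻¹)) x :=
      fun x hx => (cd_lin e x).mul (cd_xipow 5 e hx)
    obtain ⟨D, hD, hD1⟩ := barrier hn (e := e) (h := z)
      (Z := fun x => k * (inner ℝ e x * (‖x‖ ^ 4)⁻¹) -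
        1 / 2 * (inner ℝ e x * (inner ℝ e x * (‖x‖ ^ 5)⁻¹)))
      (f := fun x => (‖x‖ ^ 7)⁻¹) (L := L) (D := C * W) (c := 1 / 2) hl.dz hl.z0 hL hL0 hl.tz
      (fun x hx => (contDiffAt_const.mul (cd_xipow 4 e hx)).sub (contDiffAt_const.mul (hcz x hx)))
      (fun x hx hx1 => le_trans (by positivity) (hb x hx hx1)) (by norm_num)
      (fun x hx hx1 => by
        have := hb x hx hx1.ge
        simpa [hx1] using this) (by positivity)
      (fun x hx hx1 => by
        have hx0 := ne_zero_of_xe hx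
        rw [lap_sub (contDiffAt_const.mul (cd_xipow 4 e hx0)) (contDiffAt_const.mul (hcz x hx0)),
          lap_cmul _ (cd_xipow 4 e hx0), lap_cmul _ (hcz x hx0), lap_xipow 4 e hx0,
          lap_xxipow 5 h.he hx0]
        have h1 := xe_le h.he x
        have e1 : (‖x‖ ^ (4 + 2))⁻¹ = ‖x‖ * (‖x‖ ^ (5 + 2))⁻¹ := by
          have : ‖x‖ ≠ 0 := by linarith
          field_simp
          ring
        have e2 : (‖x‖ ^ 7)⁻¹ ≤ (‖x‖ ^ 5)⁻¹ := by
          apply inv_anti₀ (by positivity)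
          exact pow_le_pow_right₀ hx1.le (by norm_num)
        have e3 : inner ℝ e x ^ 2 * (‖x‖ ^ (5 + 2))⁻¹ ≤ inner ℝ e x * (‖x‖ ^ (4 + 2))⁻¹ := by
          rw [e1, pow_two, mul_assoc]; gcongr
        have e4 : 0 ≤ inner ℝ e x ^ 2 * (‖x‖ ^ (5 + 2))⁻¹ := by positivity
        set X := inner ℝ e x ^ 2 * (‖x‖ ^ (5 + 2))⁻¹
        set Y := inner ℝ e x * (‖x‖ ^ (4 + 2))⁻¹
        push_cast
        have e5 : (5 * ((n:ℝ) - 5 + 2)) * X ≤ (5 * (n - 5 + 2)) * Y := by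
          apply mul_le_mul_of_nonneg_left e3; linarith
        have e6 : 0 ≤ Y := e4.trans e3
        have e7 : 0 ≤ (4 * ((n:ℝ) - 4) - 4) * Y := mul_nonneg (by linarith) e6
        have e8 : k * Y ≤ k * ((4 * ((n:ℝ) - 4)) * Y) := by
          apply mul_le_mul_of_nonneg_left _ (by linarith); nlinarith
        have e9 : 0 ≤ X * n := by positivity
        nlinarith)
      (fun x hx hx1 => by positivity)
      (fun x hx hx1 => by
        rw [hlz x]
        calc Q x * |w x| ≤ (C * (‖x‖ ^ 7)⁻¹) * W := by
              have := h.Qb x hx1.le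
              have := hW x
              have := (h.Qpos x).le
              gcongr
          _ = _ := by ring)
    refine ⟨D * k, by positivity, fun x hx hx1 => (hD1 x hx hx1).trans ?_⟩
    rw [mul_assoc]
    apply mul_le_mul_of_nonneg_left _ hD
    have : 0 ≤ inner ℝ e x * (inner ℝ e x * (‖x‖ ^ 5)⁻¹) := by positivity
    linarith
  -- from z to w
  have ztow : ∀ k : ℕ, 1 ≤ k → k + 1 ≤ n → (∃ D : ℝ, 0 ≤ D ∧ ∀ x, 0 ≤ inner ℝ e x → 1 ≤ ‖x‖ →
      |z x| ≤ D * (inner ℝ e x * (‖x‖ ^ (k + 3))⁻¹)) → ∃ D : ℝ, 0 ≤ D ∧ ∀ x, 0 ≤ inner ℝ e x →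
      1 ≤ ‖x‖ → |w x| ≤ D * (inner ℝ e x * (‖x‖ ^ k)⁻¹) := by
    rintro k hk hkn ⟨D, hD, hz⟩
    refine HS.step hn (C := C * D) (by positivity) hk hkn hl.dw hl.w0 h.he hl.tw ?_
    intro x hx hx1
    rw [hlw]
    have hx0 : ‖x‖ ≠ 0 := by linarith
    calc P x * |z x| ≤ (C * ‖x‖) * (D * (inner ℝ e x * (‖x‖ ^ (k + 3))⁻¹)) := by
          have := h.Pb x hx1.le
          have := hz x hx.le hx1.le
          have := (h.Ppos x).le
          gcongr
      _ = C * D * (inner ℝ e x * (‖x‖ ^ (k + 2))⁻¹) := by field_simp; ring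
  have wtoz : ∀ k : ℕ, 1 ≤ k → k + 5 ≤ n → (∃ D : ℝ, 0 ≤ D ∧ ∀ x, 0 ≤ inner ℝ e x → 1 ≤ ‖x‖ →
      |w x| ≤ D * (inner ℝ e x * (‖x‖ ^ k)⁻¹)) → ∃ D : ℝ, 0 ≤ D ∧ ∀ x, 0 ≤ inner ℝ e x →
      1 ≤ ‖x‖ → |z x| ≤ D * (inner ℝ e x * (‖x‖ ^ (k + 1 + 3))⁻¹) := by
    rintro k hk hkn ⟨D, hD, hw⟩
    refine HS.step hn (C := C * D) (by positivity) (by omega) (by omega) hl.dz hl.z0 h.he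
      hl.tz ?_
    intro x hx hx1
    rw [hlz]
    have hx0 : 0 < ‖x‖ := by linarith
    calc Q x * |w x| ≤ (C * (‖x‖ ^ 7)⁻¹) * (D * (inner ℝ e x * (‖x‖ ^ k)⁻¹)) := by
          have := h.Qb x hx1.le
          have := hw x hx.le hx1.le
          have := (h.Qpos x).le
          gcongr
      _ = C * D * (inner ℝ e x * (‖x‖ ^ (k + 7))⁻¹) := by field_simp; ring
      _ ≤ C * D * (inner ℝ e x * (‖x‖ ^ (k + 1 + 3 + 2))⁻¹) := by
          gcongr C * D * (inner ℝ e x * ?_)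
          apply inv_anti₀ (by positivity)
          exact pow_le_pow_right₀ hx1.le (by omega)
  have ind : ∀ k : ℕ, 1 ≤ k → k + 4 ≤ n → ∃ D : ℝ, 0 ≤ D ∧ ∀ x, 0 ≤ inner ℝ e x → 1 ≤ ‖x‖ →
      |w x| ≤ D * (inner ℝ e x * (‖x‖ ^ k)⁻¹) := by
    intro k hk
    induction k, hk using Nat.le_induction with
    | base => intro _; exact ztow 1 le_rfl (by omega) ⟨D0, hD0, hz0⟩
    | succ k hk ih =>
      intro hkn
      exact ztow (k + 1) (by omega) (by omega) (wtoz k hk (by omega) (ih (by omega)))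
  obtain ⟨D1, hD1, hw1⟩ := ind (n - 4) (by omega) (by omega)
  -- final barrier
  have hb : ∀ x : Eu n, 0 ≤ inner ℝ e x → 1 ≤ ‖x‖ → 1 / 2 * (inner ℝ e x * (‖x‖ ^ n)⁻¹) ≤
        inner ℝ e x * (‖x‖ ^ n)⁻¹ - 1 / 2 * (inner ℝ e x * (‖x‖ ^ (n + 1))⁻¹) := by
    intro x hx hx1
    have : inner ℝ e x * (‖x‖ ^ (n + 1))⁻¹ ≤ inner ℝ e x * (‖x‖ ^ n)⁻¹ := by
      apply mul_le_mul_of_nonneg_left _ hx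
      apply inv_anti₀ (by positivity)
      exact pow_le_pow_right₀ hx1 (by omega)
    linarith
  obtain ⟨D, hD, hDz⟩ := barrier hn (e := e) (h := z)
    (Z := fun x => inner ℝ e x * (‖x‖ ^ n)⁻¹ - 1 / 2 * (inner ℝ e x * (‖x‖ ^ (n + 1))⁻¹))
    (f := fun x => inner ℝ e x * (‖x‖ ^ (n + 3))⁻¹) (L := L) (D := C * D1) (c := 1 / 2)
    hl.dz hl.z0 hL hL0 hl.tz
    (fun x hx => (cd_xipow n e hx).sub (contDiffAt_const.mul (cd_xipow (n + 1) e hx)))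
    (fun x hx hx1 => le_trans (by positivity) (hb x hx hx1)) (by norm_num)
    (fun x hx hx1 => by
        have := hb x hx hx1.ge
        simpa [hx1] using this) (by positivity)
    (fun x hx hx1 => by
      have hx0 := ne_zero_of_xe hx
      rw [lap_sub (cd_xipow n e hx0) (contDiffAt_const.mul (cd_xipow (n + 1) e hx0)),
        lap_cmul _ (cd_xipow (n + 1) e hx0), lap_xipow n e hx0, lap_xipow (n + 1) e hx0]
      push_cast
      have : 0 ≤ inner ℝ e x * (‖x‖ ^ (n + 3))⁻¹ := by positivity
      rw [show n + 1 + 2 = n + 3 by omega]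
      nlinarith)
    (fun x hx hx1 => by positivity)
    (fun x hx hx1 => by
      rw [hlz]
      calc Q x * |w x| ≤ (C * (‖x‖ ^ 7)⁻¹) * (D1 * (inner ℝ e x * (‖x‖ ^ (n - 4))⁻¹)) := by
            have := h.Qb x hx1.le
            have := hw1 x hx.le hx1.le
            have := (h.Qpos x).le
            gcongr
        _ = C * D1 * (inner ℝ e x * (‖x‖ ^ (n + 3))⁻¹) := by
            rw [show n + 3 = 7 + (n - 4) by omega, pow_add, mul_inv]; ring)
  refine ⟨D, hD, fun x hx hx1 => (hDz x hx hx1).trans ?_⟩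
  apply mul_le_mul_of_nonneg_left _ hD
  have : 0 ≤ inner ℝ e x * (‖x‖ ^ (n + 1))⁻¹ := by positivity
  linarith

lemma HS.K1 (h : HS n e P Q A B C) (hn : 5 ≤ n) (hl : LS n e P Q w z) :
    ∃ m : ℝ, 0 ≤ m ∧ ∀ x, 0 < inner ℝ e x → |z x| ≤ m * B x := by
  obtain ⟨D, hD, hz⟩ := h.decay_w hn hl
  obtain ⟨L, hL0, hL⟩ := lip_half h.he hl.dz hl.z0
  have hC := h.hC
  have hBpos : ∀ x, 0 < inner ℝ e x → 0 < B x := fun x hx => by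
    have h1 := h.Bl x hx
    have h2 : 0 < (1 + ‖x‖) ^ n := by positivity
    by_contra hneg
    push Not at hneg
    have : C * (B x * (1 + ‖x‖) ^ n) ≤ 0 :=
      mul_nonpos_of_nonneg_of_nonpos hC.le (mul_nonpos_of_nonpos_of_nonneg hneg h2.le)
    linarith
  refine ⟨(L + D) * (C * 2 ^ n), by positivity, fun x hx => ?_⟩
  have hB := hBpos x hx
  have hBl := h.Bl x hx
  rcases le_total ‖x‖ 1 with hx1 | hx1
  · have h1 : (1 + ‖x‖) ^ n ≤ 2 ^ n := by gcongr; linarith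
    calc |z x| ≤ L * inner ℝ e x := hL x hx.le hx1
      _ ≤ L * (C * (B x * 2 ^ n)) := by
          gcongr
          exact hBl.trans (by gcongr)
      _ ≤ (L + D) * (C * (B x * 2 ^ n)) := by gcongr; linarith
      _ = _ := by ring
  · have h1 : (1 + ‖x‖) ^ n ≤ (2 * ‖x‖) ^ n := by gcongr; linarith
    rw [mul_pow] at h1
    calc |z x| ≤ D * (inner ℝ e x * (‖x‖ ^ n)⁻¹) := hz x hx.le hx1
      _ ≤ D * (C * (B x * (2 ^ n * ‖x‖ ^ n)) * (‖x‖ ^ n)⁻¹) := by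
          gcongr
          exact hBl.trans (by gcongr)
      _ = D * (C * (B x * 2 ^ n)) := by
          have : ‖x‖ ≠ 0 := by linarith
          field_simp
      _ ≤ (L + D) * (C * (B x * 2 ^ n)) := by gcongr; linarith
      _ = _ := by ring

end
end LE

namespace LE

section
variable {n : ℕ} {e : Eu n} {P Q A B w z : Eu n → ℝ} {C : ℝ}

lemma far_of_tendsto {f : Eu n → ℝ} (ht : Tendsto f (cocompact _) (𝓝 0)) {ε : ℝ} (hε : 0 < ε) :
    ∃ R : ℝ, ∀ x, R ≤ ‖x‖ → |f x| < ε := by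
  have h1 := ht.abs.eventually_lt_const (show |(0:ℝ)| < ε by simpa using hε)
  rw [← Metric.cobounded_eq_cocompact, ← comap_norm_atTop, eventually_comap] at h1
  obtain ⟨R, hR⟩ := eventually_atTop.1 h1
  exact ⟨R, fun x hx => hR ‖x‖ hx x rfl⟩

lemma HS.Bpos (h : HS n e P Q A B C) {x : Eu n} (hx : 0 < inner ℝ e x) : 0 < B x := by
  have h1 := h.Bl x hx
  have h2 : 0 < (1 + ‖x‖) ^ n := by positivity
  by_contra hneg
  push Not at hneg
  have : C * (B x * (1 + ‖x‖) ^ n) ≤ 0 :=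
    mul_nonpos_of_nonneg_of_nonpos h.hC.le (mul_nonpos_of_nonpos_of_nonneg hneg h2.le)
  linarith

lemma HS.w_le (h : HS n e P Q A B C) (hn : 5 ≤ n) (hl : LS n e P Q w z) {m : ℝ}
    (hz : ∀ x, 0 < inner ℝ e x → z x ≤ m * B x) : ∀ x, 0 < inner ℝ e x → w x ≤ m * A x := by
  have hci : Continuous (fun x : Eu n => inner ℝ e x) := by fun_prop
  intro x hx
  have := maxprin (n := n) (by omega) (Ω := {x | 0 < inner ℝ e x})
      (C := {x | 0 ≤ inner ℝ e x}) (h := fun x => w x - m * A x)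
      (isOpen_lt continuous_const hci) (isClosed_le continuous_const hci)
      (fun x (hx : 0 < inner ℝ e x) => hx.le)
      (hl.dw.continuous.sub (continuous_const.mul h.cA)).continuousOn
      (fun x hx => hl.dw.contDiffAt.sub (contDiffAt_const.mul (h.dA x (ne_zero_of_xe hx))))
      (fun x hx => by
        have hx0 := ne_zero_of_xe hx
        rw [lap_sub hl.dw.contDiffAt (contDiffAt_const.mul (h.dA x hx0)), lap_cmul _ (h.dA x hx0)]
        have e1 := hl.lw x
        have e2 := h.lA x hx0
        have e3 := mul_nonneg (h.Ppos x).le (sub_nonneg.2 (hz x hx))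
        have e4 : lap A x = -(P x * B x) := by linarith
        rw [e4]
        linarith)
      (fun x hx hnot => by
        have : inner ℝ e x = 0 := le_antisymm (not_lt.1 hnot) hx
        rw [hl.w0 x this, h.A0 x this]; simp)
      (fun ε hε => by
        have t : Tendsto (fun x => w x - m * A x) (cocompact _) (𝓝 0) := by
          simpa using hl.tw.sub (h.tA.const_mul m)
        obtain ⟨R, hR⟩ := far_of_tendsto t hε
        exact ⟨R, fun x _ hxR => (le_abs_self _).trans (hR x hxR).le⟩) x hx
  linarith

/-- Green function lower bound -/
lemma green_lower {s d t : ℝ} (hn : 5 ≤ n) (hs : 0 < s) (hd : 0 < d) (ht : 0 ≤ t)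
    (hsd : d ^ 2 = s ^ 2 + t) : t * (d ^ n)⁻¹ ≤ (s ^ (n - 2))⁻¹ - (d ^ (n - 2))⁻¹ := by
  obtain ⟨m, rfl⟩ : ∃ m, n = m + 4 := ⟨n - 4, by omega⟩
  have hle : s ≤ d := by nlinarith
  rw [show m + 4 - 2 = m + 2 by omega]
  have hsm : s ^ m ≤ d ^ m := by gcongr
  have e1 : (s ^ (m + 2))⁻¹ - (d ^ (m + 2))⁻¹ = (d ^ (m + 2) - s ^ (m + 2)) * ((s ^ (m + 2))⁻¹ * (d ^ (m + 2))⁻¹) := by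
    field_simp
  have e2 : d ^ m * t ≤ d ^ (m + 2) - s ^ (m + 2) := by
    have : s ^ m * s ^ 2 ≤ d ^ m * s ^ 2 := by gcongr
    rw [pow_add, pow_add, hsd]
    linarith
  have e3 : (d ^ (m + 2))⁻¹ ≤ (s ^ (m + 2))⁻¹ := by
    apply inv_anti₀ (by positivity); gcongr
  rw [e1]
  calc t * (d ^ (m + 4))⁻¹ = d ^ m * t * ((d ^ (m + 2))⁻¹ * (d ^ (m + 2))⁻¹) := by
        field_simp; ring
    _ ≤ (d ^ (m + 2) - s ^ (m + 2)) * ((s ^ (m + 2))⁻¹ * (d ^ (m + 2))⁻¹) := by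
        have : 0 ≤ d ^ (m + 2) - s ^ (m + 2) := le_trans (by positivity) e2
        gcongr

/-- Quantitative Hopf-type lemma -/
lemma HS.hopf (h : HS n e P Q A B C) (hn : 5 ≤ n) {f : Eu n → ℝ} (cf : Continuous f)
    (df : ∀ x, x ≠ 0 → ContDiffAt ℝ 2 f x)
    (lf : ∀ x, 0 < inner ℝ e x → 0 ≤ -lap f x) (f0 : ∀ x, inner ℝ e x = 0 → f x = 0)
    (fnn : ∀ x, 0 < inner ℝ e x → 0 ≤ f x) {y : Eu n} (hy : 0 < inner ℝ e y) (hfy : 0 < f y) :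
    ∃ c : ℝ, 0 < c ∧ ∀ x, 0 < inner ℝ e x → c * B x ≤ f x := by
  have hci : Continuous (fun x : Eu n => inner ℝ e x) := by fun_prop
  have hn5 : (5:ℝ) ≤ n := by exact_mod_cast hn
  have he := h.he
  have hC := h.hC
  set ye := inner ℝ e y with hye
  have hev : ∀ᶠ x in 𝓝 y, f y / 2 < f x ∧ 0 < inner ℝ e x :=
    (cf.continuousAt.eventually_const_lt (by linarith)).and
      (hci.continuousAt.eventually_const_lt hy)
  obtain ⟨ρ', hρ', hball⟩ := Metric.eventually_nhds_iff.1 hev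
  set ρ := ρ' / 2 with hρd
  have hρ : 0 < ρ := by positivity
  set δ := f y / 2 with hδ
  have hδ0 : 0 < δ := by positivity
  have hb1 : ∀ x, ‖x - y‖ ≤ ρ → δ < f x ∧ 0 < inner ℝ e x := fun x hx =>
    hball (by rw [dist_eq_norm]; linarith)
  set y' := y - (2 * ye) • e with hy'
  have hd : ∀ x : Eu n, ‖x - y'‖ ^ 2 = ‖x - y‖ ^ 2 + 4 * ye * inner ℝ e x := by
    intro x
    have : x - y' = (x - y) + (2 * ye) • e := by rw [hy']; abel
    rw [this, norm_add_sq_real, inner_smul_right, norm_smul, he, real_inner_comm, inner_sub_right,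
      ← hye, mul_one, Real.norm_eq_abs, sq_abs]
    ring
  have hdpos : ∀ x : Eu n, 0 ≤ inner ℝ e x → x - y ≠ 0 → x - y' ≠ 0 := by
    intro x hx hxy h0
    have := hd x
    rw [h0, norm_zero] at this
    have h1 : 0 < ‖x - y‖ := norm_pos_iff.2 hxy
    have : 0 ≤ 4 * ye * inner ℝ e x := by positivity
    nlinarith
  set m := n - 2 with hm
  set c0 := δ * ρ ^ m with hc0
  have hc00 : 0 < c0 := by positivity
  have hcG : ∀ x : Eu n, 0 ≤ inner ℝ e x → x - y ≠ 0 →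
      ContDiffAt ℝ 2 (fun x : Eu n => (‖x - y‖ ^ m)⁻¹ - (‖x - y'‖ ^ m)⁻¹) x := fun x hx hxy =>
    (cd_ipow m hxy).sub (cd_ipow m (hdpos x hx hxy))
  have hmR : (m:ℝ) + 2 - n = 0 := by
    rw [hm, Nat.cast_sub (by omega)]; push_cast; ring
  have hlG : ∀ x : Eu n, 0 ≤ inner ℝ e x → x - y ≠ 0 →
      lap (fun x : Eu n => (‖x - y‖ ^ m)⁻¹ - (‖x - y'‖ ^ m)⁻¹) x = 0 := fun x hx hxy => by
    rw [lap_sub (cd_ipow m hxy) (cd_ipow m (hdpos x hx hxy)), lap_ipow m hxy,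
      lap_ipow m (hdpos x hx hxy), hmR]
    ring
  have hne : ∀ x : Eu n, ρ ≤ ‖x - y‖ → x - y ≠ 0 := fun x hx h0 => by
    rw [h0, norm_zero] at hx; linarith
  have key : ∀ x : Eu n, 0 < inner ℝ e x → ρ < ‖x - y‖ →
      c0 * ((‖x - y‖ ^ m)⁻¹ - (‖x - y'‖ ^ m)⁻¹) ≤ f x := by
    intro x hx hxy
    have := maxprin (n := n) (by omega) (Ω := {x | 0 < inner ℝ e x ∧ ρ < ‖x - y‖})
      (C := {x | 0 ≤ inner ℝ e x ∧ ρ ≤ ‖x - y‖})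
      (h := fun x => c0 * ((‖x - y‖ ^ m)⁻¹ - (‖x - y'‖ ^ m)⁻¹) - f x)
      ((isOpen_lt continuous_const hci).inter
        (isOpen_lt continuous_const (continuous_id.sub continuous_const).norm))
      ((isClosed_le continuous_const hci).inter
        (isClosed_le continuous_const (continuous_id.sub continuous_const).norm))
      (fun x hx => ⟨hx.1.le, hx.2.le⟩)
      (fun x hx => (((hcG x hx.1 (hne x hx.2)).continuousAt.const_mul c0).sub
        cf.continuousAt).continuousWithinAt)
      (fun x hx => (contDiffAt_const.mul (hcG x hx.1.le (hne x hx.2.le))).sub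
        (df x (ne_zero_of_xe hx.1)))
      (fun x hx => by
        have g := hcG x hx.1.le (hne x hx.2.le)
        rw [lap_sub (contDiffAt_const.mul g) (df x (ne_zero_of_xe hx.1)), lap_cmul _ g,
          hlG x hx.1.le (hne x hx.2.le)]
        linarith [lf x hx.1])
      (fun x hx hnot => by
        rcases hx.1.eq_or_lt with h0 | h0
        · have h1 : ‖x - y'‖ = ‖x - y‖ := by
            have := hd x
            rw [← h0, mul_zero, add_zero] at this
            exact (pow_left_inj₀ (norm_nonneg _) (norm_nonneg _) (by norm_num)).1 this
          rw [h1, f0 x h0.symm]; simp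
        · have h1 : ‖x - y‖ = ρ := by
            refine le_antisymm ?_ hx.2
            by_contra hlt
            exact hnot ⟨h0, not_le.1 hlt⟩
          have h2 := (hb1 x h1.le).1
          have h3 : 0 ≤ c0 * (‖x - y'‖ ^ m)⁻¹ := by positivity
          have h4 : c0 * (‖x - y‖ ^ m)⁻¹ = δ := by rw [h1, hc0]; field_simp
          rw [mul_sub]; linarith)
      (fun ε hε => by
        refine ⟨‖y‖ + 1 + c0 / ε, fun x hx hxR => ?_⟩
        have h1 : 1 + c0 / ε ≤ ‖x - y‖ := by
          have := norm_sub_norm_le x y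
          linarith
        have hce : 0 < c0 / ε := by positivity
        have h2 : ‖x - y‖ ≤ ‖x - y‖ ^ m := le_self_pow₀ (by linarith) (by omega)
        have h3 : c0 * (‖x - y‖ ^ m)⁻¹ ≤ ε := by
          rw [← div_eq_mul_inv, div_le_iff₀ (by linarith), ← div_le_iff₀' hε]
          linarith
        have h4 : 0 ≤ c0 * (‖x - y'‖ ^ m)⁻¹ := by positivity
        have h5 := fnn x hx.1
        rw [mul_sub]; linarith) x ⟨hx, hxy⟩
    linarith
  -- conclusion
  set E := 1 + ‖y'‖ with hE
  have hE1 : 1 ≤ E := by rw [hE]; linarith [norm_nonneg y']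
  set c1 := c0 * (4 * ye) / (C * E ^ n) with hc1
  set c2 := δ / (C * (‖y‖ + ρ)) with hc2
  have hyρ : 0 < ‖y‖ + ρ := by positivity
  have hc10 : 0 < c1 := by positivity
  have hc20 : 0 < c2 := by positivity
  refine ⟨min c1 c2, lt_min hc10 hc20, fun x hx => ?_⟩
  have hB := h.Bpos hx
  have hBu := h.Bu x hx
  rcases le_or_gt ‖x - y‖ ρ with hle | hgt
  · have h1 : inner ℝ e x ≤ ‖y‖ + ρ := by
      have := xe_le he x
      have h2 : ‖x‖ ≤ ‖x - y‖ + ‖y‖ := by simpa using norm_add_le (x - y) y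
      linarith
    have h2 : B x ≤ C * (‖y‖ + ρ) := by
      have : B x * 1 ≤ B x * (1 + ‖x‖) ^ n := by
        gcongr; exact one_le_pow₀ (by linarith [norm_nonneg x])
      have : C * inner ℝ e x ≤ C * (‖y‖ + ρ) := by gcongr
      linarith
    calc min c1 c2 * B x ≤ c2 * (C * (‖y‖ + ρ)) := by
          gcongr; exact min_le_right _ _
      _ = δ := by rw [hc2]; field_simp
      _ ≤ f x := (hb1 x hle).1.le
  · have hxy : x - y ≠ 0 := hne x hgt.le
    have hdp := norm_pos_iff.2 (hdpos x hx.le hxy)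
    have g := green_lower hn (norm_pos_iff.2 hxy) hdp (t := 4 * ye * inner ℝ e x) (by positivity) (hd x)
    have hdl : ‖x - y'‖ ≤ E * (1 + ‖x‖) := by
      have h1 := norm_sub_le x y'
      have h2 := mul_nonneg (norm_nonneg x) (norm_nonneg y')
      rw [hE]; nlinarith
    have g2 : (E * (1 + ‖x‖)) ^ n ≥ ‖x - y'‖ ^ n := by gcongr
    have hx1 : 0 < 1 + ‖x‖ := by positivity
    have hE0 : 0 < E := by linarith
    have g3 : ((E * (1 + ‖x‖)) ^ n)⁻¹ ≤ (‖x - y'‖ ^ n)⁻¹ := inv_anti₀ (by positivity) g2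
    have g4 : B x ≤ C * inner ℝ e x * ((1 + ‖x‖) ^ n)⁻¹ := by
      rw [← div_eq_mul_inv, le_div_iff₀ (by positivity)]; exact hBu
    calc min c1 c2 * B x ≤ c1 * (C * inner ℝ e x * ((1 + ‖x‖) ^ n)⁻¹) := by
          gcongr; exact min_le_left _ _
      _ = c0 * (4 * ye * inner ℝ e x * ((E * (1 + ‖x‖)) ^ n)⁻¹) := by
          rw [hc1, mul_pow]; field_simp
      _ ≤ c0 * (4 * ye * inner ℝ e x * (‖x - y'‖ ^ n)⁻¹) := by gcongr
      _ ≤ c0 * ((‖x - y‖ ^ m)⁻¹ - (‖x - y'‖ ^ m)⁻¹) := by gcongr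
      _ ≤ f x := key x hx hgt

theorem HS.main (h : HS n e P Q A B C) (hn : 5 ≤ n) (hl : LS n e P Q w z) :
    ∃ M : ℝ, ∀ x, 0 < inner ℝ e x → w x = M * A x ∧ z x = M * B x := by
  have hci : Continuous (fun x : Eu n => inner ℝ e x) := by fun_prop
  obtain ⟨m0, hm0, hz0⟩ := h.K1 hn hl
  set S : Set ℝ := {m | ∀ x, 0 < inner ℝ e x → z x ≤ m * B x} with hS
  have hSne : S.Nonempty := ⟨m0, fun x hx => (le_abs_self _).trans (hz0 x hx)⟩
  have hee : 0 < inner ℝ e e := by rw [real_inner_self_eq_norm_sq, h.he]; norm_num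
  have hSb : BddBelow S := by
    refine ⟨-m0, fun m hm => ?_⟩
    have h1 := hm e hee
    have h2 := (neg_abs_le (z e)).trans h1
    have h3 := hz0 e hee
    have hB := h.Bpos hee
    have : -m0 * B e ≤ m * B e := by linarith
    exact le_of_mul_le_mul_right this hB
  set M := sInf S with hM
  have hMS : M ∈ S := by
    intro x hx
    have hB := h.Bpos hx
    have : z x / B x ≤ M := le_csInf hSne fun m hm => by
      rw [div_le_iff₀ hB]; exact hm x hx
    rwa [div_le_iff₀ hB] at this
  have hwM := h.w_le hn hl hMS
  have hzM : ∀ x, 0 < inner ℝ e x → z x = M * B x := by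
    by_contra hcon
    push Not at hcon
    obtain ⟨y, hy, hyne⟩ := hcon
    have hpos : 0 < M * B y - z y := sub_pos.2 (lt_of_le_of_ne (hMS y hy) hyne)
    obtain ⟨c, hc, hcB⟩ := h.hopf hn (f := fun x => M * B x - z x)
      ((continuous_const.mul h.cB).sub hl.dz.continuous)
      (fun x hx => (contDiffAt_const.mul (h.dB x hx)).sub hl.dz.contDiffAt)
      (fun x hx => by
        have hx0 := ne_zero_of_xe hx
        rw [lap_sub (contDiffAt_const.mul (h.dB x hx0)) hl.dz.contDiffAt, lap_cmul _ (h.dB x hx0)]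
        have e1 := hl.lz x
        have e2 := h.lB x hx0
        have e3 := mul_nonneg (h.Qpos x).le (sub_nonneg.2 (hwM x hx))
        have e4 : lap B x = -(Q x * A x) := by linarith
        rw [e4]; linarith)
      (fun x hx => by rw [h.B0 x hx, hl.z0 x hx]; simp)
      (fun x hx => sub_nonneg.2 (hMS x hx)) hy hpos
    have : M - c ∈ S := fun x hx => by
      have := hcB x hx
      linarith
    have := csInf_le hSb this
    linarith
  refine ⟨M, fun x hx => ⟨?_, hzM x hx⟩⟩
  have hx0 := ne_zero_of_xe hx
  have e1 : lap z x = lap (fun x => M * B x) x := by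
    apply lap_congr
    filter_upwards [(isOpen_lt continuous_const hci).mem_nhds hx] with y hy
    exact hzM y hy
  rw [lap_cmul _ (h.dB x hx0)] at e1
  have e2 := hl.lz x
  have e3 := h.lB x hx0
  have e4 : Q x * w x = Q x * (M * A x) := by
    have : lap B x = -(Q x * A x) := by linarith
    rw [this] at e1; linarith
  exact mul_left_cancel₀ (h.Qpos x).ne' e4

end
end LE

namespace LE

section
variable {n : ℕ}

lemma cd_succ {a a' : ℝ → ℝ} {k : ℕ} (h : ∀ r, 0 < r → HasDerivAt a (a' r) r)
    (h' : ContDiffOn ℝ k a' (Set.Ioi 0)) : ContDiffOn ℝ (k + 1 : ℕ) a (Set.Ioi 0) := by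
  have := (contDiffOn_succ_iff_deriv_of_isOpen (𝕜 := ℝ) (n := (k : WithTop ℕ∞)) (f := a)
    (isOpen_Ioi (a := (0:ℝ)))).2
    ⟨fun r hr => (h r hr).differentiableAt.differentiableWithinAt, by simp,
      h'.congr fun r hr => (h r hr).deriv⟩
  exact_mod_cast this

lemma Flux.cd_a {f a g : ℝ → ℝ} (h : Flux n f a g) (hg : ContDiffOn ℝ 1 g (Set.Ioi 0)) :
    ContDiffOn ℝ 2 a (Set.Ioi 0) := by
  have h1 : ContDiffOn ℝ (1:ℕ) (fun r => r ^ (n - 1) * g r) (Set.Ioi 0) := by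
    have := (contDiff_id.pow (n - 1)).contDiffOn.mul hg
    exact_mod_cast this
  exact_mod_cast cd_succ h.da h1

lemma Flux.cd_f {f a g : ℝ → ℝ} (h : Flux n f a g) (hg : ContinuousOn g (Set.Ioi 0)) :
    ContDiffOn ℝ 2 f (Set.Ioi 0) := by
  have h1 : ContDiffOn ℝ (0:ℕ) (fun r => r ^ (n - 1) * g r) (Set.Ioi 0) := by
    have : ContinuousOn (fun r => r ^ (n - 1) * g r) (Set.Ioi 0) :=
      (continuous_id.pow (n - 1)).continuousOn.mul hg
    exact_mod_cast contDiffOn_zero.2 this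
  have h2 := cd_succ h.da h1
  have h3 : ContDiffOn ℝ (1:ℕ) (fun r => -(a r / r ^ (n - 1))) (Set.Ioi 0) := by
    refine ContDiffOn.neg (ContDiffOn.div (by exact_mod_cast h2)
      (contDiff_id.pow (n - 1)).contDiffOn fun r hr => ?_)
    have : (0:ℝ) < r := hr
    show r ^ (n - 1) ≠ 0
    positivity
  exact_mod_cast cd_succ h.df h3

/-- equation satisfied by `⟨e,x⟩ a(|x|)/|x|^n` -/
lemma flux_grad (hn : 1 ≤ n) (e : Eu n) {f a g : ℝ → ℝ} (h : Flux n f a g)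
    (hg : ContDiffOn ℝ 1 g (Set.Ioi 0)) {x : Eu n} (hx : x ≠ 0) {g1 : ℝ}
    (hg1 : HasDerivAt g g1 ‖x‖) :
    ContDiffAt ℝ 2 (fun y => inner ℝ e y * (a ‖y‖ / ‖y‖ ^ n)) x ∧
    lap (fun y => inner ℝ e y * (a ‖y‖ / ‖y‖ ^ n)) x = inner ℝ e x * (g1 / ‖x‖) := by
  have hr : 0 < ‖x‖ := norm_pos_iff.2 hx
  set α : ℝ → ℝ := fun r => a r / r ^ n with hα
  have hcα : ContDiffAt ℝ 2 α ‖x‖ := by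
    have h1 : ContDiffAt ℝ 2 a ‖x‖ := (h.cd_a hg).contDiffAt (Ioi_mem_nhds hr)
    exact h1.div (contDiff_id.pow n).contDiffAt (by show ‖x‖ ^ n ≠ 0; positivity)
  have hd : ∀ r, 0 < r → HasDerivAt α (g r / r - n * (a r / r ^ (n + 1))) r := by
    intro r hr
    refine ((h.da r hr).div (hasDerivAt_pow n r) (by positivity)).congr_deriv ?_
    obtain ⟨m, rfl⟩ := Nat.exists_eq_add_of_le' hn
    simp only [Nat.add_sub_cancel]
    field_simp
    ring
  have hd2 : HasDerivAt (fun r => g r / r - n * (a r / r ^ (n + 1)))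
      (g1 / ‖x‖ - g ‖x‖ / ‖x‖ ^ 2 - n * (g ‖x‖ / ‖x‖ ^ 2 - (n + 1) * (a ‖x‖ / ‖x‖ ^ (n + 2)))) ‖x‖ := by
    have h1 := (hg1.div (hasDerivAt_id ‖x‖) hr.ne').sub
      (((h.da _ hr).div (hasDerivAt_pow (n + 1) ‖x‖) (by positivity)).const_mul (n:ℝ))
    refine h1.congr_deriv ?_
    obtain ⟨m, rfl⟩ := Nat.exists_eq_add_of_le' hn
    simp only [Nat.add_sub_cancel, id]
    push_cast
    field_simp
    ring
  have hcx : ContDiffAt ℝ 2 (fun y : Eu n => α ‖y‖) x := by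
    simpa using contDiffAt_radial (y := 0) (x := x) (g := α) (by simpa using hx) (by simpa using hcα)
  have hl := lap_radial (y := 0) (x := x) (g := α) (by simpa using hx) (by simpa using hcα)
    (g' := fun r => g r / r - n * (a r / r ^ (n + 1)))
    (by
      simp only [sub_zero]
      filter_upwards [Ioi_mem_nhds hr] with r hr' using hd r hr') (by simpa using hd2)
  simp only [sub_zero] at hl
  refine ⟨(contDiff_const.inner ℝ contDiff_id).contDiffAt.mul hcx, ?_⟩
  have := lap_linear_mul e hcx
  rw [this, hl, fderiv_radial e hx hcα (hd _ hr), real_inner_comm]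
  field_simp
  ring

end
end LE

namespace LE

section
variable {n : ℕ}

/-- A radial `C²` function together with its profile. -/
structure Rad (n : ℕ) (F : Eu n → ℝ) (f a g : ℝ → ℝ) : Prop where
  cF : ContDiff ℝ 2 F
  eF : ∀ x, F x = f ‖x‖
  fl : Flux n f a g
  cg : ContinuousOn g (Set.Ioi 0)
  F0 : fderiv ℝ F 0 = 0

lemma Rad.grad (hn : 1 ≤ n) {F : Eu n → ℝ} {f a g : ℝ → ℝ} (h : Rad n F f a g) {x : Eu n} (hx : x ≠ 0)
    (e : Eu n) : -fderiv ℝ F x e = inner ℝ e x * (a ‖x‖ / ‖x‖ ^ n) := by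
  have hr : 0 < ‖x‖ := norm_pos_iff.2 hx
  have hF : F = fun x => f ‖x‖ := funext h.eF
  have h1 := fderiv_radial e hx ((h.fl.cd_f h.cg).contDiffAt (Ioi_mem_nhds hr)) (h.fl.df _ hr)
  rw [hF, h1, real_inner_comm]
  obtain ⟨m, rfl⟩ := Nat.exists_eq_add_of_le' hn
  simp only [Nat.add_sub_cancel]
  field_simp
  ring

lemma Rad.grad_perp (hn : 1 ≤ n) {F : Eu n → ℝ} {f a g : ℝ → ℝ} (h : Rad n F f a g) {x e : Eu n}
    (hx : inner ℝ e x = 0) : fderiv ℝ F x e = 0 := by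
  rcases eq_or_ne x 0 with rfl | hx0
  · simp [h.F0]
  · have := h.grad hn hx0 e
    rw [hx] at this
    linarith

lemma Rad.eqn (hn : 1 ≤ n) {F : Eu n → ℝ} {f a g : ℝ → ℝ} (h : Rad n F f a g)
    (hg : ContDiffOn ℝ 1 g (Set.Ioi 0)) (e : Eu n) {x : Eu n} (hx : x ≠ 0) {g1 : ℝ}
    (hg1 : HasDerivAt g g1 ‖x‖) :
    ContDiffAt ℝ 2 (fun y => -fderiv ℝ F y e) x ∧
      lap (fun y => -fderiv ℝ F y e) x = inner ℝ e x * (g1 / ‖x‖) := by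
  obtain ⟨h1, h2⟩ := flux_grad hn e h.fl hg hx hg1
  have hev : (fun y => -fderiv ℝ F y e) =ᶠ[𝓝 x] fun y => inner ℝ e y * (a ‖y‖ / ‖y‖ ^ n) := by
    filter_upwards [isOpen_ne.eventually_mem hx] with y hy using h.grad hn hy e
  exact ⟨h1.congr_of_eventuallyEq hev, by rw [lap_congr hev, h2]⟩

lemma Rad.cont {F : Eu n → ℝ} {f a g : ℝ → ℝ} (h : Rad n F f a g) (e : Eu n) :
    Continuous (fun y => -fderiv ℝ F y e) :=
  ((h.cF.continuous_fderiv (by norm_num)).clm_apply continuous_const).neg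

lemma tendsto_radial {f : ℝ → ℝ} (h : Tendsto f atTop (𝓝 0)) :
    Tendsto (fun x : Eu n => f ‖x‖) (cocompact _) (𝓝 0) :=
  h.comp (tendsto_norm_cocompact_atTop)

lemma Flux.a_div_le (hn : 3 ≤ n) {f a g : ℝ → ℝ} (h : Flux n f a g)
    (hg : ∀ r, 0 < r → 0 ≤ g r) (hf : Tendsto f atTop (𝓝 0)) {r : ℝ} (hr : 0 < r) :
    a r / r ^ (n - 2) ≤ (n - 2) * f r := by
  have hN : 0 < (n : ℝ) - 2 := by
    have : (3:ℝ) ≤ n := by exact_mod_cast hn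
    linarith
  have h1 := h.red_nonneg hn hg hf hr
  unfold red at h1
  have h2 : a r / ((n - 2) * r ^ (n - 2)) = (a r / r ^ (n - 2)) / (n - 2) := by
    field_simp
  rw [h2, sub_nonneg, div_le_iff₀ hN] at h1
  linarith

lemma Rad.tend (hn : 3 ≤ n) {F : Eu n → ℝ} {f a g : ℝ → ℝ} (h : Rad n F f a g)
    (hg : ∀ r, 0 < r → 0 ≤ g r) (hf : Tendsto f atTop (𝓝 0)) {e : Eu n} (he : ‖e‖ = 1) :
    Tendsto (fun y => -fderiv ℝ F y e) (cocompact _) (𝓝 0) := by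
  have hN : 0 < (n : ℝ) - 2 := by
    have : (3:ℝ) ≤ n := by exact_mod_cast hn
    linarith
  have h0 : Tendsto (fun x : Eu n => (n - 2) * f ‖x‖) (cocompact _) (𝓝 0) := by
    simpa using (tendsto_radial (n := n) hf).const_mul ((n:ℝ) - 2)
  refine squeeze_zero_norm' ?_ h0
  have hev : ∀ᶠ x : Eu n in cocompact _, 1 ≤ ‖x‖ :=
    tendsto_norm_cocompact_atTop.eventually_ge_atTop 1
  filter_upwards [hev] with x hx
  have hr : 0 < ‖x‖ := by linarith
  have hx0 : x ≠ 0 := norm_pos_iff.1 hr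
  rw [h.grad (by omega) hx0 e, norm_mul]
  have h1 := h.fl.a_div_le hn hg hf hr
  have h2 : ‖(inner ℝ e x : ℝ)‖ ≤ ‖x‖ := by
    have := norm_inner_le_norm (𝕜 := ℝ) e x
    rwa [he, one_mul] at this
  have ha := h.fl.a_nonneg (by omega) hg hr.le
  have h3 : a ‖x‖ / ‖x‖ ^ n = (a ‖x‖ / ‖x‖ ^ (n - 2)) / ‖x‖ ^ 2 := by
    rw [div_div, ← pow_add]; congr 2; omega
  have h4 : 0 ≤ a ‖x‖ / ‖x‖ ^ n := by positivity
  rw [Real.norm_of_nonneg h4]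
  have h5 : 0 ≤ a ‖x‖ / ‖x‖ ^ (n - 2) := by positivity
  calc ‖(inner ℝ e x : ℝ)‖ * (a ‖x‖ / ‖x‖ ^ n) ≤ ‖x‖ * (a ‖x‖ / ‖x‖ ^ n) := by gcongr
    _ = a ‖x‖ / ‖x‖ ^ (n - 2) / ‖x‖ := by rw [h3]; field_simp
    _ ≤ a ‖x‖ / ‖x‖ ^ (n - 2) := div_le_self h5 hx
    _ ≤ _ := h1

/-- ground states and their profiles -/
structure GS (n : ℕ) (p q : ℝ) (U V : Eu n → ℝ) (u v a b : ℝ → ℝ) : Prop where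
  rs : RadSol n p q u v a b
  ru : Rad n U u a (fun r => v r ^ p)
  rv : Rad n V v b (fun r => u r ^ q)

lemma rad_tendsto {F : Eu n → ℝ} (hF : Tendsto F (cocompact _) (𝓝 0)) {e : Eu n} (he : ‖e‖ = 1) :
    Tendsto (fun r : ℝ => F (r • e)) atTop (𝓝 0) := by
  refine hF.comp ?_
  rw [← Metric.cobounded_eq_cocompact, ← tendsto_norm_atTop_iff_cobounded]
  have : (fun r : ℝ => ‖r • e‖) = fun r => |r| := by
    funext r; rw [norm_smul, he, mul_one, Real.norm_eq_abs]
  rw [this]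
  exact tendsto_abs_atTop_atTop

lemma exists_unit (hn : 1 ≤ n) : ∃ e : Eu n, ‖e‖ = 1 :=
  ⟨EuclideanSpace.single ⟨0, hn⟩ 1, by simp⟩

lemma exists_gs (hn : 5 ≤ n) {p q : ℝ} (hp : 0 < p) (hq : 0 < q)
    (hyp : 1 / (p + 1) + 1 / (q + 1) = ((n : ℝ) - 2) / n) {U V : Eu n → ℝ}
    (h : IsGroundState n p q U V) : ∃ u v a b, GS n p q U V u v a b := by
  obtain ⟨cU, cV, pU, pV, lU, lV, mU, mV, tU, tV, U0⟩ := h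
  obtain ⟨e, he⟩ := exists_unit (n := n) (by omega)
  have radU : ∀ x y, ‖x‖ = ‖y‖ → U x = U y := fun x y h => le_antisymm (mU _ _ h.ge) (mU _ _ h.le)
  have radV : ∀ x y, ‖x‖ = ‖y‖ → V x = V y := fun x y h => le_antisymm (mV _ _ h.ge) (mV _ _ h.le)
  have fu : Flux n (fun r => U (r • e)) _ (fun r => V (r • e) ^ p) :=
    (flux_of_radial (by omega) cU radU he).congr fun r _ => lU _
  have fv : Flux n (fun r => V (r • e)) _ (fun r => U (r • e) ^ q) :=
    (flux_of_radial (by omega) cV radV he).congr fun r _ => lV _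
  refine ⟨_, _, _, _, ⟨⟨hp, hq, hyp, fu, fv, fun r _ => pU _, fun r _ => pV _, rad_tendsto tU he,
    rad_tendsto tV he, by simpa using U0⟩, ⟨cU, fun x => radU _ _ ?_, fu, ?_, ?_⟩,
    ⟨cV, fun x => radV _ _ ?_, fv, ?_, ?_⟩⟩⟩
  · simp [norm_smul, he]
  · exact (fv.cf.mono Set.Ioi_subset_Ici_self).rpow_const fun x _ => Or.inr hp.le
  · have : IsLocalMax U 0 := Eventually.of_forall fun x => mU 0 x (by simp)
    exact this.fderiv_eq_zero
  · simp [norm_smul, he]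
  · exact (fu.cf.mono Set.Ioi_subset_Ici_self).rpow_const fun x _ => Or.inr hq.le
  · have : IsLocalMax V 0 := Eventually.of_forall fun x => mV 0 x (by simp)
    exact this.fderiv_eq_zero

lemma Flux.cd_pow {f a g : ℝ → ℝ} (h : Flux n f a g) (hg : ContinuousOn g (Set.Ioi 0))
    (hf : ∀ r, 0 ≤ r → 0 < f r) (s : ℝ) : ContDiffOn ℝ 1 (fun r => f r ^ s) (Set.Ioi 0) :=
  ((h.cd_f hg).of_le (by norm_num)).rpow_const_of_ne fun r hr => (hf r (le_of_lt hr)).ne'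

lemma Flux.d_pow {f a g : ℝ → ℝ} (h : Flux n f a g)
    (hf : ∀ r, 0 ≤ r → 0 < f r) (s : ℝ) {r : ℝ} (hr : 0 < r) :
    HasDerivAt (fun r => f r ^ s) (-(s * f r ^ (s - 1) * (a r / r ^ (n - 1)))) r :=
  ((h.df r hr).rpow_const (Or.inl (hf r hr.le).ne')).congr_deriv (by ring)

lemma eqn_pair (hn : 1 ≤ n) {F G : Eu n → ℝ} {f a g b k : ℝ → ℝ} {s : ℝ}
    (hF : Rad n F f a (fun r => g r ^ s)) (hG : Rad n G g b k) (hg : ∀ r, 0 ≤ r → 0 < g r)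
    (e : Eu n) {x : Eu n} (hx : x ≠ 0) :
    ContDiffAt ℝ 2 (fun y => -fderiv ℝ F y e) x ∧
      -lap (fun y => -fderiv ℝ F y e) x = (s * G x ^ (s - 1)) * -fderiv ℝ G x e := by
  have hr : 0 < ‖x‖ := norm_pos_iff.2 hx
  obtain ⟨h1, h2⟩ := hF.eqn hn (hG.fl.cd_pow hG.cg hg s) e hx (hG.fl.d_pow hg s hr)
  refine ⟨h1, ?_⟩
  rw [h2, hG.grad hn hx e, hG.eF]
  obtain ⟨m, rfl⟩ := Nat.exists_eq_add_of_le' hn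
  simp only [Nat.add_sub_cancel]
  field_simp
  ring

lemma GS.hs (hn : 5 ≤ n) {p q : ℝ} {U V : Eu n → ℝ} {u v a b : ℝ → ℝ} (h : GS n p q U V u v a b)
    {C : ℝ} (hC : 0 < C) (hb : ∀ r, 0 ≤ r → b r ≤ C)
    (h1 : ∀ r, 1 ≤ r → p * v r ^ (p - 1) ≤ C * r)
    (h2 : ∀ r, 1 ≤ r → q * u r ^ (q - 1) ≤ C * (r ^ 7)⁻¹) {e : Eu n} (he : ‖e‖ = 1) :
    ∃ C', HS n e (fun x => p * V x ^ (p - 1)) (fun x => q * U x ^ (q - 1))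
      (fun x => -fderiv ℝ U x e) (fun x => -fderiv ℝ V x e) C' := by
  have hN : (5:ℝ) ≤ n := by exact_mod_cast hn
  have hs := h.rs
  have hp := hs.hp
  have hq := hs.hq
  have hn1 : 1 ≤ n := by omega
  have u1 := hs.upos 1 zero_le_one
  have bge : ∀ r, 0 ≤ r → r ≤ 1 → u 1 ^ q * r ^ n / n ≤ b r := fun r h0 hr =>
    hs.fv.a_ge (M := u 1 ^ q) hn1 (T := 1) (fun s hs0 hs1 => Real.rpow_le_rpow u1.le
      (hs.fu.f_anti hn1 hs.gv hs0.le hs1.le) hq.le) h0 hr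
  have ble : ∀ r, 0 ≤ r → r ≤ 1 → b r ≤ 1 * r ^ n / n := fun r h0 hr =>
    hs.fv.a_le (M := 1) hn1 (T := 1) (fun s hs0 hs1 =>
      Real.rpow_le_one (hs.upos s hs0.le).le (hs.u_le_one hn hs0.le) hq.le) h0 hr
  have uq : 0 < u 1 ^ q := by positivity
  set c := u 1 ^ q / n with hc
  have hc0 : 0 < c := by positivity
  have b1 : c ≤ b 1 := by simpa [hc] using bge 1 zero_le_one le_rfl
  have bn : ∀ r, 0 ≤ r → 0 ≤ b r := fun r hr => hs.fv.a_nonneg hn1 hs.gu hr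
  set K := max (max C (1 / c)) (2 ^ n * max 1 C) with hK
  have hK1 : C ≤ K := (le_max_left _ _).trans (le_max_left _ _)
  have hK2 : 1 / c ≤ K := (le_max_right _ _).trans (le_max_left _ _)
  have hK3 : 2 ^ n * max 1 C ≤ K := le_max_right _ _
  have hK0 : 0 < K := hC.trans_le hK1
  -- main two sided bound for b r (1+r)^n / r^n
  have lo : ∀ r, 0 < r → 1 ≤ K * (b r / r ^ n * (1 + r) ^ n) := by
    intro r hr
    have h3 : c ≤ b r / r ^ n * (1 + r) ^ n := by
      rcases le_total r 1 with h | h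
      · have h4 : c ≤ b r / r ^ n := by
          rw [le_div_iff₀ (by positivity)]
          have := bge r hr.le h
          rw [hc, div_mul_eq_mul_div]; exact this
        have h5 : (1:ℝ) ≤ (1 + r) ^ n := one_le_pow₀ (by linarith)
        exact h4.trans (le_mul_of_one_le_right (hc0.le.trans h4) h5)
      · have h4 : c ≤ b r := b1.trans (hs.fv.a_mono hs.gu zero_le_one h)
        have h5 : r ^ n ≤ (1 + r) ^ n := by gcongr; linarith
        rw [div_mul_eq_mul_div, le_div_iff₀ (by positivity)]
        exact mul_le_mul h4 h5 (by positivity) (bn r hr.le)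
    calc (1:ℝ) = 1 / c * c := by field_simp
      _ ≤ K * _ := mul_le_mul hK2 h3 hc0.le hK0.le
  have up : ∀ r, 0 < r → b r / r ^ n * (1 + r) ^ n ≤ K := by
    intro r hr
    refine le_trans ?_ hK3
    rcases le_total r 1 with h | h
    · have h4 : b r / r ^ n ≤ 1 := by
        rw [div_le_iff₀ (by positivity)]
        have := ble r hr.le h
        have h6 : (1:ℝ) * r ^ n / n ≤ 1 * r ^ n := div_le_self (by positivity) (by linarith)
        linarith
      have h5 : (1 + r) ^ n ≤ (2:ℝ) ^ n := by gcongr; linarith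
      calc _ ≤ 1 * (2:ℝ) ^ n := mul_le_mul h4 h5 (by positivity) zero_le_one
        _ = 2 ^ n * 1 := by ring
        _ ≤ _ := by gcongr; exact le_max_left _ _
    · have h5 : (1 + r) ^ n ≤ (2 * r) ^ n := by gcongr; linarith
      calc b r / r ^ n * (1 + r) ^ n ≤ b r / r ^ n * (2 * r) ^ n := by
            have := bn r hr.le
            gcongr
        _ = 2 ^ n * b r := by rw [mul_pow]; field_simp
        _ ≤ _ := by
            gcongr; exact (hb r hr.le).trans (le_max_right _ _)
  have nz : ∀ x : Eu n, 0 < inner ℝ e x → x ≠ 0 := by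
    rintro x hx rfl; simp at hx
  refine ⟨K, ?_⟩
  constructor
  · exact he
  · exact hK0
  · intro x
    have : 0 < V x := by rw [h.rv.eF]; exact hs.vpos _ (norm_nonneg _)
    positivity
  · intro x
    have : 0 < U x := by rw [h.ru.eF]; exact hs.upos _ (norm_nonneg _)
    positivity
  · intro x hx
    simp only [h.rv.eF]
    exact (h1 _ hx).trans (by gcongr)
  · intro x hx
    simp only [h.ru.eF]
    exact (h2 _ hx).trans (by gcongr)
  · exact h.ru.cont e
  · exact h.rv.cont e
  · exact fun x hx => (eqn_pair hn1 h.ru h.rv hs.vpos e hx).1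
  · exact fun x hx => (eqn_pair hn1 h.rv h.ru hs.upos e hx).1
  · exact fun x hx => (eqn_pair hn1 h.ru h.rv hs.vpos e hx).2
  · exact fun x hx => (eqn_pair hn1 h.rv h.ru hs.upos e hx).2
  · intro x hx; simp [h.ru.grad_perp hn1 hx]
  · intro x hx; simp [h.rv.grad_perp hn1 hx]
  · exact h.ru.tend (by omega) hs.gv hs.tu he
  · exact h.rv.tend (by omega) hs.gu hs.tv he
  · intro x hx
    have hx0 := nz x hx
    have hr : 0 < ‖x‖ := norm_pos_iff.2 hx0
    simp only [h.rv.grad hn1 hx0 e]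
    calc inner ℝ e x = inner ℝ e x * 1 := by ring
      _ ≤ inner ℝ e x * (K * (b ‖x‖ / ‖x‖ ^ n * (1 + ‖x‖) ^ n)) := by
        gcongr; exact lo _ hr
      _ = _ := by ring
  · intro x hx
    have hx0 := nz x hx
    have hr : 0 < ‖x‖ := norm_pos_iff.2 hx0
    simp only [h.rv.grad hn1 hx0 e]
    calc _ = inner ℝ e x * (b ‖x‖ / ‖x‖ ^ n * (1 + ‖x‖) ^ n) := by ring
      _ ≤ inner ℝ e x * K := by gcongr; exact up _ hr
      _ = _ := by ring

end
end LE

namespace LE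

section
variable {n : ℕ}

/-- reflection in the hyperplane orthogonal to `e` -/
noncomputable def refl (e : Eu n) : Eu n ≃ₗᵢ[ℝ] Eu n := (Submodule.span ℝ {e})ᗮ.reflection

lemma refl_apply {e : Eu n} (he : ‖e‖ = 1) (x : Eu n) : refl e x = x - (2 * inner ℝ e x) • e := by
  rw [refl, Submodule.reflection_orthogonal_apply, Submodule.reflection_singleton_apply, he]
  simp [two_smul, mul_smul]

lemma inner_refl {e : Eu n} (he : ‖e‖ = 1) (x : Eu n) : inner ℝ e (refl e x) = - inner ℝ e x := by
  rw [refl_apply he, inner_sub_right, inner_smul_right, real_inner_self_eq_norm_sq, he]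
  ring

lemma refl_refl {e : Eu n} (x : Eu n) : refl e (refl e x) = x :=
  Submodule.reflection_reflection _ x

lemma refl_fix {e : Eu n} (he : ‖e‖ = 1) {x : Eu n} (hx : inner ℝ e x = 0) : refl e x = x := by
  rw [refl_apply he, hx]; simp

lemma tendsto_isom {F : Eu n → ℝ} (hF : Tendsto F (cocompact _) (𝓝 0)) (σ : Eu n ≃ₗᵢ[ℝ] Eu n) :
    Tendsto (fun x => F (σ x)) (cocompact _) (𝓝 0) :=
  hF.comp σ.toHomeomorph.isClosedEmbedding.tendsto_cocompact

/-- solutions of the linearised system -/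
structure Lin (n : ℕ) (P Q w z : Eu n → ℝ) : Prop where
  dw : ContDiff ℝ 2 w
  dz : ContDiff ℝ 2 z
  lw : ∀ x, -lap w x = P x * z x
  lz : ∀ x, -lap z x = Q x * w x
  tw : Tendsto w (cocompact _) (𝓝 0)
  tz : Tendsto z (cocompact _) (𝓝 0)

variable {P Q w z : Eu n → ℝ}

lemma Lin.isom (h : Lin n P Q w z) (σ : Eu n ≃ₗᵢ[ℝ] Eu n) (hP : ∀ x, P (σ x) = P x)
    (hQ : ∀ x, Q (σ x) = Q x) : Lin n P Q (fun x => w (σ x)) (fun x => z (σ x)) where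
  dw := h.dw.comp σ.contDiff
  dz := h.dz.comp σ.contDiff
  lw := fun x => by rw [lap_comp_isometry σ h.dw.contDiffAt, h.lw, hP]
  lz := fun x => by rw [lap_comp_isometry σ h.dz.contDiffAt, h.lz, hQ]
  tw := tendsto_isom h.tw σ
  tz := tendsto_isom h.tz σ

lemma Lin.sub {w' z' : Eu n → ℝ} (h : Lin n P Q w z) (h' : Lin n P Q w' z') :
    Lin n P Q (fun x => w x - w' x) (fun x => z x - z' x) where
  dw := h.dw.sub h'.dw
  dz := h.dz.sub h'.dz
  lw := fun x => by
    rw [lap_sub h.dw.contDiffAt h'.dw.contDiffAt]; linarith [h.lw x, h'.lw x]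
  lz := fun x => by
    rw [lap_sub h.dz.contDiffAt h'.dz.contDiffAt]; linarith [h.lz x, h'.lz x]
  tw := by simpa using h.tw.sub h'.tw
  tz := by simpa using h.tz.sub h'.tz

lemma Lin.cmul (c : ℝ) (h : Lin n P Q w z) :
    Lin n P Q (fun x => c * w x) (fun x => c * z x) where
  dw := contDiff_const.mul h.dw
  dz := contDiff_const.mul h.dz
  lw := fun x => by
    rw [lap_cmul c h.dw.contDiffAt]; linear_combination c * h.lw x
  lz := fun x => by
    rw [lap_cmul c h.dz.contDiffAt]; linear_combination c * h.lz x
  tw := by simpa using h.tw.const_mul c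
  tz := by simpa using h.tz.const_mul c

lemma Rad.isom {F : Eu n → ℝ} {f a g : ℝ → ℝ} (h : Rad n F f a g) (σ : Eu n ≃ₗᵢ[ℝ] Eu n)
    (x : Eu n) : F (σ x) = F x := by
  rw [h.eF, h.eF, σ.norm_map]

lemma Rad.fderiv_isom {F : Eu n → ℝ} {f a g : ℝ → ℝ} (h : Rad n F f a g) (σ : Eu n ≃ₗᵢ[ℝ] Eu n)
    (x e : Eu n) : fderiv ℝ F (σ x) (σ e) = fderiv ℝ F x e := by
  have h1 : (fun y => F (σ y)) = F := funext fun y => h.isom σ y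
  have h2 : HasFDerivAt (fun y => F (σ y))
      ((fderiv ℝ F (σ x)).comp (σ.toContinuousLinearEquiv : Eu n →L[ℝ] Eu n)) x :=
    ((h.cF.differentiable (by norm_num)) (σ x)).hasFDerivAt.comp x
      (σ.toContinuousLinearEquiv : Eu n →L[ℝ] Eu n).hasFDerivAt
  rw [h1] at h2
  rw [h2.fderiv]
  rfl

lemma refl_self {e : Eu n} (he : ‖e‖ = 1) : refl e e = -e := by
  rw [refl_apply he, real_inner_self_eq_norm_sq, he]
  module

lemma Rad.fderiv_refl {F : Eu n → ℝ} {f a g : ℝ → ℝ} (h : Rad n F f a g) {e : Eu n} (he : ‖e‖ = 1)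
    (x : Eu n) : fderiv ℝ F (refl e x) e = -fderiv ℝ F x e := by
  have := h.fderiv_isom (refl e) x e
  rw [refl_self he, map_neg] at this
  linarith

lemma Rad.fderiv_refl_perp {F : Eu n → ℝ} {f a g : ℝ → ℝ} (h : Rad n F f a g) {e e' : Eu n}
    (he : ‖e‖ = 1) (hee : inner ℝ e e' = 0)
    (x : Eu n) : fderiv ℝ F (refl e x) e' = fderiv ℝ F x e' := by
  have := h.fderiv_isom (refl e) x e'
  rwa [refl_fix he hee] at this

lemma HS.anti {p q : ℝ} {U V : Eu n → ℝ} {u v a b : ℝ → ℝ} (g : GS n p q U V u v a b) {e : Eu n}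
    {C : ℝ} (hn : 5 ≤ n)
    (h : HS n e (fun x => p * V x ^ (p - 1)) (fun x => q * U x ^ (q - 1))
      (fun x => -fderiv ℝ U x e) (fun x => -fderiv ℝ V x e) C)
    (hl : Lin n (fun x => p * V x ^ (p - 1)) (fun x => q * U x ^ (q - 1)) w z) :
    ∃ c : ℝ, ∀ x, w x - w (refl e x) = c * fderiv ℝ U x e ∧ z x - z (refl e x) = c * fderiv ℝ V x e := by
  have he := h.he
  have hl2 := hl.sub (hl.isom (refl e) (fun x => by simp only [g.rv.isom])
    (fun x => by simp only [g.ru.isom]))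
  obtain ⟨M, hM⟩ := h.main hn (w := fun x => w x - w (refl e x)) (z := fun x => z x - z (refl e x))
    ⟨hl2.dw, hl2.dz, hl2.lw, hl2.lz, fun x hx => by simp only [refl_fix he hx, sub_self],
      fun x hx => by simp only [refl_fix he hx, sub_self], hl2.tw, hl2.tz⟩
  refine ⟨-M, fun x => ?_⟩
  rcases lt_trichotomy 0 (inner ℝ e x) with hx | hx | hx
  · obtain ⟨h1, h2⟩ := hM x hx
    constructor
    · linarith
    · linarith
  · rw [refl_fix he hx.symm, g.ru.grad_perp (by omega) hx.symm, g.rv.grad_perp (by omega) hx.symm]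
    simp
  · obtain ⟨h1, h2⟩ := hM (refl e x) (by rw [inner_refl he]; linarith)
    simp only [refl_refl, g.ru.fderiv_refl he, g.rv.fderiv_refl he] at h1 h2
    constructor
    · linarith
    · linarith

end
end LE

namespace LE

section
variable {n : ℕ}

lemma dil (hn : 5 ≤ n) {f a g b k : ℝ → ℝ} {s α β : ℝ} (hs : 0 < s)
    (hf : Flux n f a (fun r => g r ^ s)) (hg : Flux n g b k) (gpos : ∀ r, 0 ≤ r → 0 < g r)
    (kpos : ∀ r, 0 < r → 0 ≤ k r) (hαβ : 2 + α = s * β) :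
    Flux n (fun r => α * f r - a r / r ^ (n - 2)) (fun r => (α - (n - 2)) * a r + r ^ n * g r ^ s)
      (fun r => s * g r ^ (s - 1) * (β * g r - b r / r ^ (n - 2))) := by
  have hN : (5:ℝ) ≤ n := by exact_mod_cast hn
  obtain ⟨m, rfl⟩ := Nat.exists_eq_add_of_le' hn
  have e2 : m + 5 - 2 = m + 3 := by omega
  have e1 : m + 5 - 1 = m + 4 := by omega
  have hpos : ∀ r, 0 < r → 0 ≤ g r ^ s := fun r hr => Real.rpow_nonneg (gpos r hr.le).le s
  refine ⟨fun r hr => ?_, fun r hr => ?_, ?_, ?_, ?_⟩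
  · refine (((hf.df r hr).const_mul α).sub ((hf.da r hr).div (hasDerivAt_pow (m + 5 - 2) r)
      (by positivity))).congr_deriv ?_
    simp only [e1, e2]
    have e3 : m + 3 - 1 = m + 2 := by omega
    rw [e3]
    push_cast
    field_simp
    ring
  · refine (((hf.da r hr).const_mul (α - (((m + 5 : ℕ) : ℝ) - 2))).add ((hasDerivAt_pow (m + 5) r).mul
      (hg.d_pow gpos s hr))).congr_deriv ?_
    simp only [e1, e2]
    have h1 : g r ^ s = g r ^ (s - 1) * g r := by
      rw [Real.rpow_sub_one (gpos r hr.le).ne']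
      field_simp [(gpos r hr.le).ne']
    rw [h1]
    have h2 : α = s * β - 2 := by linarith
    rw [h2]
    push_cast
    field_simp
    ring
  · refine (continuousOn_const.mul hf.cf).sub ?_
    intro r hr
    rcases eq_or_lt_of_le (show 0 ≤ r from hr) with h0 | h0
    · rw [← h0]
      have hz : a 0 / 0 ^ (m + 5 - 2) = 0 := by rw [hf.a0, zero_div]
      unfold ContinuousWithinAt
      beta_reduce
      rw [hz]
      have hle : ∀ r, 0 ≤ r → a r / r ^ (m + 5 - 2) ≤ g 0 ^ s * r ^ 2 / ((m + 5 : ℕ):ℝ) := by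
        intro r hr
        rcases eq_or_lt_of_le hr with h0 | h0
        · rw [← h0, hz]; simp
        · have := hf.a_le (by omega) (T := r) (M := g 0 ^ s) (fun t ht _ =>
            Real.rpow_le_rpow (gpos t ht.le).le (hg.f_anti (by omega) kpos le_rfl ht.le) hs.le) hr le_rfl
          rw [div_le_iff₀ (by positivity), e2]
          refine this.trans (le_of_eq ?_)
          ring
      refine squeeze_zero' (t₀ := 𝓝[Set.Ici 0] (0:ℝ))
        (g := fun r => g 0 ^ s * r ^ 2 / ((m + 5 : ℕ):ℝ)) ?_ ?_ ?_
      · filter_upwards [self_mem_nhdsWithin] with r hr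
        have hr : 0 ≤ r := hr
        have := hf.a_nonneg (by omega) hpos hr
        positivity
      · filter_upwards [self_mem_nhdsWithin] with r hr using hle r hr
      · have : Continuous (fun r : ℝ => g 0 ^ s * r ^ 2 / ((m + 5 : ℕ):ℝ)) := by fun_prop
        have h := this.tendsto 0
        simp only [ne_eq, OfNat.ofNat_ne_zero, not_false_eq_true, zero_pow, mul_zero, zero_div] at h
        exact h.mono_left nhdsWithin_le_nhds
    · exact ((hf.da r h0).continuousAt.div (continuous_id.pow _).continuousAt
        (by show r ^ (m + 5 - 2) ≠ 0; positivity)).continuousWithinAt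
  · exact (continuousOn_const.mul hf.ca).add ((continuous_id.pow (m + 5)).continuousOn.mul
      (hg.cf.rpow_const fun x hx => Or.inr hs.le))
  · simp [hf.a0]

lemma uniq_pos (hn : 1 ≤ n) {F G A B P Q : ℝ → ℝ} (hF : Flux n F A (fun r => P r * G r))
    (hG : Flux n G B (fun r => Q r * F r)) (hP : ∀ r, 0 ≤ r → 0 ≤ P r) (hQ : ∀ r, 0 ≤ r → 0 ≤ Q r)
    (F0 : F 0 = 0) (tG : Tendsto G atTop (𝓝 0)) : ¬ 0 < G 0 := by
  intro h0
  have step : ∀ T, 0 ≤ T → (∀ s, 0 < s → s < T → 0 ≤ G s) → G 0 ≤ G T := by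
    intro T hT hpos
    have h1 : ∀ s, 0 < s → s < T → F s ≤ 0 := by
      intro s hs hsT
      have := hF.f_le hn (T := T) (M := 0) (fun t ht htT => mul_nonneg (hP t ht.le) (hpos t ht htT))
        hs.le hsT.le
      simpa [F0] using this
    have := hG.f_ge hn (T := T) (M := 0) (fun t ht htT =>
      mul_nonpos_of_nonneg_of_nonpos (hQ t ht.le) (h1 t ht htT)) hT le_rfl
    simpa using this
  have pos : ∀ r, 0 ≤ r → 0 < G r := by
    by_contra hc
    push Not at hc
    obtain ⟨R, hR, hGR⟩ := hc
    have hcl : IsCompact (Set.Icc 0 R ∩ G ⁻¹' Set.Iic 0) := by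
      refine isCompact_Icc.of_isClosed_subset ?_ Set.inter_subset_left
      exact (hG.cf.mono fun x hx => hx.1).preimage_isClosed_of_isClosed isClosed_Icc isClosed_Iic
    obtain ⟨T, ⟨hT1, hT2⟩, hT⟩ := hcl.exists_isLeast ⟨R, ⟨hR, le_rfl⟩, hGR⟩
    have hT2 : G T ≤ 0 := hT2
    have := step T hT1.1 (fun s hs hsT => by
      by_contra hneg
      have := hT ⟨⟨hs.le, hsT.le.trans hT1.2⟩, (not_le.1 hneg).le⟩
      linarith)
    linarith
  have h1 : ∀ᶠ r in atTop, G 0 ≤ G r := by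
    filter_upwards [eventually_ge_atTop 0] with r hr using step r hr fun s hs _ => (pos s hs.le).le
  have := ge_of_tendsto tG h1
  linarith

lemma uniq (hn : 1 ≤ n) {F G A B P Q : ℝ → ℝ} (hF : Flux n F A (fun r => P r * G r))
    (hG : Flux n G B (fun r => Q r * F r)) (hP : ∀ r, 0 ≤ r → 0 ≤ P r) (hQ : ∀ r, 0 ≤ r → 0 ≤ Q r)
    (cP : ContinuousOn P (Set.Ici 0)) (cQ : ContinuousOn Q (Set.Ici 0))
    (F0 : F 0 = 0) (tG : Tendsto G atTop (𝓝 0)) : ∀ r, 0 ≤ r → F r = 0 ∧ G r = 0 := by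
  have h1 := uniq_pos hn hF hG hP hQ F0 tG
  have h2 := uniq_pos hn (F := fun r => - F r) (G := fun r => - G r)
    (hF.neg.congr fun r _ => by ring) (hG.neg.congr fun r _ => by ring) hP hQ (by simp [F0])
    (by simpa using tG.neg)
  have G0 : G 0 = 0 := by
    simp only [Left.neg_pos_iff] at h2
    exact le_antisymm (not_lt.1 h1) (not_lt.1 h2)
  intro r hr
  obtain ⟨C1, hC1⟩ := (isCompact_Icc (a := (0:ℝ)) (b := r)).exists_bound_of_continuousOn
    (cP.mono fun x hx => hx.1)
  obtain ⟨C2, hC2⟩ := (isCompact_Icc (a := (0:ℝ)) (b := r)).exists_bound_of_continuousOn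
    (cQ.mono fun x hx => hx.1)
  set C := max (max C1 C2) 0 with hC
  obtain ⟨L, hL, hV⟩ := volterra hn hr (C := C) (le_max_right _ _)
  have key := hV F A _ G B _ 0 le_rfl hF hG (by simp [F0]) (by simp [G0])
    (fun s hs hsr => by
      have h3 := hC1 s ⟨hs.le, hsr⟩
      rw [Real.norm_eq_abs] at h3
      have h4 : |P s| ≤ C := h3.trans ((le_max_left _ _).trans (le_max_left _ _))
      rw [abs_mul, add_zero]
      exact mul_le_mul h4 (by linarith [abs_nonneg (F s)]) (abs_nonneg _) (le_max_right _ _))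
    (fun s hs hsr => by
      have h3 := hC2 s ⟨hs.le, hsr⟩
      rw [Real.norm_eq_abs] at h3
      have h4 : |Q s| ≤ C := h3.trans ((le_max_right _ _).trans (le_max_left _ _))
      rw [abs_mul, add_zero]
      exact mul_le_mul h4 (by linarith [abs_nonneg (G s)]) (abs_nonneg _) (le_max_right _ _))
    r hr le_rfl
  simp only [mul_zero] at key
  exact ⟨abs_nonpos_iff.1 key.1, abs_nonpos_iff.1 key.2.1⟩

lemma dil_tendsto (hn : 3 ≤ n) {f a g : ℝ → ℝ} (h : Flux n f a g)
    (hg : ∀ r, 0 < r → 0 ≤ g r) (hf : Tendsto f atTop (𝓝 0)) (α : ℝ) :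
    Tendsto (fun r => α * f r - a r / r ^ (n - 2)) atTop (𝓝 0) := by
  have h1 : Tendsto (fun r => a r / r ^ (n - 2)) atTop (𝓝 0) := by
    refine squeeze_zero' ?_ ?_ (g := fun r => (n - 2) * f r) (by simpa using hf.const_mul ((n:ℝ) - 2))
    · filter_upwards [eventually_gt_atTop 0] with r hr
      have := h.a_nonneg (by omega) hg hr.le
      positivity
    · filter_upwards [eventually_gt_atTop 0] with r hr using h.a_div_le hn hg hf hr
  simpa using (hf.const_mul α).sub h1

lemma ode_mode (hn : 5 ≤ n) {p q : ℝ} {u v a b : ℝ → ℝ} (h : RadSol n p q u v a b)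
    {F G A B : ℝ → ℝ} (hF : Flux n F A (fun r => p * v r ^ (p - 1) * G r))
    (hG : Flux n G B (fun r => q * u r ^ (q - 1) * F r)) (tG : Tendsto G atTop (𝓝 0)) :
    ∃ c : ℝ, ∀ r, 0 ≤ r → F r = c * (n / (q + 1) * u r - a r / r ^ (n - 2)) ∧
      G r = c * (n / (p + 1) * v r - b r / r ^ (n - 2)) := by
  have hp := h.hp
  have hq := h.hq
  obtain ⟨s1, s2, s3⟩ := h.swap' (by omega)
  have hN : (5:ℝ) ≤ n := by exact_mod_cast hn
  have hα : (0:ℝ) < n / (q + 1) := by positivity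
  have d1 := dil hn hp h.fu h.fv h.vpos h.gu s2
  have d2 := dil hn hq h.fv h.fu h.upos h.gv s3
  set c := F 0 / (n / (q + 1)) with hc
  refine ⟨c, fun r hr => ?_⟩
  have tG' := tG.sub ((dil_tendsto (by omega) h.fv h.gu h.tv (n / (p + 1))).const_mul c)
  simp only [mul_zero, sub_zero] at tG'
  have := uniq (by omega) (P := fun r => p * v r ^ (p - 1)) (Q := fun r => q * u r ^ (q - 1))
    ((hF.sub (d1.cmul c)).congr fun r _ => by ring) ((hG.sub (d2.cmul c)).congr fun r _ => by ring)
    (fun r hr => by have := h.vpos r hr; positivity) (fun r hr => by have := h.upos r hr; positivity)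
    (continuousOn_const.mul (h.fv.cf.rpow_const fun x hx => Or.inl (h.vpos x hx).ne'))
    (continuousOn_const.mul (h.fu.cf.rpow_const fun x hx => Or.inl (h.upos x hx).ne'))
    (by simp only [h.fu.a0, h.u0, hc]; field_simp; simp) tG' r hr
  exact ⟨by linarith [this.1], by linarith [this.2]⟩

end
end LE

namespace LE

section
variable {n : ℕ}

lemma grad_self (hn : 3 ≤ n) {F : Eu n → ℝ} {f a g : ℝ → ℝ} (h : Rad n F f a g) (x : Eu n) :
    fderiv ℝ F x x = -(a ‖x‖ / ‖x‖ ^ (n - 2)) := by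
  rcases eq_or_ne x 0 with rfl | hx
  · simp [h.fl.a0]
  · have hr : 0 < ‖x‖ := norm_pos_iff.2 hx
    have h1 := h.grad (by omega) hx x
    rw [real_inner_self_eq_norm_sq] at h1
    have h2 : ‖x‖ ^ n = ‖x‖ ^ (n - 2) * ‖x‖ ^ 2 := by rw [← pow_add]; congr 1; omega
    rw [h2] at h1
    have h3 : ‖x‖ ^ 2 * (a ‖x‖ / (‖x‖ ^ (n - 2) * ‖x‖ ^ 2)) = a ‖x‖ / ‖x‖ ^ (n - 2) := by
      field_simp
    linarith

lemma radial_mode (hn : 5 ≤ n) {p q : ℝ} {U V w z : Eu n → ℝ} {u v a b : ℝ → ℝ}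
    (g : GS n p q U V u v a b)
    (hl : Lin n (fun x => p * V x ^ (p - 1)) (fun x => q * U x ^ (q - 1)) w z)
    (rw_ : ∀ x y, ‖x‖ = ‖y‖ → w x = w y) (rz : ∀ x y, ‖x‖ = ‖y‖ → z x = z y) :
    ∃ c : ℝ, ∀ x, w x = c * (fderiv ℝ U x x + n / (q + 1) * U x) ∧
      z x = c * (fderiv ℝ V x x + n / (p + 1) * V x) := by
  obtain ⟨e, he⟩ := exists_unit (n := n) (by omega)
  have hne : ∀ r : ℝ, 0 < r → ‖r • e‖ = r := fun r hr => by
    rw [norm_smul, he, mul_one, Real.norm_of_nonneg hr.le]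
  have f1 := (flux_of_radial (by omega) hl.dw rw_ he).congr
    (g' := fun r => p * v r ^ (p - 1) * z (r • e)) fun r hr => by
      rw [hl.lw, g.rv.eF, hne r hr]
  have f2 := (flux_of_radial (by omega) hl.dz rz he).congr
    (g' := fun r => q * u r ^ (q - 1) * w (r • e)) fun r hr => by
      rw [hl.lz, g.ru.eF, hne r hr]
  obtain ⟨c, hc⟩ := ode_mode hn g.rs f1 f2 (rad_tendsto hl.tz he)
  refine ⟨c, fun x => ?_⟩
  obtain ⟨h1, h2⟩ := hc ‖x‖ (norm_nonneg _)
  have hx : ‖x‖ = ‖‖x‖ • e‖ := by simp [norm_smul, he]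
  rw [rw_ _ _ hx, rz _ _ hx, h1, h2, grad_self (by omega) g.ru, grad_self (by omega) g.rv,
    g.ru.eF, g.rv.eF]
  constructor <;> ring

lemma refl_swap {x y : Eu n} (hxy : ‖x‖ = ‖y‖) (hne : x ≠ y) :
    ∃ e : Eu n, ‖e‖ = 1 ∧ refl e x = y := by
  have hd : 0 < ‖x - y‖ := norm_pos_iff.2 (sub_ne_zero.2 hne)
  have he : ‖‖x - y‖⁻¹ • (x - y)‖ = 1 := by
    rw [norm_smul, norm_inv, norm_norm]; field_simp
  refine ⟨‖x - y‖⁻¹ • (x - y), he, ?_⟩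
  rw [refl_apply he, real_inner_smul_left, inner_sub_left, real_inner_self_eq_norm_sq, smul_smul]
  have h1 : ‖x - y‖ ^ 2 = 2 * (‖x‖ ^ 2 - inner ℝ y x) := by
    rw [norm_sub_sq_real, ← hxy, real_inner_comm]; ring
  have h2 : 2 * (‖x - y‖⁻¹ * (‖x‖ ^ 2 - inner ℝ y x)) * ‖x - y‖⁻¹ = 1 := by
    field_simp
    linarith
  rw [h2]
  module

lemma even_of_flips {f : Eu n → ℝ}
    (h : ∀ i x, f (refl (EuclideanSpace.single i 1) x) = f x) (x : Eu n) : f (-x) = f x := by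
  have he : ∀ i : Fin n, ‖(EuclideanSpace.single i 1 : Eu n)‖ = 1 := fun i => by simp
  have key : ∀ s : Finset (Fin n),
      f (x - ∑ i ∈ s, (2 * x i) • (EuclideanSpace.single i 1 : Eu n)) = f x := by
    intro s
    induction s using Finset.induction_on with
    | empty => simp
    | insert i s hi ih =>
      rw [← ih, ← h i (x - ∑ i ∈ s, (2 * x i) • (EuclideanSpace.single i 1 : Eu n)),
        refl_apply (he i), Finset.sum_insert hi]
      congr 1
      have h1 : inner ℝ (EuclideanSpace.single i 1 : Eu n)
          (x - ∑ j ∈ s, (2 * x j) • (EuclideanSpace.single j 1 : Eu n)) = x i := by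
        rw [inner_sub_right, inner_sum]
        have : ∀ j ∈ s, inner ℝ (EuclideanSpace.single i 1 : Eu n)
            ((2 * x j) • (EuclideanSpace.single j 1 : Eu n)) = 0 := by
          intro j hj
          have hij : i ≠ j := by rintro rfl; exact hi hj
          simp [EuclideanSpace.inner_single_left, hij]
        rw [Finset.sum_eq_zero this]
        simp [EuclideanSpace.inner_single_left]
      rw [h1]
      abel
  have h2 : x - ∑ i, (2 * x i) • (EuclideanSpace.single i 1 : Eu n) = -x := by
    ext j
    simp [Finset.sum_apply, Pi.single_apply]
    ring
  rw [← h2, key]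

/-- For odd functions, anti-symmetry defects determine the function. -/
lemma odd_mode {w F : Eu n → ℝ} {f a g : ℝ → ℝ} (h : Rad n F f a g) (hw : ∀ x, w (-x) = - w x)
    (c : Fin n → ℝ) (hc : ∀ i x, w x - w (refl (EuclideanSpace.single i 1) x)
      = c i * fderiv ℝ F x (EuclideanSpace.single i 1)) (x : Eu n) :
    w x = ∑ j, c j / 2 * fderiv ℝ F x (EuclideanSpace.single j 1) := by
  have hodd : ∀ (x e : Eu n), fderiv ℝ F (-x) e = - fderiv ℝ F x e := by
    intro x e
    have := h.fderiv_isom (LinearIsometryEquiv.neg ℝ) x e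
    simp only [LinearIsometryEquiv.coe_neg, map_neg] at this
    linarith
  have he : ∀ i : Fin n, ‖(EuclideanSpace.single i 1 : Eu n)‖ = 1 := fun i => by simp
  have hev := even_of_flips (f := fun x => w x - ∑ j, c j / 2 * fderiv ℝ F x (EuclideanSpace.single j 1))
    (fun i x => by
      have h1 : ∀ j, c j / 2 * fderiv ℝ F (refl (EuclideanSpace.single i 1) x) (EuclideanSpace.single j 1)
          = c j / 2 * fderiv ℝ F x (EuclideanSpace.single j 1) -
            if i = j then c i * fderiv ℝ F x (EuclideanSpace.single i 1) else 0 := by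
        intro j
        split_ifs with hij
        · subst hij
          rw [h.fderiv_refl (he i)]; ring
        · rw [h.fderiv_refl_perp (he i) (by simp [EuclideanSpace.inner_single_left, hij])]; ring
      simp only [h1, Finset.sum_sub_distrib, Finset.sum_ite_eq, Finset.mem_univ, if_true]
      linarith [hc i x]) x
  simp only [hw, hodd, mul_neg, Finset.sum_neg_distrib] at hev
  linarith

theorem nondeg (hn : 5 ≤ n) {p q : ℝ} {U V w z : Eu n → ℝ} {u v a b : ℝ → ℝ}
    (g : GS n p q U V u v a b)
    {C : ℝ} (hC : 0 < C) (hb : ∀ r, 0 ≤ r → b r ≤ C)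
    (h1 : ∀ r, 1 ≤ r → p * v r ^ (p - 1) ≤ C * r)
    (h2 : ∀ r, 1 ≤ r → q * u r ^ (q - 1) ≤ C * (r ^ 7)⁻¹)
    (hl : Lin n (fun x => p * V x ^ (p - 1)) (fun x => q * U x ^ (q - 1)) w z) :
    ∃ (c : Fin n → ℝ) (c₀ : ℝ),
      (∀ x, w x = (∑ j, c j * fderiv ℝ U x (EuclideanSpace.single j 1)) +
        c₀ * (fderiv ℝ U x x + n / (q + 1) * U x)) ∧
      (∀ x, z x = (∑ j, c j * fderiv ℝ V x (EuclideanSpace.single j 1)) +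
        c₀ * (fderiv ℝ V x x + n / (p + 1) * V x)) := by
  have anti : ∀ (w z : Eu n → ℝ), Lin n (fun x => p * V x ^ (p - 1)) (fun x => q * U x ^ (q - 1)) w z →
      ∀ e : Eu n, ‖e‖ = 1 → ∃ c : ℝ, ∀ x, w x - w (refl e x) = c * fderiv ℝ U x e ∧
        z x - z (refl e x) = c * fderiv ℝ V x e := by
    intro w z hl e he
    obtain ⟨C', hs⟩ := g.hs hn hC hb h1 h2 he
    exact hs.anti g hn hl
  have hneg := hl.isom (LinearIsometryEquiv.neg ℝ) (fun x => by simp only [g.rv.isom])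
    (fun x => by simp only [g.ru.isom])
  simp only [LinearIsometryEquiv.coe_neg] at hneg
  have hev := (hl.cmul (1 / 2)).sub (hneg.cmul (-1 / 2))
  have hod := (hl.cmul (1 / 2)).sub (hneg.cmul (1 / 2))
  have hoddU : ∀ (x e : Eu n), fderiv ℝ U (-x) e = - fderiv ℝ U x e := by
    intro x e
    have := g.ru.fderiv_isom (LinearIsometryEquiv.neg ℝ) x e
    simp only [LinearIsometryEquiv.coe_neg, map_neg] at this
    linarith
  have hoddV : ∀ (x e : Eu n), fderiv ℝ V (-x) e = - fderiv ℝ V x e := by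
    intro x e
    have := g.rv.fderiv_isom (LinearIsometryEquiv.neg ℝ) x e
    simp only [LinearIsometryEquiv.coe_neg, map_neg] at this
    linarith
  set we : Eu n → ℝ := fun x => 1 / 2 * w x - -1 / 2 * w (-x) with hwe
  set ze : Eu n → ℝ := fun x => 1 / 2 * z x - -1 / 2 * z (-x) with hze
  set wo : Eu n → ℝ := fun x => 1 / 2 * w x - 1 / 2 * w (-x) with hwo
  set zo : Eu n → ℝ := fun x => 1 / 2 * z x - 1 / 2 * z (-x) with hzo
  have we_even : ∀ x, we (-x) = we x := fun x => by simp only [hwe, neg_neg]; ring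
  have ze_even : ∀ x, ze (-x) = ze x := fun x => by simp only [hze, neg_neg]; ring
  have wo_odd : ∀ x, wo (-x) = - wo x := fun x => by simp only [hwo, neg_neg]; ring
  have zo_odd : ∀ x, zo (-x) = - zo x := fun x => by simp only [hzo, neg_neg]; ring
  have inv : ∀ e : Eu n, ‖e‖ = 1 → ∀ x, we (refl e x) = we x ∧ ze (refl e x) = ze x := by
    intro e he x
    obtain ⟨c, hc⟩ := anti we ze hev e he
    obtain ⟨a1, a2⟩ := hc x
    obtain ⟨b1, b2⟩ := hc (-x)
    rw [map_neg, we_even, we_even, hoddU] at b1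
    rw [map_neg, ze_even, ze_even, hoddV] at b2
    constructor
    · linarith
    · linarith
  have radial : ∀ x y, ‖x‖ = ‖y‖ → we x = we y ∧ ze x = ze y := by
    intro x y hxy
    by_cases hne : x = y
    · subst hne; exact ⟨rfl, rfl⟩
    · obtain ⟨e, he, hr⟩ := refl_swap hxy hne
      obtain ⟨i1, i2⟩ := inv e he x
      rw [hr] at i1 i2
      exact ⟨i1.symm, i2.symm⟩
  obtain ⟨c₀, hc₀⟩ := radial_mode hn g hev (fun x y h => (radial x y h).1) (fun x y h => (radial x y h).2)
  choose c hc using fun i : Fin n => anti wo zo hod (EuclideanSpace.single i 1) (by simp)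
  have o1 := odd_mode g.ru wo_odd c (fun i x => (hc i x).1)
  have o2 := odd_mode g.rv zo_odd c (fun i x => (hc i x).2)
  refine ⟨fun j => c j / 2, c₀, fun x => ?_, fun x => ?_⟩
  · rw [← o1 x, ← (hc₀ x).1]; simp only [hwe, hwo]; ring
  · rw [← o2 x, ← (hc₀ x).2]; simp only [hze, hzo]; ring

end
end LE

theorem nondegeneracy_near_one (n : ℕ) (hn : 5 ≤ n) :
    ∃ ε₁ : ℝ, 0 < ε₁ ∧
      ∀ p q : ℝ, 0 < p → 0 < q →
        1 / (p + 1) + 1 / (q + 1) = ((n : ℝ) - 2) / n →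
        |p - 1| ≤ ε₁ →
        ∀ U V : EuclideanSpace ℝ (Fin n) → ℝ, IsGroundState n p q U V →
        ∀ φ ψ : EuclideanSpace ℝ (Fin n) → ℝ,
          ContDiff ℝ 2 φ → ContDiff ℝ 2 ψ →
          (∀ x, -lap φ x = p * V x ^ (p - 1) * ψ x) →
          (∀ x, -lap ψ x = q * U x ^ (q - 1) * φ x) →
          Tendsto φ (cocompact _) (nhds 0) →
          Tendsto ψ (cocompact _) (nhds 0) →
          ∃ (c : Fin n → ℝ) (c₀ : ℝ),
            (∀ x, φ x = (∑ j, c j * fderiv ℝ U x (EuclideanSpace.single j 1)) +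
              c₀ * (fderiv ℝ U x x + ((n : ℝ) - 2 - (n : ℝ) / (p + 1)) * U x)) ∧
            (∀ x, ψ x = (∑ j, c j * fderiv ℝ V x (EuclideanSpace.single j 1)) +
              c₀ * (fderiv ℝ V x x + ((n : ℝ) - 2 - (n : ℝ) / (q + 1)) * V x)) := by
  obtain ⟨ε, hε, hdec⟩ := LE.decay hn
  refine ⟨ε, hε, ?_⟩
  intro p q hp hq hyp hpe U V hGS φ ψ cφ cψ lφ lψ tφ tψ
  obtain ⟨u, v, a, b, g⟩ := LE.exists_gs hn hp hq hyp hGS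
  obtain ⟨C, hC, hb, h1, h2⟩ := hdec p q u v a b g.rs hpe
  obtain ⟨s1, -, -⟩ := g.rs.swap' (by omega)
  obtain ⟨c, c₀, k1, k2⟩ := LE.nondeg hn g hC hb h1 h2 ⟨cφ, cψ, lφ, lψ, tφ, tψ⟩
  have e1 : (n : ℝ) - 2 - (n : ℝ) / (p + 1) = n / (q + 1) := by linarith
  have e2 : (n : ℝ) - 2 - (n : ℝ) / (q + 1) = n / (p + 1) := by linarith
  refine ⟨c, c₀, ?_, ?_⟩
  · rw [e1]; exact k1
  · rw [e2]; exact k2
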